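/- Let W be a finite Coxeter group acting on ℝ^n with positive roots R_+ normalized so that (α,α)=2, and with degrees d_1,…,d_n of basic invariants. Then for Re(k) ≥ 0, (2π)^{-n/2} ∫_{ℝ^n} ∏_{α∈R_+} |(α,x)|^{2k} e^{-|x|²/2} dx = ∏_{j=1}^n Γ(1+k d_j)/Γ(1+k). -/

import Mathlib

open MeasureTheory Complex Finset

noncomputable section

/-- The standard dot product on `ℝ^n`. -/
def dotR {n : ℕ} (x y : Fin n → ℝ) : ℝ := ∑ i, x i * y i

/-- The set of orthogonal reflections `s_α : x ↦ x - (α,x)α` (for `(α,α)=2`)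
in the hyperplanes orthogonal to the vectors of `R`. -/
def reflSet {n : ℕ} (R : Finset (Fin n → ℝ)) :
    Set ((Fin n → ℝ) ≃ₗ[ℝ] (Fin n → ℝ)) :=
  { e | ∃ α ∈ R, ∀ x, e x = x - dotR α x • α }

/-- The group generated by the reflections in the hyperplanes orthogonal to `R`. -/
def coxGroup {n : ℕ} (R : Finset (Fin n → ℝ)) :
    Subgroup ((Fin n → ℝ) ≃ₗ[ℝ] (Fin n → ℝ)) :=
  Subgroup.closure (reflSet R)

/-- Data of a finite Coxeter group `W` acting on `ℝ^n`: a system `R` of positive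
roots, normalised by `(α,α) = 2`, generating a finite reflection group, together
with the degrees `d j` of a system of basic homogeneous algebraically independent
generators `P j` of the algebra of `W`-invariant polynomials. -/
structure CoxeterData (n : ℕ) where
  /-- the positive roots -/
  R : Finset (Fin n → ℝ)
  norm2 : ∀ α ∈ R, dotR α α = 2
  noncollinear : ∀ α ∈ R, ∀ β ∈ R, α ≠ β → ∀ c : ℝ, β ≠ c • α
  pos : ∃ v, ∀ α ∈ R, 0 < dotR α v
  finiteW : Finite (coxGroup R)
  stableR : ∀ e ∈ coxGroup R, ∀ α ∈ R, ((e : (Fin n → ℝ) ≃ₗ[ℝ] (Fin n → ℝ)) α ∈ R ∨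
      -((e : (Fin n → ℝ) ≃ₗ[ℝ] (Fin n → ℝ)) α) ∈ R)
  /-- the degrees of the basic invariants -/
  d : Fin n → ℕ
  /-- the basic invariants -/
  P : Fin n → MvPolynomial (Fin n) ℝ
  homog : ∀ j, (P j).IsHomogeneous (d j)
  invP : ∀ j, ∀ e ∈ coxGroup R, ∀ x : Fin n → ℝ,
    MvPolynomial.eval ((e : (Fin n → ℝ) ≃ₗ[ℝ] (Fin n → ℝ)) x) (P j) = MvPolynomial.eval x (P j)
  algInd : AlgebraicIndependent ℝ P
  gen : ∀ q : MvPolynomial (Fin n) ℝ,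
    (∀ e ∈ coxGroup R, ∀ x : Fin n → ℝ,
      MvPolynomial.eval ((e : (Fin n → ℝ) ≃ₗ[ℝ] (Fin n → ℝ)) x) q = MvPolynomial.eval x q) →
    q ∈ Algebra.adjoin ℝ (Set.range P)

end

namespace MacdonaldMehta

/-! ### Roots, reflections and chambers -/

section

variable {n : ℕ}

lemma dotR_comm (x y : Fin n → ℝ) : dotR x y = dotR y x := by
  simp [dotR, mul_comm]

lemma dotR_add (x y z : Fin n → ℝ) : dotR x (y + z) = dotR x y + dotR x z := by
  simp [dotR, mul_add, sum_add_distrib]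

lemma dotR_smul (c : ℝ) (x y : Fin n → ℝ) : dotR x (c • y) = c * dotR x y := by
  simp only [dotR, Pi.smul_apply, smul_eq_mul, mul_sum]
  exact sum_congr rfl fun i _ => by ring

lemma dotR_neg (x y : Fin n → ℝ) : dotR x (-y) = -dotR x y := by
  simp [dotR]

lemma dotR_sub (x y z : Fin n → ℝ) : dotR x (y - z) = dotR x y - dotR x z := by
  simp [dotR, mul_sub]

lemma dotR_zero (x : Fin n → ℝ) : dotR x 0 = 0 := by simp [dotR]

lemma add_dotR (x y z : Fin n → ℝ) : dotR (x + y) z = dotR x z + dotR y z := by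
  simp [dotR, add_mul, sum_add_distrib]

lemma smul_dotR (c : ℝ) (x y : Fin n → ℝ) : dotR (c • x) y = c * dotR x y := by
  rw [dotR_comm, dotR_smul, dotR_comm]

lemma neg_dotR (x y : Fin n → ℝ) : dotR (-x) y = -dotR x y := by
  simp [dotR]

lemma sub_dotR (x y z : Fin n → ℝ) : dotR (x - y) z = dotR x z - dotR y z := by
  simp [dotR, sub_mul]

lemma dotR_self_nonneg (x : Fin n → ℝ) : 0 ≤ dotR x x :=
  sum_nonneg fun i _ => mul_self_nonneg (x i)

lemma dotR_self_eq_zero {x : Fin n → ℝ} : dotR x x = 0 ↔ x = 0 := by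
  constructor
  · intro h
    have := (sum_eq_zero_iff_of_nonneg fun i _ => mul_self_nonneg (x i)).1 h
    funext i
    simpa using this i (mem_univ i)
  · rintro rfl
    exact dotR_zero 0

lemma ext_dotR {x y : Fin n → ℝ} (h : ∀ z, dotR z x = dotR z y) : x = y := by
  have := h (x - y)
  rw [← sub_eq_zero, ← dotR_sub, dotR_self_eq_zero, sub_eq_zero] at this
  exact this

/-- `y ↦ (x, y)` as a linear map. -/
def dotL (x : Fin n → ℝ) : (Fin n → ℝ) →ₗ[ℝ] ℝ where
  toFun := dotR x
  map_add' := dotR_add x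
  map_smul' c y := by simp [dotR_smul]

@[simp] lemma dotL_apply (x y : Fin n → ℝ) : dotL x y = dotR x y := rfl

lemma continuous_dotR (x : Fin n → ℝ) : Continuous fun y => dotR x y := by
  unfold dotR; fun_prop

/-- The linear map `x ↦ x - (α,x)α`. -/
def reflL (α : Fin n → ℝ) : (Fin n → ℝ) →ₗ[ℝ] (Fin n → ℝ) :=
  LinearMap.id - (dotL α).smulRight α

lemma reflL_apply (α x : Fin n → ℝ) : reflL α x = x - dotR α x • α := rfl

lemma reflL_involutive {α : Fin n → ℝ} (h : dotR α α = 2) : Function.Involutive (reflL α) := by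
  intro x
  simp only [reflL_apply, dotR_sub, dotR_smul, h]
  module

/-- The reflection in the hyperplane orthogonal to `α`. -/
def refl (α : Fin n → ℝ) (h : dotR α α = 2) : (Fin n → ℝ) ≃ₗ[ℝ] (Fin n → ℝ) :=
  LinearEquiv.ofInvolutive (reflL α) (reflL_involutive h)

lemma refl_apply {α : Fin n → ℝ} (h : dotR α α = 2) (x : Fin n → ℝ) :
    refl α h x = x - dotR α x • α := rfl

lemma refl_self {α : Fin n → ℝ} (h : dotR α α = 2) : refl α h α = -α := by
  rw [refl_apply, h]; module

lemma refl_mul_self {α : Fin n → ℝ} (h : dotR α α = 2) : refl α h * refl α h = 1 := by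
  ext1 x
  exact reflL_involutive h x

lemma refl_inv {α : Fin n → ℝ} (h : dotR α α = 2) : (refl α h)⁻¹ = refl α h :=
  inv_eq_of_mul_eq_one_left (refl_mul_self h)

/-- The properties of a set of positive roots of a finite reflection group. -/
structure RootSys (R : Finset (Fin n → ℝ)) : Prop where
  norm2 : ∀ α ∈ R, dotR α α = 2
  noncollinear : ∀ α ∈ R, ∀ β ∈ R, α ≠ β → ∀ c : ℝ, β ≠ c • α
  pos : ∃ v, ∀ α ∈ R, 0 < dotR α v
  finiteW : Finite (coxGroup R)
  stableR : ∀ e ∈ coxGroup R, ∀ α ∈ R, ((e : (Fin n → ℝ) ≃ₗ[ℝ] (Fin n → ℝ)) α ∈ R ∨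
      -((e : (Fin n → ℝ) ≃ₗ[ℝ] (Fin n → ℝ)) α) ∈ R)

lemma _root_.CoxeterData.rootSys (C : CoxeterData n) : RootSys C.R :=
  ⟨C.norm2, C.noncollinear, C.pos, C.finiteW, C.stableR⟩

variable {R : Finset (Fin n → ℝ)}

lemma refl_mem {α : Fin n → ℝ} (h : dotR α α = 2) (hα : α ∈ R) : refl α h ∈ coxGroup R :=
  Subgroup.subset_closure ⟨α, hα, fun _ => rfl⟩

lemma RootSys.closure_eq (hR : RootSys R) {e : (Fin n → ℝ) ≃ₗ[ℝ] (Fin n → ℝ)}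
    (he : e ∈ reflSet R) : ∃ α, ∃ h : α ∈ R, e = refl α (hR.norm2 α h) := by
  obtain ⟨α, hα, h⟩ := he
  exact ⟨α, hα, LinearEquiv.ext fun x => h x⟩

lemma RootSys.dotR_map (hR : RootSys R) {e : (Fin n → ℝ) ≃ₗ[ℝ] (Fin n → ℝ)}
    (he : e ∈ coxGroup R) (x y : Fin n → ℝ) : dotR (e x) (e y) = dotR x y := by
  induction he using Subgroup.closure_induction generalizing x y with
  | mem e he =>
    obtain ⟨α, hα, rfl⟩ := hR.closure_eq he
    simp only [refl_apply, dotR_sub, sub_dotR, smul_dotR, dotR_smul, hR.norm2 α hα,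
      dotR_comm x α]
    ring
  | one => rfl
  | mul a b _ _ ha hb => rw [LinearEquiv.mul_apply, LinearEquiv.mul_apply, ha, hb]
  | inv a _ ha =>
    rw [← ha]
    simp only [← LinearEquiv.mul_apply, mul_inv_cancel]; rfl

lemma RootSys.dotR_map_left (hR : RootSys R) {e : (Fin n → ℝ) ≃ₗ[ℝ] (Fin n → ℝ)}
    (he : e ∈ coxGroup R) (x y : Fin n → ℝ) : dotR (e x) y = dotR x (e⁻¹ y) := by
  rw [← hR.dotR_map he x (e⁻¹ y), ← LinearEquiv.mul_apply, mul_inv_cancel]; rfl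

lemma RootSys.dotR_map_right (hR : RootSys R) {e : (Fin n → ℝ) ≃ₗ[ℝ] (Fin n → ℝ)}
    (he : e ∈ coxGroup R) (x y : Fin n → ℝ) : dotR x (e y) = dotR (e⁻¹ x) y := by
  rw [dotR_comm, hR.dotR_map_left he, dotR_comm]

lemma RootSys.neg_notMem (hR : RootSys R) {α : Fin n → ℝ} (hα : α ∈ R) : -α ∉ R := by
  intro h
  obtain ⟨v, hv⟩ := hR.pos
  have := hv _ h
  rw [neg_dotR] at this
  linarith [hv α hα]

lemma coxGroup_mono {R S : Finset (Fin n → ℝ)} (h : S ⊆ R) : coxGroup S ≤ coxGroup R :=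
  Subgroup.closure_mono fun _ ⟨α, hα, he⟩ => ⟨α, h hα, he⟩

/-- The positive roots vanishing at `x`. -/
noncomputable def para (R : Finset (Fin n → ℝ)) (x : Fin n → ℝ) : Finset (Fin n → ℝ) :=
  R.filter fun α => dotR α x = 0

lemma mem_para {x α : Fin n → ℝ} : α ∈ para R x ↔ α ∈ R ∧ dotR α x = 0 := by
  simp [para]

lemma para_subset (x : Fin n → ℝ) : para R x ⊆ R := filter_subset _ _

lemma para_fix {x : Fin n → ℝ} {e : (Fin n → ℝ) ≃ₗ[ℝ] (Fin n → ℝ)}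
    (he : e ∈ coxGroup (para R x)) (y : Fin n → ℝ) (hy : ∀ α ∈ para R x, dotR α y = 0) :
    e y = y := by
  induction he using Subgroup.closure_induction with
  | mem e he =>
    obtain ⟨α, hα, h⟩ := he
    rw [h, hy α hα]; module
  | one => rfl
  | mul a b _ _ ha hb => rw [LinearEquiv.mul_apply, hb, ha]
  | inv a _ ha =>
    nth_rw 1 [← ha]
    rw [← LinearEquiv.mul_apply, inv_mul_cancel]; rfl

lemma para_fix_self {x : Fin n → ℝ} {e : (Fin n → ℝ) ≃ₗ[ℝ] (Fin n → ℝ)}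
    (he : e ∈ coxGroup (para R x)) : e x = x :=
  para_fix he x fun _ h => (mem_para.1 h).2

lemma RootSys.parabolic (hR : RootSys R) (x : Fin n → ℝ) : RootSys (para R x) where
  norm2 α hα := hR.norm2 α (para_subset x hα)
  noncollinear α hα β hβ := hR.noncollinear α (para_subset x hα) β (para_subset x hβ)
  pos := hR.pos.imp fun v hv α hα => hv α (para_subset x hα)
  finiteW := by
    have := hR.finiteW
    exact Finite.of_injective _
      (Subgroup.inclusion_injective (coxGroup_mono (para_subset (R := R) x)))
  stableR e he α hα := by
    have heR := coxGroup_mono (para_subset x) he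
    have h0 : dotR (e α) x = 0 := by
      rw [hR.dotR_map_left heR, para_fix_self (inv_mem he)]
      exact (mem_para.1 hα).2
    refine (hR.stableR e heR α (para_subset x hα)).imp (fun h => mem_para.2 ⟨h, h0⟩)
      (fun h => mem_para.2 ⟨h, by rw [neg_dotR, h0, neg_zero]⟩)

/-- Every point can be moved to the closed fundamental chamber. -/
lemma RootSys.exists_dominant (hR : RootSys R) {v : Fin n → ℝ} (hv : ∀ α ∈ R, 0 < dotR α v)
    (x : Fin n → ℝ) : ∃ w ∈ coxGroup R, ∀ α ∈ R, 0 ≤ dotR α (w x) := by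
  have := hR.finiteW
  obtain ⟨w, hw⟩ := Finite.exists_max fun w : coxGroup R => dotR (w.1 x) v
  refine ⟨w, w.2, fun α hα => ?_⟩
  have h := hw (⟨refl α (hR.norm2 α hα), refl_mem _ hα⟩ * w)
  simp only [Subgroup.coe_mul, LinearEquiv.mul_apply, refl_apply, sub_dotR, smul_dotR] at h
  by_contra! h0
  nlinarith [hv α hα]

/-- A point off all reflection hyperplanes. -/
def Regular (R : Finset (Fin n → ℝ)) (x : Fin n → ℝ) : Prop := ∀ α ∈ R, dotR α x ≠ 0

/-- Two points in the same face of the hyperplane arrangement. -/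
def SameFace (R : Finset (Fin n → ℝ)) (x y : Fin n → ℝ) : Prop :=
  ∀ α ∈ R, SignType.sign (dotR α x) = SignType.sign (dotR α y)

lemma RootSys.exists_mem_eq (hR : RootSys R) {e : (Fin n → ℝ) ≃ₗ[ℝ] (Fin n → ℝ)}
    (he : e ∈ coxGroup R) {α : Fin n → ℝ} (hα : α ∈ R) : ∃ β ∈ R, e α = β ∨ e α = -β := by
  rcases hR.stableR e he α hα with h | h
  · exact ⟨_, h, .inl rfl⟩
  · exact ⟨_, h, .inr (neg_neg _).symm⟩

lemma RootSys.regular_map (hR : RootSys R) {e : (Fin n → ℝ) ≃ₗ[ℝ] (Fin n → ℝ)}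
    (he : e ∈ coxGroup R) {x : Fin n → ℝ} (hx : Regular R x) : Regular R (e x) := by
  intro α hα
  rw [hR.dotR_map_right he]
  obtain ⟨β, hβ, h | h⟩ := hR.exists_mem_eq (inv_mem he) hα <;> rw [h]
  · exact hx β hβ
  · rw [neg_dotR]; exact neg_ne_zero.2 (hx β hβ)

lemma RootSys.sameFace_map (hR : RootSys R) {e : (Fin n → ℝ) ≃ₗ[ℝ] (Fin n → ℝ)}
    (he : e ∈ coxGroup R) {x y : Fin n → ℝ} (hx : SameFace R x y) : SameFace R (e x) (e y) := by
  intro α hα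
  rw [hR.dotR_map_right he, hR.dotR_map_right he]
  obtain ⟨β, hβ, h | h⟩ := hR.exists_mem_eq (inv_mem he) hα <;> rw [h]
  · exact hx β hβ
  · rw [neg_dotR, neg_dotR, Left.sign_neg, Left.sign_neg, hx β hβ]

lemma SameFace.symm {x y : Fin n → ℝ} (h : SameFace R x y) : SameFace R y x :=
  fun α hα => (h α hα).symm

lemma SameFace.trans {x y z : Fin n → ℝ} (h : SameFace R x y) (h' : SameFace R y z) :
    SameFace R x z :=
  fun α hα => (h α hα).trans (h' α hα)

lemma SameFace.refl (x : Fin n → ℝ) : SameFace R x x := fun _ _ => rfl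

lemma SameFace.mono {S : Finset (Fin n → ℝ)} (hS : S ⊆ R) {x y : Fin n → ℝ}
    (h : SameFace R x y) : SameFace S x y := fun α hα => h α (hS hα)

lemma SameFace.para_eq {x y : Fin n → ℝ} (h : SameFace R x y) : para R x = para R y := by
  ext α
  simp only [mem_para, and_congr_right_iff]
  intro hα
  rw [← sign_eq_zero_iff, h α hα, sign_eq_zero_iff]

/-- Any two chambers are related by the group. -/
lemma RootSys.exists_sameFace (hR : RootSys R) {x y : Fin n → ℝ} (hx : Regular R x)
    (hy : Regular R y) : ∃ w ∈ coxGroup R, SameFace R (w x) y := by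
  obtain ⟨v, hv⟩ := hR.pos
  have key : ∀ x, Regular R x → ∃ w ∈ coxGroup R, SameFace R (w x) v := fun x hx => by
    obtain ⟨w, hw, h⟩ := hR.exists_dominant hv x
    refine ⟨w, hw, fun α hα => ?_⟩
    rw [sign_pos (hv α hα), sign_pos]
    exact lt_of_le_of_ne (h α hα) (hR.regular_map hw hx α hα).symm
  obtain ⟨w, hw, h⟩ := key x hx
  obtain ⟨u, hu, h'⟩ := key y hy
  refine ⟨u⁻¹ * w, mul_mem (inv_mem hu) hw, ?_⟩
  have := hR.sameFace_map (inv_mem hu) (h.trans h'.symm)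
  rwa [← LinearEquiv.mul_apply, ← LinearEquiv.mul_apply, inv_mul_cancel] at this

end

/-! ### Simple roots and parabolic subgroups -/

section

variable {n : ℕ} {R : Finset (Fin n → ℝ)}

lemma RootSys.refl_conj (hR : RootSys R) {e : (Fin n → ℝ) ≃ₗ[ℝ] (Fin n → ℝ)}
    (he : e ∈ coxGroup R) {α β : Fin n → ℝ} (hα : dotR α α = 2) (hβ : dotR β β = 2)
    (h : e α = β ∨ e α = -β) : refl β hβ * e = e * refl α hα := by
  ext1 x
  simp only [LinearEquiv.mul_apply, refl_apply, map_sub, map_smul]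
  rw [hR.dotR_map_right he]
  have : e⁻¹ (e α) = α := by rw [← LinearEquiv.mul_apply, inv_mul_cancel]; rfl
  rcases h with h | h
  · rw [← h, this]
  · have hb : β = - e α := by rw [h, neg_neg]
    rw [hb, map_neg, this, neg_dotR]
    module

open Classical in
/-- The simple roots: those `α` whose reflection permutes the other positive roots. -/
noncomputable def simpleRoots (R : Finset (Fin n → ℝ)) : Finset (Fin n → ℝ) :=
  R.filter fun α => ∀ β ∈ R, β ≠ α → β - dotR α β • α ∈ R

lemma mem_simpleRoots {α : Fin n → ℝ} :
    α ∈ simpleRoots R ↔ α ∈ R ∧ ∀ β ∈ R, β ≠ α → β - dotR α β • α ∈ R := by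
  simp [simpleRoots]

lemma simpleRoots_subset : simpleRoots R ⊆ R := filter_subset _ _

lemma RootSys.dotR_lt_two (hR : RootSys R) {α β : Fin n → ℝ} (hα : α ∈ R) (hβ : β ∈ R)
    (h : α ≠ β) : dotR α β < 2 := by
  by_contra! h2
  have h0 := dotR_self_nonneg ((2 : ℝ) • β - dotR α β • α)
  have h1 : dotR ((2 : ℝ) • β - dotR α β • α) ((2 : ℝ) • β - dotR α β • α)
      = 8 - 2 * dotR α β ^ 2 := by
    simp only [dotR_sub, sub_dotR, dotR_smul, smul_dotR, hR.norm2 α hα, hR.norm2 β hβ,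
      dotR_comm β α]
    ring
  have h3 : dotR ((2 : ℝ) • β - dotR α β • α) ((2 : ℝ) • β - dotR α β • α) = 0 := by
    nlinarith
  have h4 := sub_eq_zero.1 (dotR_self_eq_zero.1 h3)
  refine hR.noncollinear α hα β hβ h (dotR α β / 2) ?_
  rw [div_eq_inv_mul, mul_smul, ← h4, smul_smul]
  norm_num

lemma RootSys.refl_mem_simple (hR : RootSys R) {β : Fin n → ℝ} (hβ : β ∈ R) :
    refl β (hR.norm2 β hβ) ∈ coxGroup (simpleRoots R) := by
  classical
  obtain ⟨v, hv⟩ := hR.pos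
  generalize hm : (R.filter fun γ => dotR γ v < dotR β v).card = m
  induction m using Nat.strong_induction_on generalizing β with
  | _ m ih =>
  have ih' : ∀ γ (hγ : γ ∈ R), dotR γ v < dotR β v →
      refl γ (hR.norm2 γ hγ) ∈ coxGroup (simpleRoots R) := fun γ hγ hlt => by
    refine ih _ ?_ hγ rfl
    rw [← hm]
    refine card_lt_card ⟨fun δ hδ => ?_, fun hs => ?_⟩
    · simp only [mem_filter] at hδ ⊢
      exact ⟨hδ.1, hδ.2.trans hlt⟩
    · have := hs (mem_filter.2 ⟨hγ, hlt⟩)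
      simp at this
  by_cases hs : β ∈ simpleRoots R
  · exact refl_mem _ hs
  have : ∃ γ ∈ R, γ ≠ β ∧ γ - dotR β γ • β ∉ R := by
    by_contra! h
    exact hs (mem_simpleRoots.2 ⟨hβ, h⟩)
  obtain ⟨γ, hγ, hne, hn⟩ := this
  have hγ' : dotR β γ • β - γ ∈ R := by
    have := (hR.stableR _ (refl_mem (hR.norm2 β hβ) hβ) γ hγ).resolve_left hn
    rwa [refl_apply, neg_sub] at this
  set c := dotR β γ with hc
  have hc2 : c < 2 := hR.dotR_lt_two hβ hγ hne.symm
  have hsum : dotR (c • β - γ) v = c * dotR β v - dotR γ v := by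
    rw [sub_dotR, smul_dotR]
  have hb := hv β hβ
  have hg := hv γ hγ
  have hg' := hv _ hγ'
  rw [hsum] at hg'
  have hc0 : 0 < c := by
    by_contra! h
    nlinarith
  obtain ⟨δ, hδ, hδc, hδv⟩ : ∃ δ ∈ R, dotR β δ = c ∧ dotR δ v ≤ c * dotR β v / 2 := by
    by_cases h : dotR γ v ≤ c * dotR β v / 2
    · exact ⟨γ, hγ, hc.symm, h⟩
    · refine ⟨_, hγ', ?_, ?_⟩
      · rw [dotR_sub, dotR_smul, hR.norm2 β hβ, ← hc]; ring
      · rw [hsum]; linarith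
  have hd := hv δ hδ
  have hlt : dotR δ v < dotR β v := by nlinarith
  have h1 := ih' δ hδ hlt
  have hval : dotR (refl δ (hR.norm2 δ hδ) β) v = dotR β v - c * dotR δ v := by
    rw [refl_apply, sub_dotR, smul_dotR, dotR_comm δ β, hδc]
  obtain ⟨ε, hε, he⟩ := hR.exists_mem_eq (refl_mem (hR.norm2 δ hδ) hδ) hβ
  have h2 : refl ε (hR.norm2 ε hε) ∈ coxGroup (simpleRoots R) := by
    refine ih' ε hε ?_
    rcases he with he | he
    · rw [← he, hval]; nlinarith
    · have : ε = - refl δ (hR.norm2 δ hδ) β := by rw [he, neg_neg]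
      rw [this, neg_dotR, hval]
      nlinarith
  have h3 := hR.refl_conj (refl_mem (hR.norm2 δ hδ) hδ) (hR.norm2 β hβ) (hR.norm2 ε hε) he
  have h4 : refl β (hR.norm2 β hβ) = (refl δ (hR.norm2 δ hδ))⁻¹ *
      (refl ε (hR.norm2 ε hε) * refl δ (hR.norm2 δ hδ)) := by
    rw [h3, inv_mul_cancel_left]
  rw [h4]
  exact mul_mem (inv_mem h1) (mul_mem h2 h1)

lemma RootSys.coxGroup_simple (hR : RootSys R) : coxGroup (simpleRoots R) = coxGroup R := by
  refine le_antisymm (coxGroup_mono simpleRoots_subset) ?_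
  refine (Subgroup.closure_le _).2 fun e he => ?_
  obtain ⟨α, hα, rfl⟩ := hR.closure_eq he
  exact hR.refl_mem_simple hα

/-- The exchange condition. -/
lemma RootSys.exchange (hR : RootSys R) (l : List ((Fin n → ℝ) ≃ₗ[ℝ] (Fin n → ℝ)))
    (hl : ∀ s ∈ l, s ∈ reflSet (simpleRoots R)) {α : Fin n → ℝ} (hα : α ∈ R)
    (h : l.prod⁻¹ α ∉ R) :
    ∃ l' : List ((Fin n → ℝ) ≃ₗ[ℝ] (Fin n → ℝ)), (∀ s ∈ l', s ∈ reflSet (simpleRoots R)) ∧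
      l'.length + 1 = l.length ∧ refl α (hR.norm2 α hα) * l.prod = l'.prod := by
  induction l generalizing α with
  | nil => simp at h; exact absurd hα h
  | cons s t ih =>
    have ht : ∀ s ∈ t, s ∈ reflSet (simpleRoots R) := fun s hs => hl s (List.mem_cons_of_mem _ hs)
    obtain ⟨β, hβ, hs⟩ := hl s List.mem_cons_self
    have hβR := simpleRoots_subset hβ
    obtain rfl : s = refl β (hR.norm2 β hβR) := LinearEquiv.ext hs
    rw [List.prod_cons, mul_inv_rev, LinearEquiv.mul_apply, refl_inv] at h
    by_cases hαβ : α = β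
    · subst hαβ
      refine ⟨t, ht, rfl, ?_⟩
      rw [List.prod_cons, ← mul_assoc, refl_mul_self, one_mul]
    · have h1 : refl β (hR.norm2 β hβR) α ∈ R := (mem_simpleRoots.1 hβ).2 α hα hαβ
      obtain ⟨l', hl', hlen, hp⟩ := ih ht h1 h
      refine ⟨refl β (hR.norm2 β hβR) :: l', ?_, by simp [hlen], ?_⟩
      · intro s hs
        rcases List.mem_cons.1 hs with rfl | hs
        exacts [hl _ List.mem_cons_self, hl' s hs]
      · rw [List.prod_cons, List.prod_cons, ← hp, ← mul_assoc, ← mul_assoc]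
        congr 1
        have := hR.refl_conj (refl_mem (hR.norm2 β hβR) hβR) (hR.norm2 _ h1) (hR.norm2 α hα)
          (.inl ((reflL_involutive (hR.norm2 β hβR)) α))
        exact this

lemma RootSys.eq_one_of_list (hR : RootSys R) (m : ℕ)
    (l : List ((Fin n → ℝ) ≃ₗ[ℝ] (Fin n → ℝ))) (hm : l.length ≤ m)
    (hl : ∀ s ∈ l, s ∈ reflSet (simpleRoots R)) (h : ∀ α ∈ R, l.prod⁻¹ α ∈ R) : l.prod = 1 := by
  induction m generalizing l with
  | zero => simp at hm; simp [hm]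
  | succ m ih =>
    cases l with
    | nil => rfl
    | cons s t =>
      have ht : ∀ s ∈ t, s ∈ reflSet (simpleRoots R) :=
        fun s hs => hl s (List.mem_cons_of_mem _ hs)
      obtain ⟨β, hβ, hs⟩ := hl s List.mem_cons_self
      have hβR := simpleRoots_subset hβ
      obtain rfl : s = refl β (hR.norm2 β hβR) := LinearEquiv.ext hs
      have h1 : t.prod⁻¹ β ∉ R := fun h2 => by
        have := h β hβR
        rw [List.prod_cons, mul_inv_rev, LinearEquiv.mul_apply, refl_inv, refl_self,
          map_neg] at this
        exact hR.neg_notMem h2 this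
      obtain ⟨l', hl', hlen, hp⟩ := hR.exchange t ht hβR h1
      rw [List.prod_cons, hp]
      refine ih l' ?_ hl' ?_
      · simp at hm; omega
      · rwa [List.prod_cons, hp] at h

/-- The group acts freely on chambers. -/
lemma RootSys.eq_one (hR : RootSys R) {e : (Fin n → ℝ) ≃ₗ[ℝ] (Fin n → ℝ)}
    (he : e ∈ coxGroup R) (h : ∀ α ∈ R, e⁻¹ α ∈ R) : e = 1 := by
  rw [← hR.coxGroup_simple] at he
  rw [coxGroup, ← Subgroup.mem_toSubmonoid, Subgroup.closure_toSubmonoid] at he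
  obtain ⟨l, hl, rfl⟩ := Submonoid.exists_list_of_mem_closure he
  refine hR.eq_one_of_list _ l le_rfl (fun s hs => ?_) h
  refine (hl s hs).elim id fun h => ?_
  obtain ⟨α, hα, h⟩ := h
  have : refl α (hR.norm2 α (simpleRoots_subset hα)) = s⁻¹ := LinearEquiv.ext fun x => (h x).symm
  rw [← refl_inv, inv_inj] at this
  exact ⟨α, hα, fun x => by rw [← this]; rfl⟩

lemma RootSys.eq_one_of_sameFace (hR : RootSys R) {e : (Fin n → ℝ) ≃ₗ[ℝ] (Fin n → ℝ)}
    (he : e ∈ coxGroup R) {y : Fin n → ℝ} (hy : Regular R y) (h : SameFace R (e y) y) :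
    e = 1 := by
  obtain ⟨v, hv⟩ := hR.pos
  obtain ⟨g, hg, hgy⟩ := hR.exists_sameFace (x := v) (fun α hα => (hv α hα).ne') hy
  have h1 : g⁻¹ * e * g = 1 := by
    have hmem : g⁻¹ * e * g ∈ coxGroup R := mul_mem (mul_mem (inv_mem hg) he) hg
    refine hR.eq_one hmem fun α hα => ?_
    have h2 : SameFace R ((g⁻¹ * e * g) v) v := by
      have h3 := ((hR.sameFace_map he hgy).trans h).trans hgy.symm
      have := hR.sameFace_map (inv_mem hg) h3
      simp only [← LinearEquiv.mul_apply, inv_mul_cancel, ← mul_assoc] at this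
      exact this
    refine (hR.stableR _ (inv_mem hmem) α hα).resolve_right fun h4 => ?_
    have h5 := hv _ h4
    rw [neg_dotR, hR.dotR_map_left (inv_mem hmem), inv_inv] at h5
    have h6 := h2 α hα
    rw [sign_pos (hv α hα), sign_eq_one_iff] at h6
    linarith
  have : e = g * (g⁻¹ * e * g) * g⁻¹ := by group
  rw [this, h1]; group

lemma eventually_sameFace (x y : Fin n → ℝ) :
    ∀ᶠ t : ℝ in nhdsWithin 0 (Set.Ioi 0), ∀ α ∈ R, SignType.sign (dotR α (x + t • y)) =
      if dotR α x = 0 then SignType.sign (dotR α y) else SignType.sign (dotR α x) := by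
  rw [Filter.eventually_all_finset]
  intro α _
  split_ifs with h
  · filter_upwards [self_mem_nhdsWithin] with t ht
    rw [dotR_add, h, dotR_smul, zero_add, sign_mul, sign_pos ht, one_mul]
  · have : Filter.Tendsto (fun t : ℝ => dotR α (x + t • y)) (nhdsWithin 0 (Set.Ioi 0))
        (nhds (dotR α x)) := by
      have hc : Continuous fun t : ℝ => dotR α (x + t • y) :=
        (continuous_dotR α).comp (by fun_prop)
      have := hc.tendsto 0
      simp only [zero_smul, add_zero] at this
      exact this.mono_left nhdsWithin_le_nhds
    rcases lt_or_gt_of_ne h with h | h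
    · filter_upwards [this.eventually (gt_mem_nhds h)] with t ht
      rw [sign_neg ht, sign_neg h]
    · filter_upwards [this.eventually (lt_mem_nhds h)] with t ht
      rw [sign_pos ht, sign_pos h]

/-- An element mapping a face to itself lies in the corresponding parabolic subgroup. -/
lemma RootSys.mem_para_of_sameFace (hR : RootSys R) {e : (Fin n → ℝ) ≃ₗ[ℝ] (Fin n → ℝ)}
    (he : e ∈ coxGroup R) {x : Fin n → ℝ} (h : SameFace R (e x) x) :
    e ∈ coxGroup (para R x) := by
  obtain ⟨v, hv⟩ := hR.pos
  have hvr : Regular R v := fun α hα => (hv α hα).ne'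
  have hp := h.para_eq
  obtain ⟨u, hu, huv⟩ := (hR.parabolic x).exists_sameFace (x := e v) (y := v)
    (fun α hα => hR.regular_map he hvr α (para_subset x hα))
    (fun α hα => hvr α (para_subset x hα))
  have huR := coxGroup_mono (para_subset x) hu
  have hue : u (e x) = e x := para_fix hu _ fun α hα => by
    rw [← hp] at hα
    exact (mem_para.1 hα).2
  obtain ⟨t, ht1, ht2⟩ :=
    ((eventually_sameFace (R := R) x v).and (eventually_sameFace (R := R) (e x) (u (e v)))).exists
  have hreg : Regular R (x + t • v) := fun α hα => by
    rw [← sign_ne_zero, ht1 α hα]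
    split_ifs with h0
    · exact sign_ne_zero.2 (hvr α hα)
    · exact sign_ne_zero.2 h0
  have h1 : u * e = 1 := by
    refine hR.eq_one_of_sameFace (mul_mem huR he) hreg fun α hα => ?_
    rw [LinearEquiv.mul_apply, map_add, map_smul, map_add, map_smul, hue, ht1 α hα, ht2 α hα]
    have h3 := h α hα
    have h4 : dotR α (e x) = 0 ↔ dotR α x = 0 := by
      rw [← sign_eq_zero_iff, h3, sign_eq_zero_iff]
    simp only [h4]
    split_ifs with h0
    · exact huv α (mem_para.2 ⟨hα, h0⟩)
    · exact h3
  rw [eq_inv_of_mul_eq_one_right h1]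
  exact inv_mem hu

end

/-! ### Faces and the Euler characteristic -/

section

variable {n : ℕ} {R : Finset (Fin n → ℝ)}

/-- The faces of the hyperplane arrangement of `s`. -/
def faceSetoid (s : Finset (Fin n → ℝ)) : Setoid (Fin n → ℝ) where
  r := SameFace s
  iseqv := ⟨SameFace.refl, SameFace.symm, SameFace.trans⟩

/-- The set of faces. -/
abbrev Face (s : Finset (Fin n → ℝ)) := Quotient (faceSetoid s)

lemma Face.mk_eq {s : Finset (Fin n → ℝ)} {x y : Fin n → ℝ} :
    (Quotient.mk (faceSetoid s) x) = Quotient.mk (faceSetoid s) y ↔ SameFace s x y :=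
  Quotient.eq

lemma Face.out_sameFace {s : Finset (Fin n → ℝ)} (x : Fin n → ℝ) :
    SameFace s (Quotient.mk (faceSetoid s) x).out x := Quotient.mk_out (s := faceSetoid s) x

instance (s : Finset (Fin n → ℝ)) : Finite (Face s) := by
  refine Finite.of_injective
    (fun q : Face s => fun α : s => SignType.sign (dotR α.1 q.out)) fun p q h => ?_
  rw [← Quotient.out_eq p, ← Quotient.out_eq q, Face.mk_eq]
  exact fun α hα => congrFun h ⟨α, hα⟩

noncomputable instance (s : Finset (Fin n → ℝ)) : Fintype (Face s) := Fintype.ofFinite _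

/-- The linear span of the face of `x`. -/
noncomputable def flat (s : Finset (Fin n → ℝ)) (x : Fin n → ℝ) : Submodule ℝ (Fin n → ℝ) :=
  ⨅ α ∈ para s x, LinearMap.ker (dotL α)

lemma mem_flat {s : Finset (Fin n → ℝ)} {x y : Fin n → ℝ} :
    y ∈ flat s x ↔ ∀ α ∈ s, dotR α x = 0 → dotR α y = 0 := by
  simp [flat, mem_para, dotL_apply]

variable {A : Type*} [CommRing A]

/-- The sign attached to a face. -/
noncomputable def faceSign (A : Type*) [CommRing A] (s : Finset (Fin n → ℝ)) (x : Fin n → ℝ) : A :=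
  (-1) ^ Module.finrank ℝ (flat s x)

lemma SameFace.faceSign_eq {s : Finset (Fin n → ℝ)} {x y : Fin n → ℝ} (h : SameFace s x y) :
    faceSign A s x = faceSign A s y := by
  unfold faceSign flat
  rw [h.para_eq]

/-- The integral of a function constant on faces against the Euler characteristic. -/
noncomputable def eulerSum (s : Finset (Fin n → ℝ)) (f : (Fin n → ℝ) → A) : A :=
  ∑ q : Face s, faceSign A s q.out * f q.out

/-- Functions which are constant on faces. -/
def Constr (s : Finset (Fin n → ℝ)) (f : (Fin n → ℝ) → A) : Prop :=
  ∀ x y, SameFace s x y → f x = f y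

lemma flat_insert_of_ne [DecidableEq (Fin n → ℝ)] {s : Finset (Fin n → ℝ)} {β x : Fin n → ℝ} (h : dotR β x ≠ 0) :
    flat (insert β s) x = flat s x := by
  ext y
  simp [mem_flat, h]

lemma flat_insert_of_eq [DecidableEq (Fin n → ℝ)] {s : Finset (Fin n → ℝ)} {β x : Fin n → ℝ} (h : dotR β x = 0) :
    flat (insert β s) x = flat s x ⊓ LinearMap.ker (dotL β) := by
  ext y
  simp [mem_flat, h, dotL_apply, and_comm]

lemma finrank_inf_ker (L : Submodule ℝ (Fin n → ℝ)) {β z : Fin n → ℝ} (hz : z ∈ L)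
    (h : dotR β z ≠ 0) :
    Module.finrank ℝ L = Module.finrank ℝ (L ⊓ LinearMap.ker (dotL β) : Submodule ℝ _) + 1 := by
  have h1 := LinearMap.finrank_range_add_finrank_ker ((dotL β).domRestrict L)
  have h2 : LinearMap.range ((dotL β).domRestrict L) = ⊤ := by
    rw [LinearMap.range_eq_top]
    intro c
    refine ⟨⟨(c / dotR β z) • z, L.smul_mem _ hz⟩, ?_⟩
    simp only [LinearMap.domRestrict_apply, dotL_apply, dotR_smul]
    field_simp
  rw [h2, finrank_top, Module.finrank_self, LinearMap.ker_domRestrict] at h1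
  have h3 : Module.finrank ℝ (Submodule.comap L.subtype (LinearMap.ker (dotL β))) =
      Module.finrank ℝ (L ⊓ LinearMap.ker (dotL β) : Submodule ℝ _) := by
    rw [← Submodule.map_comap_subtype]
    exact (Submodule.equivMapOfInjective L.subtype L.injective_subtype _).finrank_eq
  omega

lemma SameFace.mem_flat {s : Finset (Fin n → ℝ)} {x y : Fin n → ℝ} (h : SameFace s x y) :
    y ∈ flat s x := by
  rw [MacdonaldMehta.mem_flat]
  intro α hα h0
  rw [← sign_eq_zero_iff, ← h α hα, sign_eq_zero_iff, h0]

lemma SameFace.segment {s : Finset (Fin n → ℝ)} {x y : Fin n → ℝ} (h : SameFace s x y)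
    {a b : ℝ} (ha : 0 < a) (hb : 0 < b) : SameFace s x (a • x + b • y) := by
  intro α hα
  have h1 := h α hα
  rw [dotR_add, dotR_smul, dotR_smul]
  rcases lt_trichotomy (dotR α x) 0 with h2 | h2 | h2
  · rw [sign_neg h2] at h1 ⊢
    have h3 := sign_eq_neg_one_iff.1 h1.symm
    rw [sign_neg]; nlinarith
  · rw [h2, sign_zero] at h1
    have h3 := sign_eq_zero_iff.1 h1.symm
    simp [h2, h3]
  · rw [sign_pos h2] at h1 ⊢
    have h3 := sign_eq_one_iff.1 h1.symm
    rw [sign_pos]; positivity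

open Classical in
lemma sum_faceSign_insert [DecidableEq (Fin n → ℝ)] (s : Finset (Fin n → ℝ)) (β x : Fin n → ℝ) :
    ∑ q : Face (insert β s) with SameFace s x q.out, faceSign A (insert β s) q.out =
      faceSign A s x := by
  classical
  have key : ∀ y, SameFace s x y → ∀ z, SameFace (insert β s) y z ↔
      SameFace s x z ∧ SignType.sign (dotR β z) = SignType.sign (dotR β y) := by
    intro y hy z
    constructor
    · intro h
      exact ⟨hy.trans (h.mono (subset_insert _ _)), (h β (mem_insert_self _ _)).symm⟩
    · rintro ⟨h1, h2⟩ α hα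
      rcases mem_insert.1 hα with rfl | hα
      · exact h2.symm
      · exact (hy.symm.trans h1) α hα
  have key2 : ∀ y, SameFace s x y → ∀ q : Face (insert β s),
      q = Quotient.mk _ y ↔ SameFace s x q.out ∧
        SignType.sign (dotR β q.out) = SignType.sign (dotR β y) := by
    intro y hy q
    rw [← key y hy, ← Face.mk_eq, Quotient.out_eq, eq_comm]
  have const : (∀ y, SameFace s x y → SignType.sign (dotR β y) = SignType.sign (dotR β x)) →
      flat (insert β s) x = flat s x →
      ∑ q : Face (insert β s) with SameFace s x q.out, faceSign A (insert β s) q.out =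
      faceSign A s x := by
    intro h1 h2
    have h3 : (univ.filter fun q : Face (insert β s) => SameFace s x q.out) =
        {Quotient.mk _ x} := by
      ext q
      simp only [mem_filter, mem_univ, true_and, mem_singleton]
      rw [key2 x (SameFace.refl x)]
      exact ⟨fun h => ⟨h, h1 _ h⟩, fun h => h.1⟩
    rw [h3, sum_singleton, (Face.out_sameFace x).faceSign_eq, faceSign, faceSign, h2]
  by_cases hL : ∀ z ∈ flat s x, dotR β z = 0
  · have hx := hL x (SameFace.refl x).mem_flat
    refine const (fun y hy => ?_) ?_
    · rw [hL y hy.mem_flat, hx]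
    · rw [flat_insert_of_eq hx, inf_eq_left]
      exact fun z hz => hL z hz
  · push Not at hL
    obtain ⟨z, hz, hβz⟩ := hL
    by_cases h0 : ∃ y, SameFace s x y ∧ dotR β y = 0
    · obtain ⟨y, hy, hβy⟩ := h0
      have hzz : ∀ z ∈ flat s x, ∃ t > 0, SameFace s x (y + (t : ℝ) • z) := by
        intro z hz
        obtain ⟨t, ht, ht0⟩ := ((eventually_sameFace (R := s) y z).and self_mem_nhdsWithin).exists
        refine ⟨t, ht0, fun α hα => ?_⟩
        rw [ht α hα, hy α hα]
        split_ifs with h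
        · have : dotR α x = 0 := by
            rw [← sign_eq_zero_iff, hy α hα, sign_eq_zero_iff, h]
          rw [h, MacdonaldMehta.mem_flat.1 hz α hα this]
        · rfl
      obtain ⟨z1, hz1, hp⟩ : ∃ z ∈ flat s x, 0 < dotR β z := by
        rcases lt_or_gt_of_ne hβz with h | h
        · exact ⟨-z, neg_mem hz, by rw [dotR_neg]; linarith⟩
        · exact ⟨z, hz, h⟩
      obtain ⟨t1, ht1, hs1⟩ := hzz z1 hz1
      obtain ⟨t2, ht2, hs2⟩ := hzz (-z1) (neg_mem hz1)
      set y1 := y + t1 • z1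
      set y2 := y + t2 • (-z1)
      have hy1 : 0 < dotR β y1 := by
        rw [dotR_add, hβy, dotR_smul]; positivity
      have hy2 : dotR β y2 < 0 := by
        rw [dotR_add, hβy, dotR_smul, dotR_neg]; nlinarith [mul_pos ht2 hp]
      have h3 : (univ.filter fun q : Face (insert β s) => SameFace s x q.out) =
          {Quotient.mk _ y, Quotient.mk _ y1, Quotient.mk _ y2} := by
        ext q
        simp only [mem_filter, mem_univ, true_and, mem_singleton, mem_insert]
        rw [key2 y hy, key2 y1 hs1, key2 y2 hs2, hβy, sign_zero, sign_pos hy1, sign_neg hy2,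
          ← and_or_left, ← and_or_left, iff_self_and]
        intro _
        cases SignType.sign (dotR β q.out) <;> simp
      have hne : ∀ a b, SignType.sign (dotR β a) ≠ SignType.sign (dotR β b) →
          (Quotient.mk _ a : Face (insert β s)) ≠ Quotient.mk _ b := fun a b hab h =>
        hab (Face.mk_eq.1 h β (mem_insert_self _ _))
      rw [h3, sum_insert, sum_pair, (Face.out_sameFace y).faceSign_eq,
        (Face.out_sameFace y1).faceSign_eq, (Face.out_sameFace y2).faceSign_eq,
        hy.faceSign_eq]
      · have e1 : faceSign A (insert β s) y1 = faceSign A s y := by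
          rw [← (hy.symm.trans hs1).symm.faceSign_eq, faceSign, faceSign,
            flat_insert_of_ne hy1.ne']
        have e2 : faceSign A (insert β s) y2 = faceSign A s y := by
          rw [← (hy.symm.trans hs2).symm.faceSign_eq, faceSign, faceSign,
            flat_insert_of_ne hy2.ne]
        have e3 : faceSign A (insert β s) y = - faceSign A s y := by
          have : flat s x = flat s y := by unfold flat; rw [hy.para_eq]
          rw [faceSign, faceSign, flat_insert_of_eq hβy,
            finrank_inf_ker (flat s y) (this ▸ hz) hβz, pow_succ]
          ring
        rw [e1, e2, e3]; ring
      · refine hne _ _ ?_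
        rw [sign_pos hy1, sign_neg hy2]; decide
      · simp only [mem_insert, mem_singleton, not_or]
        refine ⟨hne _ _ ?_, hne _ _ ?_⟩
        · rw [hβy, sign_zero, sign_pos hy1]; decide
        · rw [hβy, sign_zero, sign_neg hy2]; decide
    · push Not at h0
      have hx := h0 x (SameFace.refl x)
      refine const (fun y hy => ?_) (flat_insert_of_ne hx)
      by_contra hne
      have hy0 := h0 y hy
      have hlt : dotR β x * dotR β y < 0 := by
        rcases lt_or_gt_of_ne hx with h | h <;> rcases lt_or_gt_of_ne hy0 with h' | h'
        · exact absurd (by rw [sign_neg h, sign_neg h']) hne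
        · exact mul_neg_of_neg_of_pos h h'
        · exact mul_neg_of_pos_of_neg h h'
        · exact absurd (by rw [sign_pos h, sign_pos h']) hne
      have := h0 _ (hy.segment (abs_pos.2 hy0) (abs_pos.2 hx))
      apply this
      rw [dotR_add, dotR_smul, dotR_smul]
      rcases mul_neg_iff.1 hlt with ⟨h, h'⟩ | ⟨h, h'⟩
      · rw [abs_of_pos h, abs_of_neg h']; ring
      · rw [abs_of_neg h, abs_of_pos h']; ring

lemma eulerSum_insert [DecidableEq (Fin n → ℝ)] {s : Finset (Fin n → ℝ)} {f : (Fin n → ℝ) → A} (hf : Constr s f)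
    (β : Fin n → ℝ) : eulerSum (insert β s) f = eulerSum s f := by
  classical
  unfold eulerSum
  have h : ∀ q : Face s, faceSign A s q.out * f q.out =
      ∑ p : Face (insert β s) with Quotient.mk (faceSetoid s) p.out = q,
        faceSign A (insert β s) p.out * f p.out := by
    intro q
    rw [← sum_faceSign_insert s β q.out, sum_mul]
    refine sum_congr ?_ fun p hp => ?_
    · ext p
      simp only [mem_filter, mem_univ, true_and]
      rw [← Face.mk_eq (s := s), Quotient.out_eq, eq_comm]
    · simp only [mem_filter, mem_univ, true_and] at hp
      rw [hf _ _ (show SameFace s q.out p.out by rw [← Face.mk_eq, Quotient.out_eq, hp])]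
  rw [sum_congr rfl fun q _ => h q]
  exact (sum_fiberwise univ (fun p : Face (insert β s) => Quotient.mk (faceSetoid s) p.out) _).symm


lemma Constr.mono {A : Type*} {s t : Finset (Fin n → ℝ)} (hst : s ⊆ t) {f : (Fin n → ℝ) → A}
    (hf : Constr s f) : Constr t f := fun x y h => hf x y (h.mono hst)

lemma eulerSum_subset {s t : Finset (Fin n → ℝ)} (hst : s ⊆ t)
    {f : (Fin n → ℝ) → A} (hf : Constr s f) : eulerSum t f = eulerSum s f := by
  classical
  have : ∀ u : Finset (Fin n → ℝ), eulerSum (s ∪ u) f = eulerSum s f := by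
    intro u
    induction u using Finset.induction_on with
    | empty => rw [union_empty]
    | insert β u _ ih =>
      rw [union_insert, eulerSum_insert (hf.mono subset_union_left), ih]
  rw [← this t, union_eq_right.2 hst]

/-- The Euler sum over a single face. -/
lemma eulerSum_single {s : Finset (Fin n → ℝ)} {f : (Fin n → ℝ) → A} (x : Fin n → ℝ)
    (h1 : ∀ y, SameFace s y x → f y = 1) (h0 : ∀ y, ¬ SameFace s y x → f y = 0) :
    eulerSum s f = faceSign A s x := by
  classical
  unfold eulerSum
  rw [sum_eq_single (Quotient.mk _ x)]
  · rw [h1 _ (Face.out_sameFace x), mul_one, (Face.out_sameFace x).faceSign_eq]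
  · intro q _ hq
    rw [h0, mul_zero]
    rwa [← Face.mk_eq, Quotient.out_eq]
  · simp

lemma eulerSum_subspace (s : Finset (Fin n → ℝ)) {f : (Fin n → ℝ) → A} 
    (h1 : ∀ y, (∀ α ∈ s, dotR α y = 0) → f y = 1)
    (h0 : ∀ y, ¬ (∀ α ∈ s, dotR α y = 0) → f y = 0) :
    eulerSum s f = faceSign A s 0 := by
  have key : ∀ y, SameFace s y 0 ↔ ∀ α ∈ s, dotR α y = 0 := fun y =>
    forall₂_congr fun α _ => by rw [dotR_zero, sign_zero, sign_eq_zero_iff]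
  refine eulerSum_single 0 (fun y hy => h1 y ((key y).1 hy)) fun y hy => h0 y ?_
  rwa [← key]

lemma eulerSum_cone (s : Finset (Fin n → ℝ)) {v : Fin n → ℝ} (hv : ∀ α ∈ s, 0 < dotR α v) :
    eulerSum s (fun x => ∏ α ∈ s, if dotR α x < 0 then (1 : A) else 0) = (-1) ^ n := by
  have key : ∀ y, SameFace s y (-v) ↔ ∀ α ∈ s, dotR α y < 0 := fun y =>
    forall₂_congr fun α hα => by
      rw [dotR_neg, sign_neg (show -dotR α v < 0 by linarith [hv α hα]), sign_eq_neg_one_iff]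
  rw [eulerSum_single (-v)]
  · have : flat s (-v) = ⊤ := by
      rw [eq_top_iff]
      intro y _
      rw [mem_flat]
      intro α hα h
      rw [dotR_neg] at h
      linarith [hv α hα]
    rw [faceSign, this, finrank_top]
    simp
  · intro y hy
    rw [key] at hy
    exact prod_eq_one fun α hα => if_pos (hy α hα)
  · intro y hy
    rw [key] at hy
    push Not at hy
    obtain ⟨α, hα, h⟩ := hy
    exact prod_eq_zero hα (if_neg (not_lt.2 h))

lemma eulerSum_sum {ι : Type*} (s : Finset (Fin n → ℝ)) (t : Finset ι)
    (f : ι → (Fin n → ℝ) → A) :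
    eulerSum s (fun x => ∑ i ∈ t, f i x) = ∑ i ∈ t, eulerSum s (f i) := by
  simp only [eulerSum, mul_sum]
  exact sum_comm

lemma eulerSum_mul_left (s : Finset (Fin n → ℝ)) (a : A)
    (f : (Fin n → ℝ) → A) :
    eulerSum s (fun x => a * f x) = a * eulerSum s f := by
  simp only [eulerSum, mul_sum]
  exact sum_congr rfl fun _ _ => by ring

/-- The number of hyperplanes separating `x` from the positive chamber. -/
noncomputable def neg (R : Finset (Fin n → ℝ)) (x : Fin n → ℝ) : ℕ :=
  (R.filter fun α => dotR α x < 0).card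

lemma SameFace.neg_eq {x y : Fin n → ℝ} (h : SameFace R x y) :
    neg R x = neg R y := by
  unfold neg
  congr 1
  refine filter_congr fun α hα => ?_
  rw [← sign_eq_neg_one_iff, h α hα, sign_eq_neg_one_iff]

lemma RootSys.eulerSum_neg (hR : RootSys R) (X : A) {e : (Fin n → ℝ) ≃ₗ[ℝ] (Fin n → ℝ)}
    (he : e ∈ coxGroup R) :
    eulerSum R (fun x => X ^ neg R (e x)) = (-1) ^ n * X ^ R.card := by
  classical
  obtain ⟨v, hv⟩ := hR.pos
  have h1 : ∀ x, X ^ neg R (e x) = ∑ T ∈ R.powerset, (X - 1) ^ T.card *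
      ∏ α ∈ T.image ⇑(e⁻¹), if dotR α x < 0 then 1 else 0 := by
    intro x
    have : X ^ neg R (e x) = ∏ α ∈ R, (1 + (X - 1) * if dotR (e⁻¹ α) x < 0 then 1 else 0) := by
      rw [neg, ← prod_const, prod_filter]
      refine prod_congr rfl fun α hα => ?_
      rw [hR.dotR_map_right he]
      split_ifs <;> ring
    rw [this, prod_one_add]
    refine sum_congr rfl fun T _ => ?_
    rw [prod_mul_distrib, prod_const, prod_image fun a _ b _ h => (e⁻¹).injective h]
  simp_rw [h1]
  rw [eulerSum_sum]
  have hc : ∀ T ∈ R.powerset, eulerSum R (fun x => (X - 1) ^ T.card *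
      ∏ α ∈ T.image ⇑(e⁻¹), if dotR α x < 0 then (1 : A) else 0) = (X - 1) ^ T.card * (-1) ^ n := by
    intro T hT
    rw [mem_powerset] at hT
    rw [eulerSum_mul_left]
    congr 1
    set T' := T.image ⇑(e⁻¹) with hT'
    have hcT : Constr T' fun x => ∏ α ∈ T', if dotR α x < 0 then (1 : A) else 0 := by
      intro x y h
      refine prod_congr rfl fun α hα => ?_
      simp only [← sign_eq_neg_one_iff, h α hα]
    have hcR : Constr R fun x => ∏ α ∈ T', if dotR α x < 0 then (1 : A) else 0 := by
      intro x y h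
      refine hcT x y fun α hα => ?_
      obtain ⟨β, hβ, rfl⟩ := mem_image.1 hα
      rw [← hR.dotR_map_right he, ← hR.dotR_map_right he]
      exact hR.sameFace_map he h β (hT hβ)
    rw [← eulerSum_subset (subset_union_left (s₂ := T')) hcR,
      eulerSum_subset (subset_union_right) hcT]
    refine eulerSum_cone T' (v := e⁻¹ v) fun α hα => ?_
    obtain ⟨β, hβ, rfl⟩ := mem_image.1 hα
    rw [hR.dotR_map (inv_mem he)]
    exact hv β (hT hβ)
  rw [sum_congr rfl hc, ← sum_mul, mul_comm]
  congr 1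
  have := prod_one_add (s := R) (f := fun _ => X - 1)
  simp only [prod_const] at this
  rw [← this]
  congr 1; ring

lemma RootSys.mem_para_iff (hR : RootSys R) {e : (Fin n → ℝ) ≃ₗ[ℝ] (Fin n → ℝ)}
    (he : e ∈ coxGroup R) {x : Fin n → ℝ} : e ∈ coxGroup (para R x) ↔ e x = x :=
  ⟨para_fix_self, fun h => hR.mem_para_of_sameFace he (by rw [h]; exact SameFace.refl x)⟩

open Classical in
lemma RootSys.eulerSum_fix (hR : RootSys R) {e : (Fin n → ℝ) ≃ₗ[ℝ] (Fin n → ℝ)}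
    (he : e ∈ coxGroup R) :
    eulerSum R (fun x => if e ∈ coxGroup (para R x) then (1 : A) else 0) =
      (-1) ^ Module.finrank ℝ (LinearMap.ker (e.toLinearMap - LinearMap.id)) := by
  set f : (Fin n → ℝ) → A := fun x => if e ∈ coxGroup (para R x) then (1 : A) else 0 with hf
  set s := univ.image fun i : Fin n => e⁻¹ (Pi.single i 1) - Pi.single i 1 with hs
  have key : ∀ y, (∀ α ∈ s, dotR α y = 0) ↔ e y = y := by
    intro y
    simp only [hs, mem_image, mem_univ, true_and, forall_exists_index, forall_apply_eq_imp_iff]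
    rw [funext_iff]
    refine forall_congr' fun i => ?_
    rw [sub_dotR, ← hR.dotR_map_right he, sub_eq_zero]
    simp [dotR, Pi.single_apply]
  have hf1 : ∀ y, e y = y → f y = 1 := fun y hy => if_pos ((hR.mem_para_iff he).2 hy)
  have hf0 : ∀ y, ¬ e y = y → f y = 0 := fun y hy => if_neg (mt (hR.mem_para_iff he).1 hy)
  have hcs : Constr s f := by
    have hcs0 : ∀ x y, SameFace s x y → e x = x → e y = y := fun x y h hx =>
      (key y).1 fun α hα => by
        rw [← sign_eq_zero_iff, ← h α hα, (key x).2 hx α hα, sign_zero]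
    intro x y h
    by_cases hx : e x = x
    · rw [hf1 x hx, hf1 y (hcs0 x y h hx)]
    · rw [hf0 x hx, hf0 y fun hy => hx (hcs0 y x h.symm hy)]
  have hcR : Constr R f := fun x y h => by simp only [hf, h.para_eq]
  rw [← eulerSum_subset (subset_union_left (s₂ := s)) hcR, eulerSum_subset subset_union_right hcs,
    eulerSum_subspace s (fun y hy => hf1 y ((key y).1 hy))
      (fun y hy => hf0 y fun h => hy ((key y).2 h)), faceSign]
  suffices flat s 0 = LinearMap.ker (e.toLinearMap - LinearMap.id) by rw [this]
  ext y
  simp only [mem_flat, dotR_zero, forall_true_left, LinearMap.mem_ker, LinearMap.sub_apply,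
    LinearMap.id_apply, sub_eq_zero, LinearEquiv.coe_coe]
  exact key y

end

/-! ### Fixed spaces of orthogonal maps -/

section

variable {n : ℕ} {R : Finset (Fin n → ℝ)}

/-- The dimension of the fixed space of a linear map. -/
noncomputable def fixDim (e : (Fin n → ℝ) ≃ₗ[ℝ] (Fin n → ℝ)) : ℕ :=
  Module.finrank ℝ (LinearMap.ker (e.toLinearMap - LinearMap.id))

lemma toMatrix_orthogonal {e : (Fin n → ℝ) ≃ₗ[ℝ] (Fin n → ℝ)}
    (he : ∀ x y, dotR (e x) (e y) = dotR x y) :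
    (LinearMap.toMatrix' e.toLinearMap).transpose * LinearMap.toMatrix' e.toLinearMap = 1 := by
  ext i j
  have := he (Pi.single i 1) (Pi.single j 1)
  simp only [dotR] at this
  rw [Matrix.mul_apply]
  simp only [Matrix.transpose_apply, LinearMap.toMatrix'_apply, LinearEquiv.coe_coe]
  rw [this, Matrix.one_apply]
  simp [Pi.single_apply, eq_comm]

lemma fixDim_eq_rootMultiplicity {e : (Fin n → ℝ) ≃ₗ[ℝ] (Fin n → ℝ)}
    (he : ∀ x y, dotR (e x) (e y) = dotR x y) :
    fixDim e = (e.toLinearMap.charpoly).rootMultiplicity 1 := by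
  rw [← LinearMap.finrank_maxGenEigenspace_eq, fixDim]
  have h2 : ∀ x, e (e x - x) - (e x - x) = 0 → e x - x = 0 := by
    intro x hx
    have h3 : dotR (e x) (e (e x - x) - (e x - x)) = 0 := by rw [hx, dotR_zero]
    simp only [map_sub, dotR_sub, he] at h3
    rw [← dotR_self_eq_zero]
    simp only [dotR_sub, sub_dotR, he, dotR_comm x (e x)] at h3 ⊢
    linarith
  have hker : ∀ k : ℕ, ∀ x, ((e.toLinearMap - LinearMap.id) ^ (k + 1) : Module.End ℝ _) x = 0 →
      e x - x = 0 := by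
    intro k
    induction k with
    | zero => intro x hx; simpa using hx
    | succ k ih =>
      intro x hx
      rw [pow_succ, Module.End.mul_apply] at hx
      exact h2 x (ih _ hx)
  suffices LinearMap.ker (e.toLinearMap - LinearMap.id) =
      Module.End.maxGenEigenspace e.toLinearMap 1 by rw [this]
  ext x
  rw [Module.End.mem_maxGenEigenspace]
  constructor
  · intro h
    refine ⟨1, ?_⟩
    simpa using h
  · rintro ⟨k, hk⟩
    rw [one_smul] at hk
    have : e x - x = 0 := hker k x (by rw [pow_succ', Module.End.mul_apply]; erw [hk]; simp)
    simpa using this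

lemma det_eq {e : (Fin n → ℝ) ≃ₗ[ℝ] (Fin n → ℝ)}
    (he : ∀ x y, dotR (e x) (e y) = dotR x y) :
    LinearMap.det e.toLinearMap = (-1) ^ (n + fixDim e) := by
  set M := LinearMap.toMatrix' e.toLinearMap with hM
  have hMM : M.transpose * M = 1 := toMatrix_orthogonal he
  have hMM' : M * M.transpose = 1 := mul_eq_one_comm.1 hMM
  have hcp : e.toLinearMap.charpoly = M.charpoly := by
    rw [← LinearMap.charpoly_toMatrix _ (Pi.basisFun ℝ (Fin n))]; rfl
  have hdet : LinearMap.det e.toLinearMap = M.det := (LinearMap.det_toMatrix' _).symm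
  set m := fixDim e with hm
  have hroot : m = M.charpoly.rootMultiplicity 1 := by rw [← hcp, hm, fixDim_eq_rootMultiplicity he]
  obtain ⟨q, hq, hq1⟩ := Polynomial.exists_eq_pow_rootMultiplicity_mul_and_not_dvd M.charpoly
    M.charpoly_monic.ne_zero 1
  rw [← hroot] at hq
  rw [Polynomial.dvd_iff_isRoot, Polynomial.IsRoot.def] at hq1
  have hev : ∀ t : ℝ, (t • (1 : Matrix (Fin n) (Fin n) ℝ) - M).det = (t - 1) ^ m * q.eval t := by
    intro t
    have : (M.charpoly).eval t = (t • (1 : Matrix (Fin n) (Fin n) ℝ) - M).det := by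
      rw [Matrix.eval_charpoly, Matrix.scalar_apply, ← Matrix.smul_one_eq_diagonal]
    rw [← this, hq]
    simp
  have hrec : ∀ t : ℝ, t ≠ 0 → (t - 1) ^ m * q.eval t =
      M.det * ((-t) ^ n * ((t⁻¹ - 1) ^ m * q.eval t⁻¹)) := by
    intro t ht
    have h1 : t • (1 : Matrix (Fin n) (Fin n) ℝ) - M =
        M * ((-t) • (t⁻¹ • (1 : Matrix (Fin n) (Fin n) ℝ) - M)).transpose := by
      rw [Matrix.transpose_smul, Matrix.transpose_sub, Matrix.transpose_smul,
        Matrix.transpose_one, Matrix.mul_smul, mul_sub, hMM', smul_sub, Matrix.mul_smul, smul_smul,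
        mul_one, neg_mul, mul_inv_cancel₀ ht]
      module
    rw [← hev, h1, Matrix.det_mul, Matrix.det_transpose, Matrix.det_smul, hev, Fintype.card_fin]
  have hrec2 : ∀ t : ℝ, t ∈ Set.Ioi 1 → q.eval t = M.det * ((-t) ^ n * ((-t⁻¹) ^ m * q.eval t⁻¹)) := by
    intro t ht
    have ht1 : (1 : ℝ) < t := ht
    have ht0 : t ≠ 0 := by linarith
    have h1 := hrec t ht0
    have h2 : (t⁻¹ - 1) = (t - 1) * (-t⁻¹) := by field_simp; ring
    rw [h2, mul_pow] at h1
    have h3 : (t - 1) ^ m ≠ 0 := pow_ne_zero _ (by linarith)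
    apply mul_left_cancel₀ h3
    rw [h1]; ring
  have hlim1 : Filter.Tendsto (fun t : ℝ => q.eval t) (nhdsWithin 1 (Set.Ioi 1))
      (nhds (q.eval 1)) := (q.continuous.tendsto 1).mono_left nhdsWithin_le_nhds
  have hinv : Filter.Tendsto (fun t : ℝ => t⁻¹) (nhdsWithin 1 (Set.Ioi 1)) (nhds 1) := by
    have := (tendsto_inv₀ (one_ne_zero (α := ℝ))).mono_left
      (nhdsWithin_le_nhds (s := Set.Ioi 1))
    simpa using this
  have hid : Filter.Tendsto (fun t : ℝ => t) (nhdsWithin 1 (Set.Ioi 1)) (nhds 1) :=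
    nhdsWithin_le_nhds
  have hlim2 : Filter.Tendsto (fun t : ℝ => M.det * ((-t) ^ n * ((-t⁻¹) ^ m * q.eval t⁻¹)))
      (nhdsWithin 1 (Set.Ioi 1)) (nhds (M.det * ((-1) ^ n * ((-1) ^ m * q.eval 1)))) :=
    ((hid.neg.pow n).mul ((hinv.neg.pow m).mul ((q.continuous.tendsto 1).comp hinv))).const_mul _
  have heq := tendsto_nhds_unique (hlim1.congr' (by
    filter_upwards [self_mem_nhdsWithin] with t ht using hrec2 t ht)) hlim2
  have h5 : M.det * ((-1) ^ n * (-1) ^ m) = 1 := by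
    apply mul_right_cancel₀ hq1
    rw [one_mul]
    linear_combination -heq
  rw [hdet, pow_add]
  have h6 : ((-1 : ℝ) ^ n * (-1) ^ m) * ((-1) ^ n * (-1) ^ m) = 1 := by
    rw [← pow_add, ← mul_pow]; norm_num
  calc M.det = M.det * ((-1) ^ n * (-1) ^ m) * ((-1) ^ n * (-1) ^ m) := by rw [mul_assoc, h6, mul_one]
    _ = _ := by rw [h5, one_mul]

lemma det_refl {α : Fin n → ℝ} (h : dotR α α = 2) : LinearMap.det (refl α h).toLinearMap = -1 := by
  have hiso : ∀ x y, dotR (refl α h x) (refl α h y) = dotR x y := by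
    intro x y
    simp only [refl_apply, dotR_sub, sub_dotR, dotR_smul, smul_dotR, h, dotR_comm x α]
    ring
  rw [det_eq hiso]
  have h1 : LinearMap.ker ((refl α h).toLinearMap - LinearMap.id) = ⊤ ⊓ LinearMap.ker (dotL α) := by
    ext x
    have hα : α ≠ 0 := by rintro rfl; simp [dotR_zero] at h
    simp [refl_apply, dotL_apply, hα]
  have h2 := finrank_inf_ker ⊤ (β := α) (z := α) trivial (by rw [h]; norm_num)
  rw [← h1, finrank_top] at h2
  change _ = fixDim _ + 1 at h2
  simp only [Module.finrank_fintype_fun_eq_card, Fintype.card_fin] at h2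
  generalize fixDim (refl α h) = k at h2 ⊢
  rw [show n + k = 2 * k + 1 by omega, pow_succ, pow_mul]
  norm_num

end

/-! ### Hilbert functions of invariants -/

section

variable {n : ℕ} {R : Finset (Fin n → ℝ)}

/-- Substitution of a linear map into a polynomial. -/
noncomputable def subst (e : (Fin n → ℝ) →ₗ[ℝ] (Fin n → ℝ)) :
    MvPolynomial (Fin n) ℝ →ₐ[ℝ] MvPolynomial (Fin n) ℝ :=
  MvPolynomial.aeval fun i => ∑ j, MvPolynomial.C (e (Pi.single j 1) i) * MvPolynomial.X j

lemma eval_subst (e : (Fin n → ℝ) →ₗ[ℝ] (Fin n → ℝ)) (x : Fin n → ℝ)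
    (p : MvPolynomial (Fin n) ℝ) :
    MvPolynomial.eval x (subst e p) = MvPolynomial.eval (e x) p := by
  have : (MvPolynomial.aeval x).comp (subst e) = MvPolynomial.aeval (R := ℝ) (e x) := by
    ext i
    simp only [subst, AlgHom.comp_apply, MvPolynomial.aeval_X, map_sum, map_mul,
      MvPolynomial.algHom_C, Algebra.algebraMap_self, RingHom.id_apply]
    conv_rhs => rw [LinearMap.pi_apply_eq_sum_univ e x]
    have : ∀ j : Fin n, (fun k => if j = k then (1 : ℝ) else 0) = Pi.single j 1 := fun j => by
      ext k; simp [Pi.single_apply, eq_comm]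
    simp [mul_comm, this]
  have h := DFunLike.congr_fun this p
  simpa [MvPolynomial.coe_aeval_eq_eval] using h

lemma ext_eval {p q : MvPolynomial (Fin n) ℝ}
    (h : ∀ x, MvPolynomial.eval x p = MvPolynomial.eval x q) : p = q := MvPolynomial.funext h

lemma subst_isHomogeneous (e : (Fin n → ℝ) →ₗ[ℝ] (Fin n → ℝ)) {p : MvPolynomial (Fin n) ℝ} {m : ℕ}
    (hp : p.IsHomogeneous m) : (subst e p).IsHomogeneous m := by
  have := hp.aeval (S := ℝ) (τ := Fin n) (n := 1)
    (fun i => ∑ j, MvPolynomial.C (e (Pi.single j 1) i) * MvPolynomial.X j) (fun i =>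
      MvPolynomial.IsHomogeneous.sum _ _ _ fun j _ => by
        simpa using (MvPolynomial.isHomogeneous_C (Fin n) (e (Pi.single j 1) i)).mul
          (MvPolynomial.isHomogeneous_X ℝ j))
  rwa [one_mul] at this

instance (m : ℕ) : Module.Finite ℝ (MvPolynomial.homogeneousSubmodule (Fin n) ℝ m) :=
  Module.Finite.iff_fg.2 (MvPolynomial.homogeneousSubmodule_fg (Fin n) ℝ m)

/-- The action on homogeneous polynomials of degree `m`, twisted by a character. -/
noncomputable def rho (ε : ((Fin n → ℝ) ≃ₗ[ℝ] (Fin n → ℝ)) →* ℝ) (m : ℕ) :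
    Representation ℝ ((Fin n → ℝ) ≃ₗ[ℝ] (Fin n → ℝ))
      (MvPolynomial.homogeneousSubmodule (Fin n) ℝ m) where
  toFun g := ε g • (subst (g⁻¹).toLinearMap).toLinearMap.restrict fun _ hp =>
    subst_isHomogeneous _ hp
  map_one' := by
    ext1 p
    apply Subtype.ext
    refine ext_eval fun x => ?_
    simp [eval_subst]
  map_mul' g h := by
    ext1 p
    apply Subtype.ext
    refine ext_eval fun x => ?_
    change MvPolynomial.eval x (ε (g * h) • subst ((g * h)⁻¹).toLinearMap p.1) =
      MvPolynomial.eval x (ε g • subst (g⁻¹).toLinearMap (ε h • subst (h⁻¹).toLinearMap p.1))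
    simp [eval_subst, mul_assoc]

lemma rho_apply (ε : ((Fin n → ℝ) ≃ₗ[ℝ] (Fin n → ℝ)) →* ℝ) (m : ℕ)
    (g : (Fin n → ℝ) ≃ₗ[ℝ] (Fin n → ℝ)) (p : MvPolynomial.homogeneousSubmodule (Fin n) ℝ m) :
    (rho ε m g p : MvPolynomial (Fin n) ℝ) = ε g • subst (g⁻¹).toLinearMap p.1 := rfl

/-- The homogeneous polynomials of degree `m` which transform by the character `ε`. -/
noncomputable def semiInv (ε : ((Fin n → ℝ) ≃ₗ[ℝ] (Fin n → ℝ)) →* ℝ) (R : Finset (Fin n → ℝ))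
    (m : ℕ) : Submodule ℝ (MvPolynomial (Fin n) ℝ) :=
  MvPolynomial.homogeneousSubmodule (Fin n) ℝ m ⊓
    ⨅ e ∈ coxGroup R, LinearMap.ker ((subst e.toLinearMap).toLinearMap - ε e • LinearMap.id)

lemma mem_semiInv {ε : ((Fin n → ℝ) ≃ₗ[ℝ] (Fin n → ℝ)) →* ℝ}
    {m : ℕ} {p : MvPolynomial (Fin n) ℝ} : p ∈ semiInv ε R m ↔ p.IsHomogeneous m ∧
      ∀ e ∈ coxGroup R, subst e.toLinearMap p = ε e • p := by
  simp [semiInv, MvPolynomial.mem_homogeneousSubmodule, sub_eq_zero]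

/-- The elements of the reflection group. -/
noncomputable def elts (R : Finset (Fin n → ℝ)) : Finset ((Fin n → ℝ) ≃ₗ[ℝ] (Fin n → ℝ)) :=
  open Classical in
  if h : (coxGroup R : Set ((Fin n → ℝ) ≃ₗ[ℝ] (Fin n → ℝ))).Finite then h.toFinset else ∅

lemma RootSys.mem_elts (hR : RootSys R) {e : (Fin n → ℝ) ≃ₗ[ℝ] (Fin n → ℝ)} :
    e ∈ elts R ↔ e ∈ coxGroup R := by
  have h : (coxGroup R : Set ((Fin n → ℝ) ≃ₗ[ℝ] (Fin n → ℝ))).Finite := hR.finiteW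
  simp [elts, h]

lemma RootSys.sum_elts (hR : RootSys R) [Fintype (coxGroup R)] {B : Type*} [AddCommMonoid B]
    (f : ((Fin n → ℝ) ≃ₗ[ℝ] (Fin n → ℝ)) → B) :
    ∑ e ∈ elts R, f e = ∑ e : coxGroup R, f e.1 :=
  sum_subtype _ (fun _ => hR.mem_elts) f

lemma RootSys.card_elts (hR : RootSys R) : (elts R).card = Nat.card (coxGroup R) := by
  have := hR.finiteW
  have := Fintype.ofFinite (coxGroup R)
  rw [card_eq_sum_ones, hR.sum_elts]
  simp

lemma RootSys.card_elts_pos (hR : RootSys R) : 0 < (elts R).card :=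
  card_pos.2 ⟨1, hR.mem_elts.2 (one_mem _)⟩

/-- The character of the group on homogeneous polynomials. -/
noncomputable def chi (m : ℕ) (e : (Fin n → ℝ) ≃ₗ[ℝ] (Fin n → ℝ)) : ℝ :=
  LinearMap.trace ℝ _ (rho 1 m e)

lemma RootSys.sum_chi (hR : RootSys R) (ε : ((Fin n → ℝ) ≃ₗ[ℝ] (Fin n → ℝ)) →* ℝ)
    (m : ℕ) : ∑ e ∈ elts R, ε e * chi m e = (elts R).card * Module.finrank ℝ (semiInv ε R m) := by
  have := hR.finiteW
  have := Fintype.ofFinite (coxGroup R)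
  set ρ : Representation ℝ (coxGroup R) (MvPolynomial.homogeneousSubmodule (Fin n) ℝ m) :=
    (rho ε m).comp (coxGroup R).subtype with hρ
  have hne : (Nat.card (coxGroup R) : ℝ) ≠ 0 := by
    rw [← hR.card_elts]; exact_mod_cast hR.card_elts_pos.ne'
  have := invertibleOfNonzero hne
  have h1 := Representation.card_inv_mul_sum_char_eq_finrank ρ
  rw [inv_mul_eq_iff_eq_mul₀ hne] at h1
  have h2 : ∀ e : coxGroup R, ρ.character e = ε e.1 * chi m e.1 := by
    intro e
    rw [Representation.character, chi, ← smul_eq_mul, ← map_smul]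
    congr 1
    ext1 p
    apply Subtype.ext
    simp [hρ, rho_apply]
  rw [hR.sum_elts, hR.card_elts, ← sum_congr rfl fun e _ => h2 e, h1]
  congr 2
  have h3 : semiInv ε R m = ρ.invariants.map (Submodule.subtype _) := by
    ext p
    rw [mem_semiInv]
    have hinv : ∀ g : (Fin n → ℝ) ≃ₗ[ℝ] (Fin n → ℝ), ε g * ε g⁻¹ = 1 := fun g => by
      rw [← map_mul, mul_inv_cancel, map_one]
    constructor
    · rintro ⟨hp, h⟩
      refine ⟨⟨p, hp⟩, fun g => Subtype.ext ?_, rfl⟩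
      have := h _ (inv_mem g.2)
      simp only [hρ, MonoidHom.comp_apply, Subgroup.coe_subtype, rho_apply, this, smul_smul, hinv,
        one_smul]
    · rintro ⟨⟨p, hp⟩, h, rfl⟩
      refine ⟨hp, fun e he => ?_⟩
      have h4 := congrArg Subtype.val (h ⟨e⁻¹, inv_mem he⟩)
      simp only [hρ, MonoidHom.comp_apply, Subgroup.coe_subtype, rho_apply, inv_inv] at h4
      simp only [Submodule.subtype_apply]
      conv_rhs => rw [← h4]
      rw [smul_smul, hinv, one_smul]
  rw [h3]
  exact (Submodule.equivMapOfInjective _ (Submodule.injective_subtype _) _).finrank_eq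

/-- The linear form defined by a vector. -/
noncomputable def lin (α : Fin n → ℝ) : MvPolynomial (Fin n) ℝ :=
  ∑ i, MvPolynomial.C (α i) * MvPolynomial.X i

lemma eval_lin (α x : Fin n → ℝ) : MvPolynomial.eval x (lin α) = dotR α x := by
  simp [lin, dotR]

lemma lin_isHomogeneous (α : Fin n → ℝ) : (lin α).IsHomogeneous 1 :=
  MvPolynomial.IsHomogeneous.sum _ _ _ fun j _ => by
    simpa using (MvPolynomial.isHomogeneous_C (Fin n) (α j)).mul (MvPolynomial.isHomogeneous_X ℝ j)

lemma lin_ne_zero {α : Fin n → ℝ} (h : dotR α α = 2) : lin α ≠ 0 := by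
  intro h0
  have := eval_lin α α
  rw [h0, map_zero, h] at this
  norm_num at this

/-- The orthogonal projection to the hyperplane of `α`. -/
noncomputable def proj (α : Fin n → ℝ) : (Fin n → ℝ) →ₗ[ℝ] (Fin n → ℝ) :=
  LinearMap.id - (1 / 2 : ℝ) • (dotL α).smulRight α

lemma proj_apply (α x : Fin n → ℝ) : proj α x = x - (dotR α x / 2) • α := by
  simp only [proj, LinearMap.sub_apply, LinearMap.id_apply, LinearMap.smul_apply,
    LinearMap.smulRight_apply, dotL_apply, smul_smul]
  congr 2
  ring

lemma dotR_proj {α : Fin n → ℝ} (h : dotR α α = 2) (x : Fin n → ℝ) : dotR α (proj α x) = 0 := by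
  rw [proj_apply, dotR_sub, dotR_smul, h]; ring

lemma lin_dvd_sub_subst_proj (α : Fin n → ℝ) (p : MvPolynomial (Fin n) ℝ) :
    lin α ∣ p - subst (proj α) p := by
  rw [← Ideal.mem_span_singleton, ← Ideal.Quotient.eq]
  have : (Ideal.Quotient.mkₐ ℝ (Ideal.span {lin α})) =
      (Ideal.Quotient.mkₐ ℝ (Ideal.span {lin α})).comp (subst (proj α)) := by
    ext i
    simp only [AlgHom.comp_apply, Ideal.Quotient.mkₐ_eq_mk]
    rw [Ideal.Quotient.eq, Ideal.mem_span_singleton]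
    refine ⟨MvPolynomial.C (α i / 2), ext_eval fun x => ?_⟩
    simp only [map_sub, eval_subst, map_mul, eval_lin, MvPolynomial.eval_X, MvPolynomial.eval_C,
      proj_apply, Pi.sub_apply, Pi.smul_apply, smul_eq_mul]
    ring
  exact DFunLike.congr_fun this p

lemma lin_dvd_iff {α : Fin n → ℝ} (h : dotR α α = 2) {p : MvPolynomial (Fin n) ℝ} :
    lin α ∣ p ↔ subst (proj α) p = 0 := by
  constructor
  · rintro ⟨q, rfl⟩
    rw [map_mul]
    have : subst (proj α) (lin α) = 0 := ext_eval fun x => by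
      rw [eval_subst, eval_lin, dotR_proj h, map_zero]
    rw [this, zero_mul]
  · intro h0
    have := lin_dvd_sub_subst_proj α p
    rwa [h0, sub_zero] at this

lemma lin_prime {α : Fin n → ℝ} (h : dotR α α = 2) : Prime (lin α) := by
  refine ⟨lin_ne_zero h, ?_, fun p q hpq => ?_⟩
  · intro hu
    have := hu.map (MvPolynomial.eval (0 : Fin n → ℝ))
    rw [eval_lin, dotR_zero] at this
    exact not_isUnit_zero this
  · simp only [lin_dvd_iff h] at hpq ⊢
    rwa [map_mul, mul_eq_zero] at hpq

lemma RootSys.not_lin_dvd (hR : RootSys R) {α β : Fin n → ℝ} (hα : α ∈ R) (hβ : β ∈ R)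
    (hne : α ≠ β) : ¬ lin α ∣ lin β := by
  rw [lin_dvd_iff (hR.norm2 α hα)]
  intro h
  apply hR.noncollinear α hα β hβ hne (dotR α β / 2)
  refine ext_dotR fun x => ?_
  have h1 := eval_subst (proj α) x (lin β)
  rw [h, map_zero, eval_lin, proj_apply, dotR_sub, dotR_smul] at h1
  rw [dotR_smul, dotR_comm x β, dotR_comm x α, dotR_comm α β]
  linarith

/-- The product of the positive roots. -/
noncomputable def delta (R : Finset (Fin n → ℝ)) : MvPolynomial (Fin n) ℝ := ∏ α ∈ R, lin α

lemma RootSys.delta_ne_zero (hR : RootSys R) : delta R ≠ 0 :=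
  prod_ne_zero_iff.2 fun α hα => lin_ne_zero (hR.norm2 α hα)

lemma delta_isHomogeneous (R : Finset (Fin n → ℝ)) : (delta R).IsHomogeneous R.card := by
  have := MvPolynomial.IsHomogeneous.prod R lin (fun _ => 1) fun α _ => lin_isHomogeneous α
  simpa [delta] using this

lemma RootSys.delta_dvd (hR : RootSys R) {p : MvPolynomial (Fin n) ℝ}
    (h : ∀ α ∈ R, lin α ∣ p) : delta R ∣ p := by
  classical
  unfold delta
  suffices ∀ S ⊆ R, ∏ α ∈ S, lin α ∣ p from this R Subset.rfl
  intro S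
  induction S using Finset.induction_on with
  | empty => simp
  | insert β S hβ ih =>
    intro hS
    obtain ⟨q, hq⟩ := ih fun x hx => hS (mem_insert_of_mem hx)
    rw [prod_insert hβ, mul_comm, hq]
    refine mul_dvd_mul_left _ ?_
    have hβR := hS (mem_insert_self _ _)
    have hp := lin_prime (hR.norm2 β hβR)
    have h1 := h β hβR
    rw [hq] at h1
    refine (hp.dvd_or_dvd h1).resolve_left fun h2 => ?_
    obtain ⟨α, hα, h3⟩ := (hp.dvd_finsetProd_iff lin).1 h2
    exact hR.not_lin_dvd hβR (hS (mem_insert_of_mem hα)) (fun he => hβ (he ▸ hα)) h3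

/-- The determinant character. -/
noncomputable def detHom : ((Fin n → ℝ) ≃ₗ[ℝ] (Fin n → ℝ)) →* ℝ where
  toFun e := LinearMap.det e.toLinearMap
  map_one' := LinearMap.det_id
  map_mul' e f := LinearMap.det_comp e.toLinearMap f.toLinearMap

lemma subst_mul (e f : (Fin n → ℝ) ≃ₗ[ℝ] (Fin n → ℝ)) (p : MvPolynomial (Fin n) ℝ) :
    subst (e * f).toLinearMap p = subst f.toLinearMap (subst e.toLinearMap p) :=
  ext_eval fun x => by simp only [eval_subst]; rfl

lemma RootSys.subst_delta_sign (hR : RootSys R) {e : (Fin n → ℝ) ≃ₗ[ℝ] (Fin n → ℝ)}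
    (he : e ∈ coxGroup R) : subst e.toLinearMap (delta R) = delta R ∨
      subst e.toLinearMap (delta R) = - delta R := by
  classical
  have he' := inv_mem he
  have h1 : ∀ α : Fin n → ℝ, subst e.toLinearMap (lin α) = lin (e⁻¹ α) := fun α =>
    ext_eval fun x => by
      rw [eval_subst, eval_lin, eval_lin, LinearEquiv.coe_coe, hR.dotR_map_right he]
  have hneg : ∀ α : Fin n → ℝ, lin (-α) = - lin α := fun α =>
    ext_eval fun x => by rw [map_neg, eval_lin, eval_lin, neg_dotR]
  let φ : (Fin n → ℝ) → (Fin n → ℝ) := fun α => if e⁻¹ α ∈ R then e⁻¹ α else -(e⁻¹ α)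
  have hφ : ∀ α ∈ R, φ α ∈ R := fun α hα => by
    simp only [φ]; split_ifs with h
    · exact h
    · exact (hR.stableR _ he' α hα).resolve_left h
  have hinj : Set.InjOn φ R := by
    intro α hα β hβ h
    have h2 : e⁻¹ α = e⁻¹ β ∨ e⁻¹ α = -(e⁻¹ β) := by
      simp only [φ] at h
      split_ifs at h
      · exact .inl h
      · exact .inr h
      · exact .inr (by rw [← h, neg_neg])
      · exact .inl (neg_injective h)
    rcases h2 with h2 | h2
    · exact (e⁻¹).injective h2
    · rw [← map_neg] at h2
      have := (e⁻¹).injective h2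
      exact absurd (this ▸ hα) (hR.neg_notMem hβ)
  have hprod : ∏ α ∈ R, lin (φ α) = delta R := by
    rw [delta]
    refine prod_bij (fun α _ => φ α) hφ (fun a ha b hb h => hinj ha hb h) (fun b hb => ?_)
      fun _ _ => rfl
    exact surj_on_of_inj_on_of_card_le (fun α _ => φ α) hφ (fun a b ha hb h => hinj ha hb h)
      le_rfl b hb |>.imp fun a h => ⟨h.1, h.2.symm⟩
  have h3 : subst e.toLinearMap (delta R) =
      ∏ α ∈ R, (if e⁻¹ α ∈ R then 1 else -1) * lin (φ α) := by
    rw [delta, map_prod]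
    refine prod_congr rfl fun α _ => ?_
    rw [h1]
    simp only [φ]
    split_ifs
    · rw [one_mul]
    · rw [hneg]; ring
  rw [h3, prod_mul_distrib, hprod]
  have h4 : ∀ S : Finset (Fin n → ℝ),
      (∏ α ∈ S, (if e⁻¹ α ∈ R then 1 else -1 : MvPolynomial (Fin n) ℝ)) = 1 ∨
      (∏ α ∈ S, (if e⁻¹ α ∈ R then 1 else -1 : MvPolynomial (Fin n) ℝ)) = -1 := by
    intro S
    induction S using Finset.induction_on with
    | empty => left; simp
    | insert β S hβ ih =>
      rw [prod_insert hβ]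
      rcases ih with h | h <;> rw [h] <;> split_ifs <;> simp
  rcases h4 R with h | h <;> rw [h] <;> simp

lemma RootSys.subst_delta_refl (hR : RootSys R) {α : Fin n → ℝ} (hα : α ∈ R) :
    subst (refl α (hR.norm2 α hα)).toLinearMap (delta R) = - delta R := by
  classical
  have h2 := hR.norm2 α hα
  refine (hR.subst_delta_sign (refl_mem h2 hα)).resolve_left fun h => ?_
  set q := ∏ β ∈ R.erase α, lin β with hq
  have hd : delta R = lin α * q := (mul_prod_erase R lin hα).symm
  have h3 : subst (proj α) q ≠ 0 := by
    rw [hq, map_prod, prod_ne_zero_iff]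
    intro β hβ h0
    rw [← lin_dvd_iff h2] at h0
    exact hR.not_lin_dvd hα (mem_of_mem_erase hβ) (ne_of_mem_erase hβ).symm h0
  have hl : subst (refl α h2).toLinearMap (lin α) = - lin α := ext_eval fun x => by
    rw [eval_subst, map_neg, eval_lin, eval_lin, LinearEquiv.coe_coe, refl_apply, dotR_sub,
      dotR_smul, h2]
    ring
  have h4 : - subst (refl α h2).toLinearMap q = q := by
    apply mul_left_cancel₀ (lin_ne_zero h2)
    rw [← hd, ← h, hd, map_mul, hl]; ring
  apply h3
  have h5 : subst (proj α) (subst (refl α h2).toLinearMap q) = subst (proj α) q :=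
    ext_eval fun x => by
      rw [eval_subst, eval_subst, eval_subst, LinearEquiv.coe_coe, refl_apply, dotR_proj h2,
        zero_smul, sub_zero]
  have h6 := congrArg (subst (proj α)) h4
  rw [map_neg, h5] at h6
  have : (2 : MvPolynomial (Fin n) ℝ) * subst (proj α) q = 0 := by
    linear_combination -h6
  exact (mul_eq_zero.1 this).resolve_left (by norm_num)

lemma RootSys.subst_delta (hR : RootSys R) {e : (Fin n → ℝ) ≃ₗ[ℝ] (Fin n → ℝ)}
    (he : e ∈ coxGroup R) : subst e.toLinearMap (delta R) = detHom e • delta R := by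
  induction he using Subgroup.closure_induction with
  | mem e he =>
    obtain ⟨α, hα, rfl⟩ := hR.closure_eq he
    rw [hR.subst_delta_refl hα]
    change _ = LinearMap.det _ • _
    rw [det_refl]; simp
  | one =>
    rw [map_one, one_smul]
    exact ext_eval fun x => by rw [eval_subst]; rfl
  | mul e f _ _ he hf =>
    rw [subst_mul, he, map_smul, hf, map_mul, smul_smul]
  | inv e _ he =>
    have h1 : subst (e⁻¹).toLinearMap (subst e.toLinearMap (delta R)) = delta R := by
      rw [← subst_mul, mul_inv_cancel]
      exact ext_eval fun x => by rw [eval_subst]; rfl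
    rw [he, map_smul] at h1
    have h2 : detHom e⁻¹ * detHom e = 1 := by rw [← map_mul, inv_mul_cancel, map_one]
    conv_rhs => rw [← h1]
    rw [smul_smul, h2, one_smul]

lemma RootSys.delta_dvd_of_mem (hR : RootSys R) {m : ℕ} {p : MvPolynomial (Fin n) ℝ}
    (hp : p ∈ semiInv detHom R m) : delta R ∣ p := by
  refine hR.delta_dvd fun α hα => ?_
  have h2 := hR.norm2 α hα
  rw [lin_dvd_iff h2]
  have h := (mem_semiInv.1 hp).2 _ (refl_mem h2 hα)
  have hd : detHom (refl α h2) = -1 := det_refl h2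
  rw [hd, neg_one_smul] at h
  have h5 : subst (proj α) (subst (refl α h2).toLinearMap p) = subst (proj α) p :=
    ext_eval fun x => by
      rw [eval_subst, eval_subst, eval_subst, LinearEquiv.coe_coe, refl_apply, dotR_proj h2,
        zero_smul, sub_zero]
  rw [h, map_neg] at h5
  have : (2 : MvPolynomial (Fin n) ℝ) * subst (proj α) p = 0 := by
    linear_combination -h5
  exact (mul_eq_zero.1 this).resolve_left (by norm_num)

/-- The Hilbert function of the invariants. -/
noncomputable def hilb (R : Finset (Fin n → ℝ)) (m : ℕ) : ℕ := Module.finrank ℝ (semiInv 1 R m)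

lemma isHomogeneous_of_mul {p q : MvPolynomial (Fin n) ℝ} {k m : ℕ} (hp : p.IsHomogeneous k)
    (hp0 : p ≠ 0) (h : (p * q).IsHomogeneous (k + m)) : q.IsHomogeneous m := by
  have h1 : MvPolynomial.homogeneousComponent (k + m) (p * q) =
      p * MvPolynomial.homogeneousComponent m q := by
    conv_lhs => rw [← q.sum_homogeneousComponent, mul_sum, map_sum]
    have h2 : ∀ i ∈ range (q.totalDegree + 1), MvPolynomial.homogeneousComponent (k + m)
        (p * MvPolynomial.homogeneousComponent i q) =
        if i = m then p * MvPolynomial.homogeneousComponent i q else 0 := fun i _ => by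
      rw [MvPolynomial.homogeneousComponent_of_mem
        (hp.mul (MvPolynomial.homogeneousComponent_isHomogeneous i q))]
      simp [eq_comm]
    rw [sum_congr rfl h2, sum_ite_eq']
    split_ifs with h3
    · rfl
    · rw [MvPolynomial.homogeneousComponent_eq_zero, mul_zero]
      simp at h3; omega
  rw [MvPolynomial.homogeneousComponent_of_mem h, if_pos rfl] at h1
  rw [mul_left_cancel₀ hp0 h1]
  exact MvPolynomial.homogeneousComponent_isHomogeneous m q

lemma RootSys.semiInv_det (hR : RootSys R) (m : ℕ) :
    semiInv detHom R (m + R.card) =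
      (semiInv 1 R m).map (LinearMap.mulLeft ℝ (delta R)) := by
  have hδ := hR.delta_ne_zero
  ext p
  constructor
  · intro hp
    obtain ⟨q, rfl⟩ := hR.delta_dvd_of_mem hp
    rw [mem_semiInv] at hp
    refine ⟨q, mem_semiInv.2 ⟨?_, fun e he => ?_⟩, rfl⟩
    · rw [add_comm] at hp
      exact isHomogeneous_of_mul (delta_isHomogeneous R) hδ hp.1
    · have h1 := hp.2 e he
      rw [map_mul, hR.subst_delta he, smul_mul_assoc] at h1
      have h2 : detHom e ≠ 0 := by
        have : detHom e * detHom e⁻¹ = 1 := by rw [← map_mul, mul_inv_cancel, map_one]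
        exact left_ne_zero_of_mul_eq_one this
      have h3 := smul_right_injective _ h2 h1
      rw [MonoidHom.one_apply, one_smul]
      exact mul_left_cancel₀ hδ h3
  · rintro ⟨q, hq, rfl⟩
    obtain ⟨hq1, hq2⟩ := mem_semiInv.1 hq
    refine mem_semiInv.2 ⟨?_, fun e he => ?_⟩
    · rw [add_comm]; exact (delta_isHomogeneous R).mul hq1
    · rw [LinearMap.mulLeft_apply, map_mul, hR.subst_delta he, hq2 e he, MonoidHom.one_apply,
        one_smul, smul_mul_assoc]

lemma RootSys.semiInv_det_of_lt (hR : RootSys R) {m : ℕ} (hm : m < R.card) :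
    semiInv detHom R m = ⊥ := by
  rw [eq_bot_iff]
  intro p hp
  rw [Submodule.mem_bot]
  by_contra h0
  have h1 := MvPolynomial.totalDegree_le_of_dvd_of_isDomain (hR.delta_dvd_of_mem hp) h0
  rw [(delta_isHomogeneous R).totalDegree hR.delta_ne_zero,
    (mem_semiInv.1 hp).1.totalDegree h0] at h1
  omega

lemma RootSys.finrank_semiInv_det (hR : RootSys R) (m : ℕ) :
    Module.finrank ℝ (semiInv detHom R m) =
      if R.card ≤ m then hilb R (m - R.card) else 0 := by
  split_ifs with h
  · obtain ⟨k, rfl⟩ := Nat.exists_eq_add_of_le' h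
    rw [hR.semiInv_det, Nat.add_sub_cancel, hilb]
    refine (Submodule.equivMapOfInjective _ ?_ _).symm.finrank_eq
    exact fun a b hab => mul_left_cancel₀ hR.delta_ne_zero hab
  · rw [hR.semiInv_det_of_lt (not_le.1 h), finrank_bot]

open Classical in
/-- The Solomon type identity for the Hilbert functions of parabolic subgroups. -/
lemma RootSys.eulerSum_hilb (hR : RootSys R) (m : ℕ) :
    eulerSum R (fun x => ((elts (para R x)).card : ℝ) * hilb (para R x) m) =
      (-1) ^ n * (elts R).card * (if R.card ≤ m then hilb R (m - R.card) else 0 : ℕ) := by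
  have h1 : ∀ x, ((elts (para R x)).card : ℝ) * hilb (para R x) m =
      ∑ e ∈ elts R, chi m e * if e ∈ coxGroup (para R x) then 1 else 0 := by
    intro x
    have h := (hR.parabolic x).sum_chi 1 m
    rw [hilb, ← h]
    simp only [MonoidHom.one_apply, one_mul, mul_ite, mul_one, mul_zero]
    rw [← sum_filter]
    refine sum_congr ?_ fun _ _ => rfl
    ext e
    rw [mem_filter, (hR.parabolic x).mem_elts, hR.mem_elts]
    exact ⟨fun h => ⟨coxGroup_mono (para_subset x) h, h⟩, fun h => h.2⟩
  simp_rw [h1]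
  rw [eulerSum_sum, ← hR.finrank_semiInv_det, mul_assoc, ← hR.sum_chi, mul_sum]
  refine sum_congr rfl fun e he => ?_
  rw [hR.mem_elts] at he
  rw [eulerSum_mul_left, hR.eulerSum_fix he]
  have h2 : detHom e = (-1) ^ (n + fixDim e) := det_eq fun x y => hR.dotR_map he x y
  have h3 : ((-1 : ℝ) ^ n) * (-1) ^ n = 1 := by rw [← mul_pow]; norm_num
  rw [h2, pow_add]
  change chi m e * (-1) ^ fixDim e = _
  linear_combination (-(chi m e * (-1) ^ fixDim e)) * h3

end

/-! ### Hilbert series -/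

section

variable {n : ℕ} {R : Finset (Fin n → ℝ)}

/-- The exponents of weight `m`. -/
abbrev Expo (d : Fin n → ℕ) (m : ℕ) := {a : Fin n →₀ ℕ // ∑ j, a j * d j = m}

lemma coeff_prod_geom {d : Fin n → ℕ} (hd : ∀ j, 0 < d j) (m : ℕ) :
    PowerSeries.coeff m (∏ j, (PowerSeries.mk fun k => if d j ∣ k then (1 : ℝ) else 0)) =
      Nat.card (Expo d m) := by
  classical
  rw [PowerSeries.coeff_prod]
  simp only [PowerSeries.coeff_mk, prod_boole]
  simp only [mem_univ, true_imp_iff, Finset.sum_boole]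
  congr 1
  rw [← Nat.card_eq_finsetCard]
  refine Nat.card_congr ⟨fun l => ⟨Finsupp.equivFunOnFinite.symm fun j => l.1 j / d j, ?_⟩,
    fun a => ⟨Finsupp.equivFunOnFinite.symm fun j => a.1 j * d j, ?_⟩, fun l => ?_, fun a => ?_⟩
  · have := l.2
    rw [mem_filter, mem_finsuppAntidiag] at this
    exact (sum_congr rfl fun j _ => Nat.div_mul_cancel (this.2 j)).trans this.1.1
  · rw [mem_filter, mem_finsuppAntidiag]
    exact ⟨⟨a.2, subset_univ _⟩, fun j => Dvd.intro_left _ rfl⟩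
  · have := l.2
    rw [mem_filter] at this
    apply Subtype.ext
    ext j
    exact Nat.div_mul_cancel (this.2 j)
  · apply Subtype.ext
    ext j
    exact Nat.mul_div_cancel _ (hd j)

lemma geom_mul {d : ℕ} (hd : 0 < d) :
    (PowerSeries.mk fun k => if d ∣ k then (1 : ℝ) else 0) * (1 - PowerSeries.X ^ d) = 1 := by
  ext k
  rw [mul_sub, mul_one, map_sub, PowerSeries.coeff_mk, PowerSeries.coeff_mul_X_pow',
    PowerSeries.coeff_one, PowerSeries.coeff_mk]
  by_cases hk : d ≤ k
  · have hs : d ∣ k - d ↔ d ∣ k :=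
      ⟨fun h => by simpa [Nat.sub_add_cancel hk] using h.add (dvd_refl d),
        fun h => Nat.dvd_sub h (dvd_refl d)⟩
    simp only [hk, hs, if_true]
    have : k ≠ 0 := by omega
    simp only [this, if_false]
    simp
  · rw [if_neg hk]
    by_cases h0 : k = 0
    · simp [h0]
    · rw [if_neg h0, if_neg (fun h => hk (Nat.le_of_dvd (by omega) h)), sub_zero]

lemma finite_expo {d : Fin n → ℕ} (hd : ∀ j, 0 < d j) (m : ℕ) : Finite (Expo d m) := by
  refine Finite.of_injective (β := Fin n → Fin (m + 1)) (fun a j => ⟨a.1 j, ?_⟩) fun a b h => ?_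
  · have h1 : a.1 j * d j ≤ m := by
      conv_rhs => rw [← a.2]
      exact single_le_sum (f := fun j => a.1 j * d j) (fun _ _ => Nat.zero_le _) (mem_univ j)
    have := Nat.le_mul_of_pos_right (a.1 j) (hd j)
    omega
  · apply Subtype.ext
    ext j
    simpa using congrFun h j

/-- The Hilbert series of the invariants when they form a polynomial algebra. -/
lemma hilb_free {d : Fin n → ℕ} {P : Fin n → MvPolynomial (Fin n) ℝ}
    (homog : ∀ j, (P j).IsHomogeneous (d j))
    (invP : ∀ j, ∀ e ∈ coxGroup R, ∀ x : Fin n → ℝ,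
      MvPolynomial.eval (e x) (P j) = MvPolynomial.eval x (P j))
    (algInd : AlgebraicIndependent ℝ P)
    (gen : ∀ q : MvPolynomial (Fin n) ℝ,
      (∀ e ∈ coxGroup R, ∀ x, MvPolynomial.eval (e x) q = MvPolynomial.eval x q) →
      q ∈ Algebra.adjoin ℝ (Set.range P)) (hd : ∀ j, 0 < d j) :
    (PowerSeries.mk fun m => (hilb R m : ℝ)) * ∏ j, (1 - PowerSeries.X ^ (d j)) = 1 := by
  have key : ∀ m, hilb R m = Nat.card (Expo d m) := by
    intro m
    have := finite_expo hd m
    have := Fintype.ofFinite (Expo d m)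
    have hmon : ∀ a : Fin n →₀ ℕ, (∏ j, P j ^ a j).IsHomogeneous (∑ j, a j * d j) := fun a =>
      MvPolynomial.IsHomogeneous.prod _ _ _ fun j _ => by
        rw [mul_comm]; exact (homog j).pow (a j)
    have haev : ∀ a : Fin n →₀ ℕ, MvPolynomial.aeval P (MvPolynomial.monomial a (1 : ℝ)) =
        ∏ j, P j ^ a j := fun a => by
      rw [MvPolynomial.aeval_monomial, map_one, one_mul, Finsupp.prod_fintype]
      simp
    have hspan : semiInv 1 R m =
        Submodule.span ℝ (Set.range fun a : Expo d m => ∏ j, P j ^ a.1 j) := by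
      apply le_antisymm
      · intro q hq
        rw [mem_semiInv] at hq
        have hg := gen q fun e he x => by
          have := hq.2 e he
          rw [MonoidHom.one_apply, one_smul] at this
          conv_rhs => rw [← this]
          rw [eval_subst]; rfl
        rw [Algebra.adjoin_range_eq_range_aeval] at hg
        obtain ⟨φ, rfl⟩ := hg
        change MvPolynomial.IsHomogeneous (MvPolynomial.aeval P φ) m ∧ _ at hq
        change MvPolynomial.aeval P φ ∈ _
        have h1 := MvPolynomial.homogeneousComponent_of_mem (m := m) hq.1
        rw [if_pos rfl] at h1
        rw [← h1]
        have h2 : MvPolynomial.homogeneousComponent m (MvPolynomial.aeval P φ) =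
            ∑ a ∈ φ.support, MvPolynomial.homogeneousComponent m
              (MvPolynomial.aeval P (MvPolynomial.monomial a (φ.coeff a))) := by
          conv_lhs => rw [φ.as_sum, map_sum, map_sum]
        rw [h2]
        refine Submodule.sum_mem _ fun a _ => ?_
        rw [← mul_one (φ.coeff a), ← smul_eq_mul, ← MvPolynomial.smul_monomial, map_smul, map_smul,
          haev]
        refine Submodule.smul_mem _ _ ?_
        rw [MvPolynomial.homogeneousComponent_of_mem (hmon a)]
        split_ifs with h
        · exact Submodule.subset_span ⟨⟨a, h.symm⟩, rfl⟩
        · exact Submodule.zero_mem _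
      · rw [Submodule.span_le]
        rintro _ ⟨a, rfl⟩
        rw [SetLike.mem_coe, mem_semiInv]
        have := hmon a.1
        rw [a.2] at this
        refine ⟨this, fun e he => ?_⟩
        rw [MonoidHom.one_apply, one_smul, map_prod]
        refine prod_congr rfl fun j _ => ?_
        rw [map_pow]
        congr 1
        exact ext_eval fun x => by rw [eval_subst]; exact invP j e he x
    rw [hilb, hspan, Nat.card_eq_fintype_card]
    refine finrank_span_eq_card ?_
    have hli := ((MvPolynomial.basisMonomials (Fin n) ℝ).linearIndependent.map'
      (MvPolynomial.aeval P).toLinearMap (LinearMap.ker_eq_bot.2 algInd)).comp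
      (Subtype.val : Expo d m → _) Subtype.val_injective
    have hf : (fun a : Expo d m => ∏ j, P j ^ a.1 j) = fun a : Expo d m =>
        MvPolynomial.aeval P (MvPolynomial.monomial a.1 (1 : ℝ)) := funext fun a => (haev a.1).symm
    rw [hf]
    exact hli
  have h2 : (PowerSeries.mk fun m => (hilb R m : ℝ)) =
      ∏ j, (PowerSeries.mk fun k => if d j ∣ k then (1 : ℝ) else 0) := by
    ext m
    rw [PowerSeries.coeff_mk, coeff_prod_geom hd, key]
  rw [h2, ← prod_mul_distrib]
  exact prod_eq_one fun j _ => geom_mul (hd j)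

lemma _root_.CoxeterData.d_pos (C : CoxeterData n) (j : Fin n) : 0 < C.d j := by
  rw [Nat.pos_iff_ne_zero]
  intro h0
  have h1 := C.homog j
  rw [h0, ← MvPolynomial.totalDegree_zero_iff_isHomogeneous,
    MvPolynomial.totalDegree_eq_zero_iff_eq_C] at h1
  apply C.algInd.transcendental j
  rw [h1]
  exact isAlgebraic_algebraMap (A := MvPolynomial (Fin n) ℝ) _

/-- The Hilbert series of the invariants. -/
noncomputable def hilbSer (R : Finset (Fin n → ℝ)) : PowerSeries ℝ :=
  PowerSeries.mk fun m => (hilb R m : ℝ)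

lemma _root_.CoxeterData.hilbSer_mul (C : CoxeterData n) :
    hilbSer C.R * ∏ j, (1 - PowerSeries.X ^ (C.d j)) = 1 :=
  hilb_free C.homog C.invP C.algInd C.gen C.d_pos

lemma hilbSer_empty : hilbSer (∅ : Finset (Fin n → ℝ)) * (1 - PowerSeries.X) ^ n = 1 := by
  have := hilb_free (R := (∅ : Finset (Fin n → ℝ))) (P := MvPolynomial.X) (d := fun _ => 1)
    (fun j => MvPolynomial.isHomogeneous_X ℝ j) (fun j e he x => ?_)
    (MvPolynomial.algebraicIndependent_X _ _) (fun q _ => ?_) fun _ => one_pos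
  · simpa [hilbSer] using this
  · have : e ∈ (⊥ : Subgroup ((Fin n → ℝ) ≃ₗ[ℝ] (Fin n → ℝ))) := by
      have h : reflSet (∅ : Finset (Fin n → ℝ)) = ∅ := by ext; simp [reflSet]
      rwa [coxGroup, h, Subgroup.closure_empty] at he
    rw [Subgroup.mem_bot] at this
    rw [this]; rfl
  · rw [MvPolynomial.adjoin_range_X]; trivial

end

/-! ### Inversions and orbits -/

section

variable {n : ℕ} {R : Finset (Fin n → ℝ)} {A : Type*} [CommRing A]

lemma RootSys.mem_para_iff' (hR : RootSys R) {e : (Fin n → ℝ) ≃ₗ[ℝ] (Fin n → ℝ)}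
    {x : Fin n → ℝ} : e ∈ coxGroup (para R x) ↔ e ∈ coxGroup R ∧ e x = x :=
  ⟨fun h => ⟨coxGroup_mono (para_subset x) h, para_fix_self h⟩,
    fun h => (hR.mem_para_iff h.1).2 h.2⟩

lemma RootSys.hilb_para_map (hR : RootSys R) {w : (Fin n → ℝ) ≃ₗ[ℝ] (Fin n → ℝ)}
    (hw : w ∈ coxGroup R) (x : Fin n → ℝ) (m : ℕ) :
    hilb (para R (w x)) m = hilb (para R x) m := by
  have hinj : Function.Injective (subst w.toLinearMap).toLinearMap := by
    intro p q h
    refine ext_eval fun y => ?_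
    have := congrArg (MvPolynomial.eval (w⁻¹ y)) h
    simp only [AlgHom.toLinearMap_apply, eval_subst] at this
    have h2 : w.toLinearMap (w⁻¹ y) = y := by
      change (w * w⁻¹) y = y
      rw [mul_inv_cancel]; rfl
    rwa [h2] at this
  have hmap : semiInv 1 (para R x) m =
      (semiInv 1 (para R (w x)) m).map (subst w.toLinearMap).toLinearMap := by
    ext p
    rw [Submodule.mem_map]
    constructor
    · intro hp
      rw [mem_semiInv] at hp
      refine ⟨subst (w⁻¹).toLinearMap p, mem_semiInv.2
        ⟨subst_isHomogeneous _ hp.1, fun e he => ?_⟩, ?_⟩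
      · rw [hR.mem_para_iff'] at he
        have h1 : w⁻¹ * e * w ∈ coxGroup (para R x) := by
          rw [hR.mem_para_iff']
          refine ⟨mul_mem (mul_mem (inv_mem hw) he.1) hw, ?_⟩
          change w⁻¹ (e (w x)) = x
          rw [he.2]
          change (w⁻¹ * w) x = x
          rw [inv_mul_cancel]; rfl
        have h2 := hp.2 _ h1
        rw [MonoidHom.one_apply, one_smul] at h2 ⊢
        rw [← subst_mul]
        conv_rhs => rw [← h2]
        rw [← subst_mul, mul_assoc, mul_inv_cancel, mul_one]
      · rw [AlgHom.toLinearMap_apply, ← subst_mul, inv_mul_cancel]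
        exact ext_eval fun x => by rw [eval_subst]; rfl
    · rintro ⟨q, hq, rfl⟩
      rw [mem_semiInv] at hq
      refine mem_semiInv.2 ⟨subst_isHomogeneous _ hq.1, fun e he => ?_⟩
      rw [hR.mem_para_iff'] at he
      have h1 : w * e * w⁻¹ ∈ coxGroup (para R (w x)) := by
        rw [hR.mem_para_iff']
        refine ⟨mul_mem (mul_mem hw he.1) (inv_mem hw), ?_⟩
        change w (e ((w⁻¹ * w) x)) = w x
        rw [inv_mul_cancel]
        change w (e x) = w x
        rw [he.2]
      have h2 := hq.2 _ h1
      rw [MonoidHom.one_apply, one_smul] at h2 ⊢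
      rw [AlgHom.toLinearMap_apply, ← subst_mul]
      conv_rhs => rw [← h2]
      rw [← subst_mul, mul_assoc, inv_mul_cancel, mul_one]
  rw [hilb, hilb, hmap]
  exact (Submodule.equivMapOfInjective _ hinj _).finrank_eq

lemma RootSys.sum_elts_mul_right (hR : RootSys R) {B : Type*} [AddCommMonoid B]
    {u : (Fin n → ℝ) ≃ₗ[ℝ] (Fin n → ℝ)} (hu : u ∈ coxGroup R)
    (f : ((Fin n → ℝ) ≃ₗ[ℝ] (Fin n → ℝ)) → B) :
    ∑ w ∈ elts R, f (w * u) = ∑ w ∈ elts R, f w :=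
  sum_bij' (fun w _ => w * u) (fun w _ => w * u⁻¹)
    (fun w hw => hR.mem_elts.2 (mul_mem (hR.mem_elts.1 hw) hu))
    (fun w hw => hR.mem_elts.2 (mul_mem (hR.mem_elts.1 hw) (inv_mem hu)))
    (by simp) (by simp) (by simp)

/-- The generating function of the number of negative roots on an orbit. -/
noncomputable def orbSum (R : Finset (Fin n → ℝ)) (X : A) (x : Fin n → ℝ) : A :=
  ∑ w ∈ elts R, X ^ neg R (w x)

lemma RootSys.orbSum_eq (hR : RootSys R) (X : A) {x y : Fin n → ℝ} (hx : Regular R x)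
    (hy : Regular R y) : orbSum R X x = orbSum R X y := by
  obtain ⟨u, hu, h⟩ := hR.exists_sameFace hx hy
  have h1 : orbSum R X (u x) = orbSum R X x :=
    hR.sum_elts_mul_right hu fun w => X ^ neg R (w x)
  rw [← h1]
  exact sum_congr rfl fun w hw => by
    rw [(hR.sameFace_map (hR.mem_elts.1 hw) h).neg_eq]

lemma neg_add_of_sign {x y z : Fin n → ℝ} (h : ∀ α ∈ R, SignType.sign (dotR α z) =
    if dotR α x = 0 then SignType.sign (dotR α y) else SignType.sign (dotR α x)) :
    neg R z = neg R x + neg (para R x) y := by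
  classical
  unfold neg para
  rw [filter_filter, ← card_union_of_disjoint]
  · congr 1
    ext α
    simp only [mem_filter, mem_union, ← and_or_left, and_congr_right_iff]
    intro hα
    have := h α hα
    rw [← sign_eq_neg_one_iff, this]
    split_ifs with h0
    · simp [h0, sign_eq_neg_one_iff]
    · simp [h0, sign_eq_neg_one_iff]
  · rw [disjoint_filter]
    rintro α - h1 ⟨h2, -⟩
    exact h1.ne h2

lemma RootSys.orbSum_shift (hR : RootSys R) (X : A) (x : Fin n → ℝ) {y : Fin n → ℝ}
    (hy : Regular R y) : orbSum R X y =
      ∑ w ∈ elts R, X ^ neg R (w x) * X ^ neg (para R (w x)) (w y) := by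
  have h1 : ∀ᶠ t : ℝ in nhdsWithin 0 (Set.Ioi 0), ∀ w ∈ elts R, ∀ α ∈ R,
      SignType.sign (dotR α (w x + t • w y)) = if dotR α (w x) = 0 then
        SignType.sign (dotR α (w y)) else SignType.sign (dotR α (w x)) := by
    rw [Filter.eventually_all_finset]
    exact fun w _ => eventually_sameFace (w x) (w y)
  obtain ⟨t, ht⟩ := h1.exists
  have hreg : Regular R (x + t • y) := by
    intro α hα h0
    have := ht 1 (hR.mem_elts.2 (one_mem _)) α hα
    change SignType.sign (dotR α (x + t • y)) = if dotR α x = 0 then SignType.sign (dotR α y) else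
      SignType.sign (dotR α x) at this
    rw [h0, sign_zero] at this
    split_ifs at this with h2
    · exact hy α hα (sign_eq_zero_iff.1 this.symm)
    · exact h2 (sign_eq_zero_iff.1 this.symm)
  rw [hR.orbSum_eq X hy hreg]
  refine sum_congr rfl fun w hw => ?_
  rw [← pow_add, ← neg_add_of_sign (ht w hw), map_add, map_smul]

lemma RootSys.card_mul_orbSum (hR : RootSys R) (X : A) (x : Fin n → ℝ) {y : Fin n → ℝ}
    (hy : Regular R y) : ((elts (para R x)).card : A) * orbSum R X y =
      ∑ w ∈ elts R, X ^ neg R (w x) * orbSum (para R (w x)) X (w y) := by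
  have hx := hR.parabolic x
  have h1 : ∀ u ∈ elts (para R x), orbSum R X y =
      ∑ w ∈ elts R, X ^ neg R (w x) * X ^ neg (para R (w x)) (w (u y)) := fun u hu => by
    have hu := coxGroup_mono (para_subset x) (hx.mem_elts.1 hu)
    rw [← hR.orbSum_shift X x (hR.regular_map hu hy)]
    exact (hR.sum_elts_mul_right hu fun w => X ^ neg R (w y)).symm
  rw [← nsmul_eq_mul, ← sum_const, sum_congr rfl h1, sum_comm]
  refine sum_congr rfl fun w hw => ?_
  rw [← mul_sum]
  congr 1
  have hw := hR.mem_elts.1 hw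
  have hwx := hR.parabolic (w x)
  refine sum_bij' (fun u _ => w * u * w⁻¹) (fun u _ => w⁻¹ * u * w) (fun u hu => ?_)
    (fun u hu => ?_) (fun u _ => by group) (fun u _ => by group) fun u _ => ?_
  · rw [hx.mem_elts, hR.mem_para_iff'] at hu
    rw [hwx.mem_elts, hR.mem_para_iff']
    refine ⟨mul_mem (mul_mem hw hu.1) (inv_mem hw), ?_⟩
    change w (u ((w⁻¹ * w) x)) = w x
    rw [inv_mul_cancel]
    change w (u x) = w x
    rw [hu.2]
  · rw [hwx.mem_elts, hR.mem_para_iff'] at hu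
    rw [hx.mem_elts, hR.mem_para_iff']
    refine ⟨mul_mem (mul_mem (inv_mem hw) hu.1) hw, ?_⟩
    change w⁻¹ (u (w x)) = x
    rw [hu.2]
    change (w⁻¹ * w) x = x
    rw [inv_mul_cancel]; rfl
  · congr 2
    change w (u y) = w (u ((w⁻¹ * w) y))
    rw [inv_mul_cancel]; rfl

lemma coeff_eulerSum (s : Finset (Fin n → ℝ)) (f : (Fin n → ℝ) → PowerSeries ℝ) (m : ℕ) :
    PowerSeries.coeff m (eulerSum s f) = eulerSum s fun x => PowerSeries.coeff m (f x) := by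
  unfold eulerSum
  rw [map_sum]
  refine sum_congr rfl fun q _ => ?_
  have : faceSign (PowerSeries ℝ) s q.out = PowerSeries.C (faceSign ℝ s q.out) := by
    simp [faceSign]
  rw [this, PowerSeries.coeff_C_mul]

lemma RootSys.eulerSum_hilbSer (hR : RootSys R) :
    eulerSum R (fun x => ((elts (para R x)).card : PowerSeries ℝ) * hilbSer (para R x)) =
      (-1 : PowerSeries ℝ) ^ n * ((elts R).card : PowerSeries ℝ) * (PowerSeries.X ^ R.card * hilbSer R) := by
  have hc : ∀ k : ℕ, (k : PowerSeries ℝ) = PowerSeries.C (k : ℝ) := fun k => by simp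
  have hs : ((-1 : PowerSeries ℝ) ^ n) = PowerSeries.C ((-1) ^ n) := by simp
  refine PowerSeries.ext fun m => ?_
  rw [coeff_eulerSum, hs, hc, ← map_mul, PowerSeries.coeff_C_mul, PowerSeries.coeff_X_pow_mul']
  have h := hR.eulerSum_hilb m
  simp only [hilbSer, PowerSeries.coeff_mk, hc, PowerSeries.coeff_C_mul]
  rw [h]
  split_ifs <;> simp

lemma RootSys.eulerSum_orbSum (hR : RootSys R) (X : A) :
    eulerSum R (orbSum R X) = (elts R).card * ((-1) ^ n * X ^ R.card) := by
  have := eulerSum_sum R (elts R) fun w x => X ^ neg R (w x)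
  rw [← nsmul_eq_mul, ← sum_const]
  refine this.trans (sum_congr rfl fun w hw => hR.eulerSum_neg X (hR.mem_elts.1 hw))

lemma RootSys.hilbSer_mul_orbSum (hR : RootSys R) {y : Fin n → ℝ} (hy : Regular R y) :
    (1 - PowerSeries.X : PowerSeries ℝ) ^ n * orbSum R (PowerSeries.X : PowerSeries ℝ) y * hilbSer R = 1 := by
  classical
  induction hN : R.card using Nat.strong_induction_on generalizing R y with
  | _ N ih =>
  rcases Nat.eq_zero_or_pos N with h0 | hpos
  · rw [h0, card_eq_zero] at hN
    subst hN
    have h1 : elts (∅ : Finset (Fin n → ℝ)) = {1} := by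
      ext e
      have h : reflSet (∅ : Finset (Fin n → ℝ)) = ∅ := by ext; simp [reflSet]
      rw [hR.mem_elts, coxGroup, h, Subgroup.closure_empty, Subgroup.mem_bot, mem_singleton]
    rw [orbSum, h1, sum_singleton, neg, filter_empty, card_empty, pow_zero, mul_one, mul_comm]
    exact hilbSer_empty
  set T := (1 - PowerSeries.X : PowerSeries ℝ) ^ n * orbSum R (PowerSeries.X : PowerSeries ℝ) y with hT
  have h1 : ∀ x, orbSum R (PowerSeries.X : PowerSeries ℝ) x =
      T * (((elts (para R x)).card : PowerSeries ℝ) * hilbSer (para R x)) +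
        (((elts R).card : PowerSeries ℝ) * (1 - T * hilbSer R)) * if para R x = R then 1 else 0 := by
    intro x
    by_cases hx : para R x = R
    · rw [if_pos hx, hx]
      have : orbSum R (PowerSeries.X : PowerSeries ℝ) x = ((elts R).card : PowerSeries ℝ) := by
        rw [orbSum, ← nsmul_one, ← sum_const]
        refine sum_congr rfl fun w hw => ?_
        have hw : w ∈ coxGroup (para R x) := by rw [hx]; exact hR.mem_elts.1 hw
        rw [para_fix_self hw, neg, card_eq_zero.2, pow_zero]
        rw [filter_eq_empty_iff]
        intro α hα
        rw [← hx, mem_para] at hα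
        exact hα.2.not_lt
      rw [this]; ring
    · rw [if_neg hx, mul_zero, add_zero, ← mul_assoc, hT]
      have h2 : ∀ w ∈ elts R, (1 - PowerSeries.X : PowerSeries ℝ) ^ n *
          orbSum (para R (w x)) PowerSeries.X (w y) * hilbSer (para R x) = 1 := by
        intro w hw
        have hw := hR.mem_elts.1 hw
        have h3 : hilbSer (para R x) = hilbSer (para R (w x)) := by
          ext m
          simp only [hilbSer, PowerSeries.coeff_mk, hR.hilb_para_map hw]
        rw [h3]
        refine ih _ ?_ (hR.parabolic (w x))
          (fun α hα => hR.regular_map hw hy α (para_subset _ hα)) rfl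
        rw [← hN]
        refine card_lt_card ((para_subset _).ssubset_of_ne fun h => hx ?_)
        have h4 : w⁻¹ ∈ coxGroup (para R (w x)) := by rw [h]; exact inv_mem hw
        have h5 := para_fix_self h4
        have h6 : w⁻¹ (w x) = x := by
          change (w⁻¹ * w) x = x
          rw [inv_mul_cancel]; rfl
        rw [h6] at h5
        rw [h5]; exact h
      have h3 := hR.card_mul_orbSum (PowerSeries.X (R := ℝ)) x hy
      calc orbSum R (PowerSeries.X : PowerSeries ℝ) x = ∑ w ∈ elts R, PowerSeries.X ^ neg R (w x) * 1 := by
            simp [orbSum]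
        _ = ∑ w ∈ elts R, PowerSeries.X ^ neg R (w x) * ((1 - PowerSeries.X : PowerSeries ℝ) ^ n *
            orbSum (para R (w x)) PowerSeries.X (w y) * hilbSer (para R x)) :=
          sum_congr rfl fun w hw => by rw [h2 w hw]
        _ = (1 - PowerSeries.X : PowerSeries ℝ) ^ n * hilbSer (para R x) * ∑ w ∈ elts R,
            PowerSeries.X ^ neg R (w x) * orbSum (para R (w x)) PowerSeries.X (w y) := by
          rw [mul_sum]
          exact sum_congr rfl fun w _ => by ring
        _ = _ := by rw [← h3]; ring
  have h2 := hR.eulerSum_orbSum (PowerSeries.X (R := ℝ))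
  have h3 : eulerSum R (orbSum R (PowerSeries.X (R := ℝ))) =
      T * ((-1 : PowerSeries ℝ) ^ n * ((elts R).card : PowerSeries ℝ) * (PowerSeries.X ^ R.card * hilbSer R)) +
      (((elts R).card : PowerSeries ℝ) * (1 - T * hilbSer R)) * faceSign _ R 0 := by
    rw [funext h1, ← hR.eulerSum_hilbSer, ← eulerSum_mul_left,
      ← eulerSum_subspace R (f := fun x => if para R x = R then (1 : PowerSeries ℝ) else 0),
      ← eulerSum_mul_left]
    · simp only [eulerSum, mul_add, sum_add_distrib]
    · intro x hx
      rw [if_pos]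
      exact filter_true_of_mem hx
    · intro x hx
      rw [if_neg]
      intro h
      exact hx fun α hα => by rw [← h, mem_para] at hα; exact hα.2
  rw [h2] at h3
  have h4 : ((elts R).card : PowerSeries ℝ) * ((1 - T * hilbSer R) *
      ((-1 : PowerSeries ℝ) ^ n * PowerSeries.X ^ R.card - faceSign _ R 0)) = 0 := by
    linear_combination h3
  have h5 : ((elts R).card : PowerSeries ℝ) ≠ 0 := by
    have : ((elts R).card : PowerSeries ℝ) = PowerSeries.C ((elts R).card : ℝ) := by simp
    rw [this, Ne, map_eq_zero_iff _ PowerSeries.C_injective]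
    exact_mod_cast hR.card_elts_pos.ne'
  have h6 : ((-1) ^ n * PowerSeries.X ^ R.card - faceSign (PowerSeries ℝ) R 0) ≠ 0 := by
    intro h
    have := congrArg PowerSeries.constantCoeff h
    simp [faceSign, hN, hpos.ne'] at this
  have h7 := (mul_eq_zero.1 ((mul_eq_zero.1 h4).resolve_left h5)).resolve_right h6
  exact (sub_eq_zero.1 h7).symm

end

/-! ### Solomon's product formula -/

section

variable {n : ℕ} {R : Finset (Fin n → ℝ)}

lemma coe_orbSum (y : Fin n → ℝ) :
    ((orbSum R (Polynomial.X : Polynomial ℝ) y : Polynomial ℝ) : PowerSeries ℝ) =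
      orbSum R (PowerSeries.X : PowerSeries ℝ) y := by
  rw [← Polynomial.coeToPowerSeries.ringHom_apply, orbSum, map_sum]
  simp [orbSum]

lemma _root_.CoxeterData.orbSum_X (C : CoxeterData n) {y : Fin n → ℝ} (hy : Regular C.R y) :
    orbSum C.R (Polynomial.X : Polynomial ℝ) y =
      ∏ j, ∑ i ∈ range (C.d j), (Polynomial.X : Polynomial ℝ) ^ i := by
  have h1 := C.rootSys.hilbSer_mul_orbSum hy
  have h2 := C.hilbSer_mul
  have h3 : (1 - PowerSeries.X : PowerSeries ℝ) ^ n * orbSum C.R (PowerSeries.X : PowerSeries ℝ) y =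
      ∏ j, (1 - PowerSeries.X ^ (C.d j)) := by
    calc _ = ((1 - PowerSeries.X : PowerSeries ℝ) ^ n *
          orbSum C.R (PowerSeries.X : PowerSeries ℝ) y) *
          (hilbSer C.R * ∏ j, (1 - PowerSeries.X ^ (C.d j))) := by rw [h2, mul_one]
      _ = _ := by rw [← mul_assoc, h1, one_mul]
  have h4 : (1 - Polynomial.X : Polynomial ℝ) ^ n * orbSum C.R (Polynomial.X : Polynomial ℝ) y =
      (1 - Polynomial.X : Polynomial ℝ) ^ n *
        ∏ j, ∑ i ∈ range (C.d j), (Polynomial.X : Polynomial ℝ) ^ i := by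
    have h5 : (1 - Polynomial.X : Polynomial ℝ) ^ n *
        ∏ j, ∑ i ∈ range (C.d j), (Polynomial.X : Polynomial ℝ) ^ i =
        ∏ j, (1 - Polynomial.X ^ (C.d j)) := by
      have : (1 - Polynomial.X : Polynomial ℝ) ^ n = ∏ _j : Fin n, (1 - Polynomial.X) := by simp
      rw [this, ← prod_mul_distrib]
      exact prod_congr rfl fun j _ => mul_neg_geom_sum _ _
    rw [h5]
    apply Polynomial.coe_injective
    rw [Polynomial.coe_mul, coe_orbSum, Polynomial.coe_pow]
    have h6 : ((1 - Polynomial.X : Polynomial ℝ) : PowerSeries ℝ) = 1 - PowerSeries.X := by simp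
    rw [h6, h3]
    rw [← Polynomial.coeToPowerSeries.ringHom_apply, map_prod]
    simp
  have h0 : (1 - Polynomial.X : Polynomial ℝ) ≠ 0 := by
    intro h
    have := congrArg (Polynomial.eval 0) h
    simp at this
  exact mul_left_cancel₀ (pow_ne_zero n h0) h4

/-- Solomon's formula for the distribution of the number of inversions. -/
lemma _root_.CoxeterData.orbSum_eq (C : CoxeterData n) {A : Type*} [CommRing A] [Algebra ℝ A]
    {y : Fin n → ℝ} (hy : Regular C.R y) (z : A) :
    orbSum C.R z y = ∏ j, ∑ i ∈ range (C.d j), z ^ i := by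
  have := congrArg (Polynomial.aeval z) (C.orbSum_X hy)
  simpa [orbSum] using this

lemma _root_.CoxeterData.exists_regular (C : CoxeterData n) : ∃ y, Regular C.R y := by
  obtain ⟨v, hv⟩ := C.pos
  exact ⟨v, fun α hα => (hv α hα).ne'⟩

lemma _root_.CoxeterData.card_elts_eq (C : CoxeterData n) : (elts C.R).card = ∏ j, C.d j := by
  obtain ⟨y, hy⟩ := C.exists_regular
  have := C.orbSum_eq hy (1 : ℝ)
  simp only [orbSum, one_pow, sum_const, card_range, nsmul_eq_mul, mul_one] at this
  exact_mod_cast this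

lemma _root_.CoxeterData.sum_d (C : CoxeterData n) : ∑ j, (C.d j - 1) = C.R.card := by
  obtain ⟨v, hv⟩ := C.pos
  have hy : Regular C.R (-v) := fun α hα => by
    rw [dotR_neg]; exact neg_ne_zero.2 (hv α hα).ne'
  have hg : ∀ d : ℕ, 0 < d → (∑ i ∈ range d, (Polynomial.X : Polynomial ℝ) ^ i).Monic ∧
      (∑ i ∈ range d, (Polynomial.X : Polynomial ℝ) ^ i).natDegree = d - 1 := fun d hd => by
    refine ⟨Polynomial.monic_geom_sum_X hd.ne', ?_⟩
    apply le_antisymm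
    · refine Polynomial.natDegree_sum_le_of_forall_le _ _ fun i hi => ?_
      rw [Polynomial.natDegree_X_pow]
      have := mem_range.1 hi
      omega
    · apply Polynomial.le_natDegree_of_ne_zero
      have : d - 1 < d := by omega
      simp [Polynomial.finsetSum_coeff, Polynomial.coeff_X_pow, this]
  have h1 : (∏ j, ∑ i ∈ range (C.d j), (Polynomial.X : Polynomial ℝ) ^ i).natDegree =
      ∑ j, (C.d j - 1) := by
    rw [Polynomial.natDegree_prod_of_monic _ _ fun j _ => (hg _ (C.d_pos j)).1]
    exact sum_congr rfl fun j _ => (hg _ (C.d_pos j)).2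
  rw [← h1, ← C.orbSum_X hy]
  apply le_antisymm
  · refine Polynomial.natDegree_sum_le_of_forall_le _ _ fun w _ => ?_
    rw [Polynomial.natDegree_X_pow]
    exact card_filter_le _ _
  · apply Polynomial.le_natDegree_of_ne_zero
    rw [orbSum, Polynomial.finsetSum_coeff]
    apply ne_of_gt
    refine sum_pos' (fun w _ => ?_) ⟨1, C.rootSys.mem_elts.2 (one_mem _), ?_⟩
    · rw [Polynomial.coeff_X_pow]; split_ifs <;> norm_num
    · rw [Polynomial.coeff_X_pow, if_pos]
      · exact one_pos
      · symm
        rw [neg, filter_true_of_mem]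
        intro α hα
        change dotR α (-v) < 0
        rw [dotR_neg]; linarith [hv α hα]

end

/-! ### Asymptotics of the Gamma function -/

section

/-- The logarithm of the quotient of the Gamma function by its Stirling approximation. -/
noncomputable def stirlingErr (x : ℝ) : ℝ :=
  Real.log (Real.Gamma (1 + x)) - ((x + 1 / 2) * Real.log (1 + x) - x)

lemma log_le_half_sub_inv {y : ℝ} (hy : 1 ≤ y) : Real.log y ≤ (y - y⁻¹) / 2 := by
  have h := Real.self_le_sinh_iff.2 (Real.log_nonneg hy)
  rwa [Real.sinh_eq, Real.exp_neg, Real.exp_log (by linarith)] at h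

lemma stirlingErr_add_one {x : ℝ} (hx : 0 ≤ x) :
    stirlingErr (x + 1) ≤ stirlingErr x ∧
      stirlingErr x - (1 / 4) * (1 / (1 + x) - 1 / (1 + (x + 1))) ≤ stirlingErr (x + 1) := by
  have hu : 0 < 1 + x := by linarith
  have hu' : 0 < 1 + (x + 1) := by linarith
  have hG : Real.log (Real.Gamma (1 + (x + 1))) =
      Real.log (1 + x) + Real.log (Real.Gamma (1 + x)) := by
    rw [← add_assoc, Real.Gamma_add_one hu.ne', Real.log_mul hu.ne' (Real.Gamma_pos_of_pos hu).ne']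
  set s := Real.log (1 + (x + 1)) - Real.log (1 + x) with hs
  have hs' : s = Real.log (1 + 1 / (1 + x)) := by
    rw [hs, ← Real.log_div hu'.ne' hu.ne']
    congr 1
    field_simp
    ring
  have hD : stirlingErr (x + 1) = stirlingErr x - ((x + 3 / 2) * s - 1) := by
    unfold stirlingErr
    rw [hG, hs]; ring
  have h1 : 2 / (2 * x + 3) ≤ s := by
    rw [hs']
    refine le_trans (le_of_eq ?_) (Real.le_log_one_add_of_nonneg (by positivity))
    field_simp
    ring
  have h2 : s ≤ (2 * x + 3) / (2 * ((1 + x) * (2 + x))) := by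
    rw [hs']
    refine (log_le_half_sub_inv (by linarith [one_div_pos.2 hu])).trans (le_of_eq ?_)
    have : (1 + 1 / (1 + x)) = (2 + x) / (1 + x) := by field_simp; ring
    rw [this, inv_div]
    have : 2 + x ≠ 0 := by linarith
    field_simp
    ring
  rw [hD]
  constructor
  · rw [div_le_iff₀ (by linarith)] at h1
    linarith
  · rw [le_div_iff₀ (by positivity)] at h2
    have h3 : (1 / 4 : ℝ) * (1 / (1 + x) - 1 / (1 + (x + 1))) =
        1 / (4 * ((1 + x) * (2 + x))) := by
      have : 1 + (x + 1) ≠ 0 := hu'.ne'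
      have : 2 + x ≠ 0 := by linarith
      field_simp
      ring
    rw [h3]
    have h4 : (x + 3 / 2) * s - 1 ≤ 1 / (4 * ((1 + x) * (2 + x))) := by
      rw [le_div_iff₀ (by positivity)]
      nlinarith
    linarith

lemma exists_stirlingErr_bound : ∃ C, ∀ x, 0 ≤ x → |stirlingErr x| ≤ C := by
  have hc : ContinuousOn stirlingErr (Set.Icc 0 1) := by
    intro x hx
    have hu : 0 < 1 + x := by linarith [hx.1]
    have h1 : ContinuousAt (fun x : ℝ => Real.Gamma (1 + x)) x := by
      refine ContinuousAt.comp (g := Real.Gamma) ?_ (by fun_prop)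
      refine (Real.differentiableAt_Gamma fun m => ?_).continuousAt
      have : (0 : ℝ) ≤ m := m.cast_nonneg
      linarith
    refine ContinuousAt.continuousWithinAt ?_
    unfold stirlingErr
    refine (h1.log (Real.Gamma_pos_of_pos hu).ne').sub (.sub (.mul (by fun_prop) ?_) (by fun_prop))
    exact ContinuousAt.log (by fun_prop) hu.ne'
  obtain ⟨C, hC⟩ := isCompact_Icc.exists_bound_of_continuousOn hc
  have key : ∀ t : ℝ, 0 ≤ t → ∀ m : ℕ, stirlingErr (t + m) ≤ stirlingErr t ∧
      stirlingErr t - (1 / 4) * (1 / (1 + t) - 1 / (1 + (t + m))) ≤ stirlingErr (t + m) := by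
    intro t ht m
    induction m with
    | zero => simp
    | succ m ih =>
      have := stirlingErr_add_one (x := t + m) (by positivity)
      push_cast
      rw [← add_assoc]
      constructor <;> linarith [ih.1, ih.2, this.1, this.2]
  refine ⟨C + 1 / 4, fun x hx => ?_⟩
  have h1 := key (Int.fract x) (Int.fract_nonneg x) ⌊x⌋₊
  have h2 : Int.fract x + (⌊x⌋₊ : ℝ) = x := by
    rw [natCast_floor_eq_intCast_floor hx]; exact Int.fract_add_floor x
  rw [h2] at h1
  have h3 := hC (Int.fract x) ⟨Int.fract_nonneg x, (Int.fract_lt_one x).le⟩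
  rw [Real.norm_eq_abs, abs_le] at h3
  have h4 : 1 / (1 + Int.fract x) ≤ 1 := by
    rw [div_le_one (by linarith [Int.fract_nonneg x])]; linarith [Int.fract_nonneg x]
  have h5 : 0 ≤ 1 / (1 + x) := by positivity
  rw [abs_le]
  constructor <;> linarith [h1.1, h1.2]

/-- The asymptotics of `Γ(1+dx)/Γ(1+x)` up to a bounded factor. -/
lemma exists_log_ratio_bound (d : ℕ) (hd : 0 < d) : ∃ C, ∀ x : ℝ, 0 ≤ x →
    |Real.log (Real.Gamma (1 + x * d) / Real.Gamma (1 + x)) -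
      ((d - 1) * x * Real.log (1 + x) + x * (d * Real.log d - d + 1))| ≤ C := by
  obtain ⟨C, hC⟩ := exists_stirlingErr_bound
  have hd1 : (1 : ℝ) ≤ d := by exact_mod_cast hd
  have hd0 : (0 : ℝ) < d := by linarith
  refine ⟨2 * C + d + |Real.log d|, fun x hx => ?_⟩
  have hxd : 0 ≤ x * d := by positivity
  have h1 := abs_le.1 (hC x hx)
  have h2 := abs_le.1 (hC (x * d) hxd)
  unfold stirlingErr at h1 h2
  have p1 := Real.Gamma_pos_of_pos (s := 1 + x) (by linarith)
  have p2 := Real.Gamma_pos_of_pos (s := 1 + x * d) (by linarith)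
  rw [Real.log_div p2.ne' p1.ne']
  set r := Real.log (1 + x) + Real.log d - Real.log (1 + x * d) with hr
  have hx1 : 0 < 1 + x := by linarith
  have hxd1 : 0 < 1 + x * d := by linarith
  have hr' : r = Real.log ((1 + x) * d / (1 + x * d)) := by
    rw [Real.log_div (by positivity) hxd1.ne', Real.log_mul hx1.ne' hd0.ne']
  have hr0 : 0 ≤ r := by
    rw [hr']
    apply Real.log_nonneg
    rw [le_div_iff₀ hxd1]
    nlinarith
  have hr1 : (1 + x * d) * r ≤ d := by
    have : r ≤ (1 + x) * d / (1 + x * d) - 1 := by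
      rw [hr']; exact Real.log_le_sub_one_of_pos (by positivity)
    calc (1 + x * d) * r ≤ (1 + x * d) * ((1 + x) * d / (1 + x * d) - 1) := by gcongr
      _ = d - 1 := by field_simp; ring
      _ ≤ d := by linarith
  have hr2 : 0 ≤ (x * d + 1 / 2) * r := by positivity
  have hr3 : (x * d + 1 / 2) * r ≤ d := by nlinarith
  have hlog := abs_le.1 (le_refl |Real.log d|)
  have e : Real.log (1 + x * d) = Real.log (1 + x) + Real.log d - r := by rw [hr]; ring
  rw [e] at h2
  rw [abs_le]
  constructor <;> nlinarith

lemma norm_betaIntegral_le {u v : ℂ} (hu : 0 < u.re) (hv : 0 < v.re) :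
    ‖Complex.betaIntegral u v‖ ≤ ‖Complex.betaIntegral u.re v.re‖ := by
  have h1 : Complex.betaIntegral u.re v.re =
      ((∫ x : ℝ in 0..1, x ^ (u.re - 1) * (1 - x) ^ (v.re - 1) : ℝ) : ℂ) := by
    rw [Complex.betaIntegral, ← intervalIntegral.integral_ofReal]
    refine intervalIntegral.integral_congr fun x hx => ?_
    rw [Set.uIcc_of_le zero_le_one] at hx
    push_cast
    rw [Complex.ofReal_cpow hx.1, Complex.ofReal_cpow (by linarith [hx.2])]
    push_cast
    rfl
  have hint : IntervalIntegrable (fun x : ℝ => x ^ (u.re - 1) * (1 - x) ^ (v.re - 1))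
      volume 0 1 := by
    have := (Complex.betaIntegral_convergent hu hv).norm
    rw [intervalIntegrable_iff_integrableOn_Ioo_of_le zero_le_one] at this ⊢
    refine this.congr_fun (fun x hx => ?_) measurableSet_Ioo
    have h1x : 0 < 1 - x := by linarith [hx.2]
    dsimp only
    rw [norm_mul, Complex.norm_cpow_eq_rpow_re_of_pos hx.1, ← Complex.ofReal_one,
      ← Complex.ofReal_sub, Complex.norm_cpow_eq_rpow_re_of_pos h1x]
    simp
  have h2 : ‖Complex.betaIntegral u v‖ ≤
      ∫ x : ℝ in 0..1, x ^ (u.re - 1) * (1 - x) ^ (v.re - 1) := by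
    refine intervalIntegral.norm_integral_le_of_norm_le zero_le_one ?_ hint
    have hne : ∀ᵐ x : ℝ, x ≠ 1 := by simp [ae_iff]
    filter_upwards [hne] with x hx1 hx
    have h1x : 0 < 1 - x := by
      have := lt_of_le_of_ne hx.2 hx1
      linarith
    rw [norm_mul, Complex.norm_cpow_eq_rpow_re_of_pos hx.1, ← Complex.ofReal_one,
      ← Complex.ofReal_sub, Complex.norm_cpow_eq_rpow_re_of_pos h1x]
    simp
  rw [h1, Complex.norm_real]
  exact h2.trans (le_abs_self _)

lemma exp_le_norm_Gamma_half (y : ℝ) :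
    Real.Gamma (1 / 2) * Real.exp (-(Real.pi * |y| / 2)) ≤ ‖Complex.Gamma (1 / 2 + y * I)‖ := by
  have h1 := Complex.Gamma_mul_Gamma_one_sub (1 / 2 + y * I)
  have h2 : (1 : ℂ) - (1 / 2 + y * I) = (starRingEnd ℂ) (1 / 2 + y * I) := by
    have : (starRingEnd ℂ) (1 / 2 : ℂ) = 1 / 2 := by
      rw [map_div₀, map_one, map_ofNat]
    rw [map_add, this, map_mul, Complex.conj_ofReal, Complex.conj_I]; ring
  rw [h2, Complex.Gamma_conj] at h1
  have h3 := congrArg norm h1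
  have h4 : Complex.sin (Real.pi * (1 / 2 + y * I)) = ((Real.cosh (Real.pi * y) : ℝ) : ℂ) := by
    have : (Real.pi * (1 / 2 + y * I) : ℂ) = (Real.pi * y : ℂ) * I + Real.pi / 2 := by ring
    rw [this, Complex.sin_add_pi_div_two, Complex.cos_mul_I]
    push_cast; rfl
  rw [norm_mul, RCLike.norm_conj, norm_div, h4, Complex.norm_real, Complex.norm_real,
    Real.norm_eq_abs, Real.norm_eq_abs, abs_of_pos Real.pi_pos, abs_of_pos (Real.cosh_pos _)] at h3
  have h5 : Real.cosh (Real.pi * y) ≤ Real.exp (Real.pi * |y|) := by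
    rw [← Real.cosh_abs, abs_mul, abs_of_pos Real.pi_pos]
    have h0 : 0 ≤ Real.pi * |y| := by positivity
    rw [Real.cosh_eq]
    have := Real.exp_le_exp.2 (show -(Real.pi * |y|) ≤ Real.pi * |y| by linarith)
    linarith
  have h6 : (Real.Gamma (1 / 2) * Real.exp (-(Real.pi * |y| / 2))) ^ 2 ≤
      ‖Complex.Gamma (1 / 2 + y * I)‖ ^ 2 := by
    rw [sq ‖_‖, h3, mul_pow, Real.Gamma_one_half_eq, Real.sq_sqrt Real.pi_pos.le, ← Real.exp_nat_mul,
      div_eq_mul_inv Real.pi]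
    refine mul_le_mul_of_nonneg_left ?_ Real.pi_pos.le
    have : ((2 : ℕ) : ℝ) * -(Real.pi * |y| / 2) = -(Real.pi * |y|) := by push_cast; ring
    rw [this, Real.exp_neg]
    exact inv_anti₀ (Real.cosh_pos _) h5
  exact le_of_sq_le_sq h6 (norm_nonneg _)

lemma exp_mul_Gamma_le_norm_Gamma {x : ℝ} (hx : 0 ≤ x) (y : ℝ) :
    Real.Gamma (1 + x) * Real.exp (-(Real.pi * |y| / 2)) ≤ ‖Complex.Gamma (1 + x + y * I)‖ := by
  set u : ℝ := x + 1 / 2 with hu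
  have hu0 : 0 < u := by linarith
  have hre : ((1 : ℂ) / 2 + y * I).re = 1 / 2 := by simp
  have h1 := Complex.Gamma_mul_Gamma_eq_betaIntegral (s := (u : ℂ)) (t := 1 / 2 + y * I)
    (by simpa using hu0) (by rw [hre]; norm_num)
  have h2 := Complex.Gamma_mul_Gamma_eq_betaIntegral (s := (u : ℂ)) (t := ((1 / 2 : ℝ) : ℂ))
    (by simpa using hu0) (by rw [Complex.ofReal_re]; norm_num)
  have h3 := norm_betaIntegral_le (u := (u : ℂ)) (v := 1 / 2 + y * I)
    (by simpa using hu0) (by rw [hre]; norm_num)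
  rw [hre, Complex.ofReal_re] at h3
  have e1 : (u : ℂ) + (1 / 2 + y * I) = 1 + x + y * I := by rw [hu]; push_cast; ring
  have e2 : u + 1 / 2 = 1 + x := by rw [hu]; ring
  rw [e1] at h1
  rw [← Complex.ofReal_add, e2] at h2
  have n1 := congrArg norm h1
  have n2 := congrArg norm h2
  simp only [norm_mul, Complex.Gamma_ofReal, Complex.norm_real, Real.norm_eq_abs] at n1 n2
  have p1 := Real.Gamma_pos_of_pos hu0
  have p2 := Real.Gamma_pos_of_pos (s := 1 / 2) (by norm_num)
  have p3 := Real.Gamma_pos_of_pos (s := 1 + x) (by linarith)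
  rw [abs_of_pos p1] at n1
  rw [abs_of_pos p1, abs_of_pos p2, abs_of_pos p3] at n2
  have h4 := exp_le_norm_Gamma_half y
  set B := ‖Complex.betaIntegral u ((1 / 2 : ℝ) : ℂ)‖
  set g := ‖Complex.Gamma (1 + x + y * I)‖
  have hB : 0 < B := by
    by_contra! h
    have : 0 < Real.Gamma u * Real.Gamma (1 / 2) := by positivity
    nlinarith
  have h5 : Real.Gamma (1 + x) * Real.exp (-(Real.pi * |y| / 2)) * B ≤ g * B := by
    calc _ = Real.exp (-(Real.pi * |y| / 2)) * (Real.Gamma (1 + x) * B) := by ring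
      _ = Real.Gamma u * (Real.Gamma (1 / 2) * Real.exp (-(Real.pi * |y| / 2))) := by
        rw [← n2]; ring
      _ ≤ Real.Gamma u * ‖Complex.Gamma (1 / 2 + y * I)‖ := by gcongr
      _ = g * ‖Complex.betaIntegral u (1 / 2 + y * I)‖ := n1
      _ ≤ g * B := by
        gcongr
  exact le_of_mul_le_mul_right h5 hB

lemma norm_Gamma_le {s : ℂ} (hs : 0 < s.re) : ‖Complex.Gamma s‖ ≤ Real.Gamma s.re := by
  rw [Complex.Gamma_eq_integral hs, Real.Gamma_eq_integral hs, Complex.GammaIntegral]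
  refine norm_integral_le_of_norm_le (Real.GammaIntegral_convergent hs) ?_
  refine (ae_restrict_iff' measurableSet_Ioi).2 (.of_forall fun x hx => ?_)
  rw [norm_mul, Complex.norm_real, Complex.norm_cpow_eq_rpow_re_of_pos hx]
  simp

end

/-! ### The product of Gamma functions -/

section

variable {n : ℕ}

/-- The product of Gamma functions. -/
noncomputable def gammaProd (C : CoxeterData n) (k : ℂ) : ℂ :=
  ∏ j, Complex.Gamma (1 + k * (C.d j)) / Complex.Gamma (1 + k)

/-- The product of Gamma functions at a real point. -/
noncomputable def gammaProdReal (C : CoxeterData n) (x : ℝ) : ℝ :=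
  ∏ j, Real.Gamma (1 + x * (C.d j)) / Real.Gamma (1 + x)

/-- The Poincaré polynomial at `exp (2πik)`, symmetrised and normalised. -/
noncomputable def poinc (C : CoxeterData n) (k : ℂ) : ℂ :=
  ∏ j, (Complex.exp (-(Real.pi * k * I * (C.d j - 1))) *
    ∑ i ∈ range (C.d j), Complex.exp (2 * Real.pi * k * I) ^ i) / (C.d j)

lemma gammaProd_ofReal (C : CoxeterData n) (x : ℝ) :
    gammaProd C x = gammaProdReal C x := by
  simp only [gammaProd, gammaProdReal]
  push_cast
  refine prod_congr rfl fun j _ => ?_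
  rw [← Complex.Gamma_ofReal, ← Complex.Gamma_ofReal]
  push_cast
  rfl

lemma gammaProdReal_pos (C : CoxeterData n) {x : ℝ} (hx : 0 ≤ x) : 0 < gammaProdReal C x :=
  prod_pos fun j _ => div_pos (Real.Gamma_pos_of_pos (by positivity))
    (Real.Gamma_pos_of_pos (by positivity))

lemma sum_d_cast (C : CoxeterData n) : ∑ j, ((C.d j : ℝ) - 1) = C.R.card := by
  rw [← C.sum_d]
  push_cast
  exact sum_congr rfl fun j _ => by rw [Nat.cast_sub (C.d_pos j), Nat.cast_one]

lemma Gamma_mul_sin (z : ℂ) (hz : z ≠ 0) :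
    Complex.Gamma (1 + z) * Complex.Gamma (1 - z) * Complex.sin (Real.pi * z) = Real.pi * z ∨
      Complex.sin (Real.pi * z) = 0 := by
  by_cases hs : Complex.sin (Real.pi * z) = 0
  · exact .inr hs
  · left
    rw [add_comm, Complex.Gamma_add_one z hz, mul_assoc z, Complex.Gamma_mul_Gamma_one_sub, mul_assoc,
      div_mul_cancel₀ _ hs, mul_comm]

lemma sin_mul_eq (k : ℂ) (d : ℕ) : Complex.sin (Real.pi * (k * d)) =
    Complex.sin (Real.pi * k) * (Complex.exp (-(Real.pi * k * I * (d - 1))) *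
      ∑ i ∈ range d, Complex.exp (2 * Real.pi * k * I) ^ i) := by
  have h := mul_neg_geom_sum (Complex.exp (2 * Real.pi * k * I)) d
  have key : ∀ z : ℂ, Complex.sin z = Complex.exp (-z * I) * (1 - Complex.exp (2 * z * I)) * I / 2 := by
    intro z
    rw [Complex.sin, mul_sub, ← Complex.exp_add, mul_one]
    ring_nf
  have e1 : Complex.exp (2 * (Real.pi * (k * d)) * I) = Complex.exp (2 * Real.pi * k * I) ^ d := by
    rw [← Complex.exp_nat_mul]
    ring_nf
  have e2 : Complex.exp (-(Real.pi * (k * d)) * I) = Complex.exp (-(Real.pi * k) * I) *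
      Complex.exp (-(Real.pi * k * I * (d - 1))) := by
    rw [← Complex.exp_add]
    ring_nf
  rw [key, key, e1, ← h, e2]
  ring_nf

lemma gamma_re_pos {C : CoxeterData n} {k : ℂ} (hk : ∀ j, |k.re| * C.d j < 1) (j : Fin n) :
    0 < (1 + k * C.d j).re ∧ 0 < (1 - k * C.d j).re ∧ 0 < (1 + k).re ∧ 0 < (1 - k).re := by
  have h1 : (1 : ℝ) ≤ C.d j := by exact_mod_cast C.d_pos j
  have h2 := hk j
  have h3 : |k.re| < 1 := by nlinarith [abs_nonneg k.re]
  have h4 := abs_le.1 (le_refl |k.re|)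
  simp only [add_re, sub_re, one_re, mul_re, natCast_re, natCast_im, mul_zero, sub_zero]
  refine ⟨?_, ?_, ?_, ?_⟩ <;> nlinarith

lemma gammaProd_reflection (C : CoxeterData n) {k : ℂ} (hk : ∀ j, |k.re| * C.d j < 1) :
    poinc C k * (gammaProd C k * gammaProd C (-k)) = 1 := by
  unfold poinc gammaProd
  rw [← prod_mul_distrib, ← prod_mul_distrib]
  refine prod_eq_one fun j _ => ?_
  obtain ⟨h1, h2, h3, h4⟩ := gamma_re_pos hk j
  have hd : (C.d j : ℂ) ≠ 0 := by exact_mod_cast (C.d_pos j).ne'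
  rcases eq_or_ne k 0 with rfl | hk0
  · simp [hd]
  have n1 := Complex.Gamma_ne_zero_of_re_pos h1
  have n2 := Complex.Gamma_ne_zero_of_re_pos h2
  have n3 := Complex.Gamma_ne_zero_of_re_pos h3
  have n4 := Complex.Gamma_ne_zero_of_re_pos h4
  have key : ∀ z : ℂ, z ≠ 0 → Complex.Gamma (1 + z) ≠ 0 → Complex.Gamma (1 - z) ≠ 0 →
      Complex.Gamma (1 + z) * Complex.Gamma (1 - z) * Complex.sin (Real.pi * z) = Real.pi * z := by
    intro z hz hz1 hz2
    have := Complex.Gamma_mul_Gamma_one_sub z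
    have h5 : Complex.Gamma z ≠ 0 := by
      rw [add_comm, Complex.Gamma_add_one z hz] at hz1
      exact right_ne_zero_of_mul hz1
    rcases Gamma_mul_sin z hz with h | h
    · exact h
    · rw [h, div_zero] at this
      exact absurd this (mul_ne_zero h5 hz2)
  have a1 := key k hk0 n3 n4
  have a2 := key (k * C.d j) (mul_ne_zero hk0 hd) n1 n2
  rw [sin_mul_eq] at a2
  set S := Complex.exp (-(Real.pi * k * I * (C.d j - 1))) *
    ∑ i ∈ range (C.d j), Complex.exp (2 * Real.pi * k * I) ^ i
  have hs : Complex.sin (Real.pi * k) ≠ 0 := by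
    intro h
    rw [h, mul_zero] at a1
    exact mul_ne_zero (by exact_mod_cast Real.pi_ne_zero) hk0 a1.symm
  have a3 : Complex.Gamma (1 + k * C.d j) * Complex.Gamma (1 - k * C.d j) * S =
      C.d j * (Complex.Gamma (1 + k) * Complex.Gamma (1 - k)) := by
    apply mul_right_cancel₀ hs
    linear_combination a2 - C.d j * a1
  rw [neg_mul, ← sub_eq_add_neg, ← sub_eq_add_neg]
  generalize Complex.Gamma (1 + k * C.d j) = g1 at *
  generalize Complex.Gamma (1 - k * C.d j) = g2 at *
  generalize Complex.Gamma (1 + k) = g3 at *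
  generalize Complex.Gamma (1 - k) = g4 at *
  generalize S = T at *
  field_simp
  linear_combination a3

lemma poinc_eq (C : CoxeterData n) {y : Fin n → ℝ} (hy : Regular C.R y) (k : ℂ) :
    poinc C k = Complex.exp (-(Real.pi * k * I * C.R.card)) *
      orbSum C.R (Complex.exp (2 * Real.pi * k * I)) y / (elts C.R).card := by
  rw [poinc, C.orbSum_eq hy, prod_div_distrib, prod_mul_distrib, C.card_elts_eq]
  push_cast
  rw [← Complex.exp_sum]
  congr 3
  have := sum_d_cast C
  have h2 : ((C.R.card : ℝ) : ℂ) = ((∑ j, ((C.d j : ℝ) - 1) : ℝ) : ℂ) := by rw [this]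
  push_cast at h2
  rw [h2, mul_sum, sum_neg_distrib]

lemma norm_poinc_le (C : CoxeterData n) (y : ℝ) :
    ‖poinc C (y * I)‖ ≤ Real.exp (Real.pi * C.R.card * |y|) := by
  obtain ⟨v, hv⟩ := C.exists_regular
  have hW : (0 : ℝ) < (elts C.R).card := by exact_mod_cast C.rootSys.card_elts_pos
  rw [poinc_eq C hv, orbSum, mul_sum, norm_div, Complex.norm_natCast, div_le_iff₀ hW]
  refine (norm_sum_le _ _).trans ?_
  have : ∀ w ∈ elts C.R, ‖Complex.exp (-(Real.pi * (y * I) * I * C.R.card)) *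
      Complex.exp (2 * Real.pi * (y * I) * I) ^ neg C.R (w v)‖ ≤
        Real.exp (Real.pi * C.R.card * |y|) := by
    intro w _
    have hneg : ((neg C.R (w v) : ℕ) : ℝ) ≤ C.R.card := by exact_mod_cast card_filter_le _ _
    rw [← Complex.exp_nat_mul, ← Complex.exp_add, Complex.norm_exp]
    apply Real.exp_le_exp.2
    have e : (-(Real.pi * (y * I) * I * C.R.card) + (neg C.R (w v) : ℕ) *
        (2 * Real.pi * (y * I) * I) : ℂ) =
        ((Real.pi * (y * (C.R.card - 2 * (neg C.R (w v) : ℕ))) : ℝ) : ℂ) := by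
      push_cast
      linear_combination (-(Real.pi * y * C.R.card) + 2 * (neg C.R (w v) : ℕ) * Real.pi * y : ℂ) *
        Complex.I_mul_I
    rw [e, Complex.ofReal_re, mul_assoc]
    refine mul_le_mul_of_nonneg_left ?_ Real.pi_pos.le
    have h0 : (0 : ℝ) ≤ (neg C.R (w v) : ℕ) := Nat.cast_nonneg _
    calc y * (C.R.card - 2 * (neg C.R (w v) : ℕ)) ≤
        |y * (C.R.card - 2 * (neg C.R (w v) : ℕ))| := le_abs_self _
      _ = |(C.R.card : ℝ) - 2 * (neg C.R (w v) : ℕ)| * |y| := by rw [abs_mul, mul_comm]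
      _ ≤ C.R.card * |y| :=
        mul_le_mul_of_nonneg_right (abs_le.2 ⟨by linarith, by linarith⟩) (abs_nonneg y)
  refine (sum_le_sum this).trans ?_
  rw [sum_const, nsmul_eq_mul, mul_comm]

lemma norm_inv_gammaProd_le (C : CoxeterData n) (y : ℝ) :
    ‖(gammaProd C (y * I))⁻¹‖ ≤ Real.exp (Real.pi * C.R.card * |y| / 2) := by
  have h := gammaProd_reflection C (k := y * I) fun j => by simp
  have hconj : gammaProd C (-(y * I)) = (starRingEnd ℂ) (gammaProd C (y * I)) := by
    simp only [gammaProd, map_prod, map_div₀, ← Complex.Gamma_conj]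
    simp
  have h1 := congrArg norm h
  rw [norm_mul, norm_mul, hconj, RCLike.norm_conj, norm_one] at h1
  have h2 := norm_poinc_le C y
  have h3 : ‖gammaProd C (y * I)‖ ≠ 0 := by
    intro h0
    simp [h0] at h1
  have h4 : ‖poinc C (y * I)‖ = ‖(gammaProd C (y * I))⁻¹‖ ^ 2 := by
    rw [norm_inv]
    field_simp
    linarith
  rw [h4] at h2
  refine le_of_sq_le_sq (h2.trans (le_of_eq ?_)) (Real.exp_pos _).le
  rw [← Real.exp_nat_mul]
  congr 1
  push_cast; ring

lemma gammaProd_ne_zero (C : CoxeterData n) {k : ℂ} (hk : ∀ j, 0 < (1 + k * C.d j).re)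
    (hk1 : 0 < (1 + k).re) : gammaProd C k ≠ 0 :=
  prod_ne_zero_iff.2 fun j _ => div_ne_zero (Complex.Gamma_ne_zero_of_re_pos (hk j))
    (Complex.Gamma_ne_zero_of_re_pos hk1)

lemma differentiableAt_gammaProd (C : CoxeterData n) {k : ℂ} (hk : ∀ j, 0 < (1 + k * C.d j).re)
    (hk1 : 0 < (1 + k).re) : DifferentiableAt ℂ (gammaProd C) k := by
  have key : ∀ s : ℂ, 0 < s.re → DifferentiableAt ℂ Complex.Gamma s := fun s hs => by
    refine Complex.differentiableAt_Gamma _ fun m h => ?_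
    rw [h, neg_re, natCast_re] at hs
    have : (0 : ℝ) ≤ m := m.cast_nonneg
    linarith
  unfold gammaProd
  refine DifferentiableAt.fun_finsetProd fun j _ => ?_
  refine DifferentiableAt.div ?_ ?_ (Complex.Gamma_ne_zero_of_re_pos hk1)
  · exact DifferentiableAt.comp (g := Complex.Gamma) k (key _ (hk j)) (by fun_prop)
  · exact DifferentiableAt.comp (g := Complex.Gamma) k (key _ hk1) (by fun_prop)

/-- The exponential type of the Gamma product. -/
noncomputable def gammaType (C : CoxeterData n) : ℝ := ∑ j, Real.pi * (C.d j + 1) / 2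

lemma norm_Gamma_bounds {x : ℝ} (hx : 0 ≤ x) (y : ℝ) :
    Real.Gamma (1 + x) * Real.exp (-(Real.pi * |y| / 2)) ≤ ‖Complex.Gamma (1 + (x + y * I))‖ ∧
      ‖Complex.Gamma (1 + (x + y * I))‖ ≤ Real.Gamma (1 + x) := by
  rw [← add_assoc]
  refine ⟨exp_mul_Gamma_le_norm_Gamma hx y, ?_⟩
  have : (1 + x + y * I : ℂ).re = 1 + x := by simp
  have h := norm_Gamma_le (s := 1 + x + y * I) (by rw [this]; linarith)
  rwa [this] at h

lemma norm_gammaProd_bounds (C : CoxeterData n) {x : ℝ} (hx : 0 ≤ x) (y : ℝ) :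
    ‖gammaProd C (x + y * I)‖ ≤ gammaProdReal C x * Real.exp (gammaType C * |y|) ∧
      gammaProdReal C x ≤ ‖gammaProd C (x + y * I)‖ * Real.exp (gammaType C * |y|) := by
  unfold gammaProd gammaProdReal gammaType
  rw [norm_prod, sum_mul, Real.exp_sum, ← prod_mul_distrib, ← prod_mul_distrib]
  have e : ∀ j, (x + y * I) * (C.d j : ℂ) = ((x * C.d j : ℝ) : ℂ) + ((y * C.d j : ℝ) : ℂ) * I := by
    intro j; push_cast; ring
  have key : ∀ j, ‖Complex.Gamma (1 + (x + y * I) * C.d j) / Complex.Gamma (1 + (x + y * I))‖ ≤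
      Real.Gamma (1 + x * C.d j) / Real.Gamma (1 + x) *
        Real.exp (Real.pi * (C.d j + 1) / 2 * |y|) ∧
      Real.Gamma (1 + x * C.d j) / Real.Gamma (1 + x) ≤
      ‖Complex.Gamma (1 + (x + y * I) * C.d j) / Complex.Gamma (1 + (x + y * I))‖ *
        Real.exp (Real.pi * (C.d j + 1) / 2 * |y|) := by
    intro j
    have hxd : 0 ≤ x * C.d j := by positivity
    obtain ⟨a1, a2⟩ := norm_Gamma_bounds hx y
    obtain ⟨b1, b2⟩ := norm_Gamma_bounds hxd (y * C.d j)
    rw [e j, norm_div]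
    have p1 := Real.Gamma_pos_of_pos (s := 1 + x) (by linarith)
    have p2 := Real.Gamma_pos_of_pos (s := 1 + x * C.d j) (by linarith)
    rw [abs_mul, Nat.abs_cast] at b1
    set g1 := ‖Complex.Gamma (1 + (x + y * I))‖
    set g2 := ‖Complex.Gamma (1 + (((x * C.d j : ℝ) : ℂ) + ((y * C.d j : ℝ) : ℂ) * I))‖
    have q1 : 0 < g1 := lt_of_lt_of_le (by positivity) a1
    have hexp : Real.exp (Real.pi * (C.d j + 1) / 2 * |y|) =
        Real.exp (Real.pi * |y| / 2) * Real.exp (Real.pi * (|y| * C.d j) / 2) := by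
      rw [← Real.exp_add]; ring_nf
    have one1 : 1 ≤ Real.exp (Real.pi * |y| / 2) := Real.one_le_exp (by positivity)
    have one2 : 1 ≤ Real.exp (Real.pi * (|y| * C.d j) / 2) := Real.one_le_exp (by positivity)
    rw [Real.exp_neg, ← div_eq_mul_inv, div_le_iff₀ (Real.exp_pos _)] at a1 b1
    rw [hexp]
    constructor
    · rw [div_mul_eq_mul_div, div_le_div_iff₀ q1 p1]
      calc g2 * Real.Gamma (1 + x) ≤ Real.Gamma (1 + x * C.d j) *
            (g1 * Real.exp (Real.pi * |y| / 2)) := by gcongr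
        _ ≤ Real.Gamma (1 + x * C.d j) * (g1 * Real.exp (Real.pi * |y| / 2)) *
            Real.exp (Real.pi * (|y| * C.d j) / 2) := le_mul_of_one_le_right (by positivity) one2
        _ = _ := by ring
    · rw [div_mul_eq_mul_div, div_le_div_iff₀ p1 q1]
      calc Real.Gamma (1 + x * C.d j) * g1 ≤
            (g2 * Real.exp (Real.pi * (|y| * C.d j) / 2)) * Real.Gamma (1 + x) := by gcongr
        _ ≤ (g2 * Real.exp (Real.pi * (|y| * C.d j) / 2)) * Real.Gamma (1 + x) *
            Real.exp (Real.pi * |y| / 2) := le_mul_of_one_le_right (by positivity) one1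
        _ = _ := by ring
  constructor
  · exact prod_le_prod (fun j _ => norm_nonneg _) fun j _ => (key j).1
  · refine prod_le_prod (fun j _ => ?_) fun j _ => (key j).2
    exact div_nonneg (Real.Gamma_pos_of_pos (by positivity)).le
      (Real.Gamma_pos_of_pos (by positivity)).le

lemma exists_log_gammaProd_bound (C : CoxeterData n) : ∃ b B : ℝ, ∀ x : ℝ, 0 ≤ x →
    |Real.log (gammaProdReal C x) - (C.R.card * x * Real.log (1 + x) + x * b)| ≤ B := by
  choose B hB using fun j => exists_log_ratio_bound (C.d j) (C.d_pos j)
  refine ⟨∑ j, ((C.d j : ℝ) * Real.log (C.d j) - C.d j + 1), ∑ j, B j, fun x hx => ?_⟩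
  have e : C.R.card * x * Real.log (1 + x) + x * ∑ j, ((C.d j : ℝ) * Real.log (C.d j) - C.d j + 1) =
      ∑ j, (((C.d j : ℝ) - 1) * x * Real.log (1 + x) +
        x * (C.d j * Real.log (C.d j) - C.d j + 1)) := by
    rw [← sum_d_cast, mul_sum, sum_mul, sum_mul, ← sum_add_distrib]
  rw [e, gammaProdReal, Real.log_prod fun j _ => ?_, ← sum_sub_distrib]
  · exact (abs_sum_le_sum_abs _ _).trans (sum_le_sum fun j _ => hB j x hx)
  · exact (div_pos (Real.Gamma_pos_of_pos (by positivity))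
      (Real.Gamma_pos_of_pos (by positivity))).ne'

end

/-! ### Analytic tools -/

section

variable {n : ℕ}

/-- An integral depending holomorphically on a parameter, under local domination. -/
lemma differentiableAt_integral {X : Type*} [MeasurableSpace X] {μ : Measure X} {f : ℂ → X → ℂ}
    {z₀ : ℂ} {r : ℝ} (hr : 0 < r) {bound : X → ℝ}
    (hmeas : ∀ z ∈ Metric.ball z₀ r, AEStronglyMeasurable (f z) μ)
    (hdiff : ∀ᵐ x ∂μ, DifferentiableOn ℂ (fun z => f z x) (Metric.ball z₀ r))
    (hbound : ∀ᵐ x ∂μ, ∀ z ∈ Metric.ball z₀ r, ‖f z x‖ ≤ bound x) (hint : Integrable bound μ) :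
    DifferentiableAt ℂ (fun z => ∫ x, f z x ∂μ) z₀ := by
  have hr2 : 0 < r / 2 := by linarith
  have hr4 : 0 < r / 4 := by linarith
  have hz0 : z₀ ∈ Metric.ball z₀ r := Metric.mem_ball_self hr
  have hderivmeas : AEStronglyMeasurable (fun x => deriv (fun z => f z x) z₀) μ := by
    refine aestronglyMeasurable_of_tendsto_ae Filter.atTop
      (f := fun (m : ℕ) x => ((r / (m + 2) : ℝ) : ℂ)⁻¹ • (f (z₀ + (r / (m + 2) : ℝ)) x - f z₀ x))
      (fun m => ?_) ?_
    · simp only [smul_eq_mul]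
      refine AEStronglyMeasurable.const_mul ((hmeas _ ?_).sub (hmeas _ hz0)) _
      rw [Metric.mem_ball, dist_eq_norm, add_sub_cancel_left, Complex.norm_real, Real.norm_eq_abs,
        abs_of_pos (by positivity), div_lt_iff₀ (by positivity)]
      have : (0 : ℝ) ≤ m := m.cast_nonneg
      nlinarith
    · filter_upwards [hdiff] with x hx
      have hd : HasDerivAt (fun z => f z x) (deriv (fun z => f z x) z₀) z₀ :=
        (hx.differentiableAt (Metric.isOpen_ball.mem_nhds hz0)).hasDerivAt
      refine hd.tendsto_slope_zero.comp ?_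
      refine tendsto_nhdsWithin_iff.2 ⟨?_, Filter.Eventually.of_forall fun m => ?_⟩
      · have : Filter.Tendsto (fun m : ℕ => r / ((m : ℝ) + 2)) Filter.atTop (nhds 0) :=
          Filter.Tendsto.div_atTop tendsto_const_nhds
            (Filter.tendsto_atTop_add_const_right _ _ tendsto_natCast_atTop_atTop)
        exact (Complex.continuous_ofReal.tendsto' 0 0 (by simp)).comp this
      · have : (r / ((m : ℝ) + 2)) ≠ 0 := by positivity
        simpa using Complex.ofReal_ne_zero.2 this
  refine (hasDerivAt_integral_of_dominated_loc_of_deriv_le (μ := μ) (F := f)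
    (F' := fun z x => deriv (fun z => f z x) z) (bound := fun x => bound x / (r / 4))
    (s := Metric.ball z₀ (r / 2)) (Metric.ball_mem_nhds _ hr2) ?_ ?_ hderivmeas ?_ ?_ ?_).2.differentiableAt
  · filter_upwards [Metric.ball_mem_nhds z₀ hr] with z hz using hmeas z hz
  · refine hint.mono' (hmeas _ hz0) ?_
    filter_upwards [hbound] with x hx using hx _ hz0
  · filter_upwards [hbound, hdiff] with x hx hd z hz
    have hsub : Metric.closedBall z (r / 4) ⊆ Metric.ball z₀ r := fun w hw => by
      have h1 := Metric.mem_ball.1 hz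
      have h2 := Metric.mem_closedBall.1 hw
      have := dist_triangle w z z₀
      exact Metric.mem_ball.2 (by linarith)
    refine Complex.norm_deriv_le_of_forall_mem_sphere_norm_le hr4 ?_ fun w hw =>
      hx w (hsub (Metric.sphere_subset_closedBall hw))
    exact (hd.mono hsub).diffContOnCl_ball subset_rfl
  · exact hint.div_const _
  · filter_upwards [hdiff] with x hd z hz
    refine (hd.differentiableAt (Metric.isOpen_ball.mem_nhds ?_)).hasDerivAt
    exact Metric.ball_subset_ball (by linarith) hz

/-- The `ℓ¹` norm. -/
def l1 (x : Fin n → ℝ) : ℝ := ∑ i, |x i|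

lemma l1_nonneg (x : Fin n → ℝ) : 0 ≤ l1 x := sum_nonneg fun _ _ => abs_nonneg _

lemma abs_dotR_le (a x : Fin n → ℝ) : |dotR a x| ≤ l1 a * l1 x := by
  unfold dotR l1
  refine (abs_sum_le_sum_abs _ _).trans ?_
  rw [sum_mul]
  refine sum_le_sum fun i _ => ?_
  rw [abs_mul]
  exact mul_le_mul_of_nonneg_left
    (single_le_sum (f := fun j => |x j|) (fun j _ => abs_nonneg _) (mem_univ i)) (abs_nonneg _)

lemma sum_abs_dotR_le (R : Finset (Fin n → ℝ)) (x : Fin n → ℝ) :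
    ∑ α ∈ R, |dotR α x| ≤ (∑ α ∈ R, l1 α) * l1 x := by
  rw [sum_mul]
  exact sum_le_sum fun α _ => abs_dotR_le α x

lemma continuous_l1 : Continuous (l1 : (Fin n → ℝ) → ℝ) := by
  unfold l1; fun_prop

lemma dotR_self_eq (x : Fin n → ℝ) : dotR x x = ∑ i, x i ^ 2 :=
  sum_congr rfl fun _ _ => (sq _).symm

lemma continuous_dotR_self : Continuous fun x : Fin n → ℝ => dotR x x := by
  unfold dotR; fun_prop

lemma integrable_gauss {s : ℝ} (hs : 0 < s) :
    Integrable fun x : Fin n → ℝ => Real.exp (-(s * dotR x x)) := by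
  have h := Integrable.fintype_prod (fun _ : Fin n => integrable_exp_neg_mul_sq hs)
  refine h.congr (.of_forall fun x => ?_)
  simp only [dotR_self_eq, mul_sum, ← sum_neg_distrib, Real.exp_sum, neg_mul]

lemma mul_l1_sub_le (B : ℝ) {s : ℝ} (hs : 0 < s) (x : Fin n → ℝ) :
    B * l1 x - s * dotR x x ≤ n * (B ^ 2 / (2 * s)) - s / 2 * dotR x x := by
  have hn : (n : ℝ) * (B ^ 2 / (2 * s)) = ∑ _i : Fin n, B ^ 2 / (2 * s) := by simp
  rw [dotR_self_eq, l1, hn, mul_sum, mul_sum, mul_sum, ← sum_sub_distrib, ← sum_sub_distrib]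
  refine sum_le_sum fun i _ => ?_
  have e : B ^ 2 / (2 * s) - s / 2 * x i ^ 2 - (B * |x i| - s * x i ^ 2) =
      (B - s * |x i|) ^ 2 / (2 * s) := by
    field_simp
    linear_combination (-s ^ 2) * sq_abs (x i)
  have : 0 ≤ (B - s * |x i|) ^ 2 / (2 * s) := by positivity
  linarith

lemma integrable_majorant (A B : ℝ) {s : ℝ} (hs : 0 < s) :
    Integrable fun x : Fin n → ℝ => Real.exp (A + B * l1 x - s * dotR x x) := by
  have h := (integrable_gauss (n := n) (half_pos hs)).const_mul
    (Real.exp (A + n * (B ^ 2 / (2 * s))))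
  have hc1 := continuous_l1 (n := n)
  have hc2 := continuous_dotR_self (n := n)
  refine h.mono' (by fun_prop) (.of_forall fun x => ?_)
  rw [Real.norm_eq_abs, abs_of_pos (Real.exp_pos _), ← Real.exp_add]
  apply Real.exp_le_exp.2
  linarith [mul_l1_sub_le B hs x]

lemma integral_gauss {s : ℝ} :
    ∫ x : Fin n → ℝ, Real.exp (-(s * dotR x x)) = Real.sqrt (Real.pi / s) ^ n := by
  have h := integral_fintype_prod_volume_eq_prod (fun (_ : Fin n) (t : ℝ) => Real.exp (-s * t ^ 2))
  simp only [integral_gaussian, prod_const, card_univ, Fintype.card_fin] at h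
  rw [← h]
  congr 1
  ext x
  simp only [dotR_self_eq, mul_sum, ← sum_neg_distrib, Real.exp_sum, neg_mul]

end

/-! ### The Macdonald–Mehta integral -/

section

variable {n : ℕ}

/-- The product `∏ |(α,x)|^{2k}`. -/
noncomputable def phi (R : Finset (Fin n → ℝ)) (k : ℂ) (x : Fin n → ℝ) : ℂ :=
  ∏ α ∈ R, ((|dotR α x| : ℝ) : ℂ) ^ (2 * k)

/-- The Gaussian normalisation constant `(2π)^{-n/2}`. -/
noncomputable def gaussConst (n : ℕ) : ℝ := (Real.sqrt (2 * Real.pi) ^ n)⁻¹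

/-- The Macdonald–Mehta integral with the Gaussian `exp (-s|x|²/2)`. -/
noncomputable def mehta (R : Finset (Fin n → ℝ)) (k s : ℂ) : ℂ :=
  gaussConst n * ∫ x : Fin n → ℝ, phi R k x * Complex.exp (-(s * (dotR x x : ℝ)) / 2)

lemma gaussConst_pos : 0 < gaussConst n := by
  unfold gaussConst; positivity

lemma gaussConst_mul_integral {s : ℝ} (hs : 0 < s) :
    gaussConst n * ∫ x : Fin n → ℝ, Real.exp (-(s / 2 * dotR x x)) = (Real.sqrt s ^ n)⁻¹ := by
  rw [integral_gauss, gaussConst, show Real.pi / (s / 2) = (2 * Real.pi) / s by field_simp,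
    Real.sqrt_div (by positivity), div_pow]
  have : Real.sqrt (2 * Real.pi) ≠ 0 := by positivity
  field_simp

lemma norm_cpow_le {t : ℝ} (ht : 0 ≤ t) {z : ℂ} (hz : 0 ≤ z.re) :
    ‖(t : ℂ) ^ z‖ ≤ Real.exp (z.re * t) := by
  have h1 : 1 ≤ Real.exp (z.re * t) := Real.one_le_exp (by positivity)
  rcases ht.eq_or_lt with rfl | ht
  · rcases eq_or_ne z 0 with rfl | h
    · simp
    · rw [Complex.ofReal_zero, Complex.zero_cpow h, norm_zero]; positivity
  · rw [Complex.norm_cpow_eq_rpow_re_of_pos ht, Real.rpow_def_of_pos ht]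
    apply Real.exp_le_exp.2
    have := Real.log_le_sub_one_of_pos ht
    rw [mul_comm]
    exact mul_le_mul_of_nonneg_left (by linarith) hz

lemma norm_phi_le (R : Finset (Fin n → ℝ)) {k : ℂ} (hk : 0 ≤ k.re) (x : Fin n → ℝ) :
    ‖phi R k x‖ ≤ Real.exp (2 * k.re * (∑ α ∈ R, l1 α) * l1 x) := by
  rw [phi, norm_prod]
  have hre : (2 * k).re = 2 * k.re := by simp
  calc ∏ α ∈ R, ‖((|dotR α x| : ℝ) : ℂ) ^ (2 * k)‖
      ≤ ∏ α ∈ R, Real.exp (2 * k.re * |dotR α x|) :=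
        prod_le_prod (fun _ _ => norm_nonneg _) fun α _ => by
          have := norm_cpow_le (abs_nonneg (dotR α x)) (z := 2 * k) (by rw [hre]; positivity)
          rwa [hre] at this
    _ = Real.exp (2 * k.re * ∑ α ∈ R, |dotR α x|) := by rw [← Real.exp_sum, mul_sum]
    _ ≤ _ := by
      apply Real.exp_le_exp.2
      rw [mul_assoc (2 * k.re)]
      exact mul_le_mul_of_nonneg_left (sum_abs_dotR_le R x) (by positivity)

lemma measurable_phi (R : Finset (Fin n → ℝ)) (k : ℂ) : Measurable (phi R k) := by
  unfold phi
  refine Finset.measurable_prod _ fun α _ => ?_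
  have : Measurable fun x : Fin n → ℝ => ((|dotR α x| : ℝ) : ℂ) := by
    have := continuous_dotR α
    exact (by fun_prop : Continuous fun x : Fin n → ℝ => ((|dotR α x| : ℝ) : ℂ)).measurable
  exact this.pow_const _

lemma norm_exp_gauss (s : ℂ) (x : Fin n → ℝ) :
    ‖Complex.exp (-(s * (dotR x x : ℝ)) / 2)‖ = Real.exp (-(s.re / 2 * dotR x x)) := by
  rw [Complex.norm_exp]
  congr 1
  have : (-(s * (dotR x x : ℝ)) / 2 : ℂ) = ((-(dotR x x) / 2 : ℝ) : ℂ) * s := by push_cast; ring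
  rw [this, Complex.re_ofReal_mul]
  ring

lemma measurable_gauss (s : ℂ) :
    Measurable fun x : Fin n → ℝ => Complex.exp (-(s * (dotR x x : ℝ)) / 2) := by
  have := continuous_dotR_self (n := n)
  exact (by fun_prop : Continuous _).measurable

lemma norm_mehta_integrand_le (R : Finset (Fin n → ℝ)) {k : ℂ} (hk : 0 ≤ k.re) (s : ℂ)
    (x : Fin n → ℝ) : ‖phi R k x * Complex.exp (-(s * (dotR x x : ℝ)) / 2)‖ ≤
      Real.exp (0 + 2 * k.re * (∑ α ∈ R, l1 α) * l1 x - s.re / 2 * dotR x x) := by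
  rw [norm_mul, norm_exp_gauss, zero_add, sub_eq_add_neg, Real.exp_add]
  exact mul_le_mul_of_nonneg_right (norm_phi_le R hk x) (Real.exp_pos _).le

lemma integrable_mehta (R : Finset (Fin n → ℝ)) {k s : ℂ} (hk : 0 ≤ k.re) (hs : 0 < s.re) :
    Integrable fun x : Fin n → ℝ => phi R k x * Complex.exp (-(s * (dotR x x : ℝ)) / 2) :=
  (integrable_majorant _ _ (half_pos hs)).mono'
    ((measurable_phi R k).mul (measurable_gauss s)).aestronglyMeasurable
    (.of_forall (norm_mehta_integrand_le R hk s))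

lemma majorant_mono {A B A' B' s s' : ℝ} (hA : A ≤ A') (hB : B ≤ B') (hs : s' ≤ s)
    (x : Fin n → ℝ) : Real.exp (A + B * l1 x - s * dotR x x) ≤
      Real.exp (A' + B' * l1 x - s' * dotR x x) := by
  apply Real.exp_le_exp.2
  have h1 := mul_le_mul_of_nonneg_right hB (l1_nonneg x)
  have h2 := mul_le_mul_of_nonneg_right hs (dotR_self_nonneg x)
  linarith

lemma differentiableAt_mehta_right (R : Finset (Fin n → ℝ)) {k s : ℂ} (hk : 0 ≤ k.re)
    (hs : 0 < s.re) : DifferentiableAt ℂ (fun s => mehta R k s) s := by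
  unfold mehta
  refine DifferentiableAt.const_mul ?_ _
  have hre : ∀ z ∈ Metric.ball s (s.re / 2), s.re / 2 ≤ z.re := fun z hz => by
    have h1 := (Complex.abs_re_le_norm (z - s)).trans (mem_ball_iff_norm.1 hz).le
    rw [sub_re] at h1
    linarith [(abs_le.1 h1).1]
  refine differentiableAt_integral (half_pos hs)
    (bound := fun x => Real.exp (0 + 2 * k.re * (∑ α ∈ R, l1 α) * l1 x - s.re / 4 * dotR x x))
    (fun z _ => ((measurable_phi R k).mul (measurable_gauss z)).aestronglyMeasurable)
    (.of_forall fun x => by fun_prop) (.of_forall fun x z hz => ?_)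
    (integrable_majorant _ _ (by linarith))
  exact (norm_mehta_integrand_le R hk z x).trans
    (majorant_mono le_rfl le_rfl (by linarith [hre z hz]) x)

lemma sum_l1_nonneg (R : Finset (Fin n → ℝ)) : 0 ≤ ∑ α ∈ R, l1 α :=
  sum_nonneg fun _ _ => l1_nonneg _

lemma differentiableAt_phi (R : Finset (Fin n → ℝ)) {k : ℂ} (hk : 0 < k.re) (x : Fin n → ℝ) :
    DifferentiableAt ℂ (fun k => phi R k x) k := by
  unfold phi
  refine DifferentiableAt.fun_finsetProd fun α _ => ?_
  have h0 : (2 * k) ≠ 0 := by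
    intro h
    have : k = 0 := by simpa using h
    rw [this] at hk
    simp at hk
  exact (by fun_prop : DifferentiableAt ℂ (fun k : ℂ => 2 * k) k).const_cpow (.inr h0)

lemma differentiableAt_mehta_left (R : Finset (Fin n → ℝ)) {k : ℂ} (hk : 0 < k.re) :
    DifferentiableAt ℂ (fun k => mehta R k 1) k := by
  unfold mehta
  refine DifferentiableAt.const_mul ?_ _
  have hre : ∀ z ∈ Metric.ball k k.re, 0 < z.re ∧ z.re ≤ 2 * k.re := fun z hz => by
    have h1 := (Complex.abs_re_le_norm (z - k)).trans_lt (mem_ball_iff_norm.1 hz)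
    rw [sub_re] at h1
    constructor <;> linarith [(abs_lt.1 h1).1, (abs_lt.1 h1).2]
  refine differentiableAt_integral hk
    (bound := fun x => Real.exp (0 + 2 * (2 * k.re) * (∑ α ∈ R, l1 α) * l1 x - (1 / 2) * dotR x x))
    (fun z _ => ((measurable_phi R z).mul (measurable_gauss 1)).aestronglyMeasurable)
    (.of_forall fun x z hz => ((differentiableAt_phi R (hre z hz).1 x).mul_const
      _).differentiableWithinAt) (.of_forall fun x z hz => ?_)
    (integrable_majorant _ _ (by norm_num))
  refine (norm_mehta_integrand_le R (hre z hz).1.le 1 x).trans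
    (majorant_mono le_rfl ?_ (by simp) x)
  exact mul_le_mul_of_nonneg_right (by linarith [(hre z hz).2]) (sum_l1_nonneg R)

lemma phi_smul (R : Finset (Fin n → ℝ)) (k : ℂ) {t : ℝ} (ht : 0 < t) (x : Fin n → ℝ) :
    phi R k (t • x) = (t : ℂ) ^ (2 * k * R.card) * phi R k x := by
  have : (t : ℂ) ^ (2 * k * R.card) = ∏ α ∈ R, (t : ℂ) ^ (2 * k) := by
    rw [prod_const, mul_comm, ← Complex.cpow_nat_mul]
  rw [this, phi, phi, ← prod_mul_distrib]
  refine prod_congr rfl fun α _ => ?_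
  rw [dotR_smul, abs_mul, abs_of_pos ht, Complex.ofReal_mul,
    Complex.mul_cpow_ofReal_nonneg ht.le (abs_nonneg _)]

lemma mehta_ofReal (R : Finset (Fin n → ℝ)) (k : ℂ) {s : ℝ} (hs : 0 < s) :
    mehta R k s = (s : ℂ) ^ (-((n : ℂ) / 2 + k * R.card)) * mehta R k 1 := by
  have hq : 0 < Real.sqrt s := Real.sqrt_pos.2 hs
  have h := Measure.integral_comp_smul (volume : Measure (Fin n → ℝ))
    (fun x => phi R k x * Complex.exp (-(1 * (dotR x x : ℝ)) / 2)) (Real.sqrt s)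
  have e : ∀ x : Fin n → ℝ, phi R k (Real.sqrt s • x) *
      Complex.exp (-(1 * (dotR (Real.sqrt s • x) (Real.sqrt s • x) : ℝ)) / 2) =
      (Real.sqrt s : ℂ) ^ (2 * k * R.card) *
        (phi R k x * Complex.exp (-(s * (dotR x x : ℝ)) / 2)) := by
    intro x
    rw [phi_smul R k hq, dotR_smul, smul_dotR, ← mul_assoc (Real.sqrt s), Real.mul_self_sqrt hs.le]
    push_cast
    ring_nf
  simp only [e] at h
  rw [integral_const_mul, Module.finrank_fin_fun, abs_of_pos (by positivity), Complex.real_smul] at h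
  unfold mehta
  have hs0 : (s : ℂ) ≠ 0 := by exact_mod_cast hs.ne'
  have hq0 : (Real.sqrt s : ℂ) ≠ 0 := by exact_mod_cast hq.ne'
  have hpow : ∀ z : ℂ, (Real.sqrt s : ℂ) ^ (2 * z) = (s : ℂ) ^ z := by
    intro z
    have : (s : ℂ) = (Real.sqrt s : ℂ) * (Real.sqrt s : ℂ) := by
      rw [← Complex.ofReal_mul, Real.mul_self_sqrt hs.le]
    rw [this, Complex.mul_cpow_ofReal_nonneg hq.le hq.le, two_mul, Complex.cpow_add _ _ hq0]
  have hn : (((Real.sqrt s ^ n)⁻¹ : ℝ) : ℂ) = (s : ℂ) ^ (-((n : ℂ) / 2)) := by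
    rw [Complex.cpow_neg, ← hpow, Complex.ofReal_inv, Complex.ofReal_pow,
      mul_div_cancel₀ _ two_ne_zero, Complex.cpow_natCast]
  rw [hn, mul_assoc, hpow] at h
  rw [neg_add, Complex.cpow_add _ _ hs0, Complex.cpow_neg _ (k * _)]
  have hne : (s : ℂ) ^ (k * R.card) ≠ 0 := by simp [Complex.cpow_eq_zero_iff, hs0]
  generalize (∫ x : Fin n → ℝ, phi R k x * Complex.exp (-(s * (dotR x x : ℝ)) / 2)) = J at *
  generalize (∫ x : Fin n → ℝ, phi R k x * Complex.exp (-(1 * (dotR x x : ℝ)) / 2)) = K at *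
  field_simp
  linear_combination (gaussConst n : ℂ) * h

lemma mehta_eq (R : Finset (Fin n → ℝ)) {k s : ℂ} (hk : 0 ≤ k.re) (hs : 0 < s.re) :
    mehta R k s = s ^ (-((n : ℂ) / 2 + k * R.card)) * mehta R k 1 := by
  have hopen : IsOpen {z : ℂ | 0 < z.re} := isOpen_lt continuous_const Complex.continuous_re
  have hconn : IsPreconnected {z : ℂ | 0 < z.re} := (convex_halfSpace_re_gt 0).isPreconnected
  have h1 : AnalyticOnNhd ℂ (fun s => mehta R k s) {z : ℂ | 0 < z.re} :=
    DifferentiableOn.analyticOnNhd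
      (fun z hz => (differentiableAt_mehta_right R hk hz).differentiableWithinAt) hopen
  have h2 : AnalyticOnNhd ℂ (fun s => s ^ (-((n : ℂ) / 2 + k * R.card)) * mehta R k 1)
      {z : ℂ | 0 < z.re} := by
    refine DifferentiableOn.analyticOnNhd (fun z hz => ?_) hopen
    refine (DifferentiableAt.mul_const ?_ _).differentiableWithinAt
    exact (differentiableAt_id).cpow_const (.inl hz)
  refine h1.eqOn_of_preconnected_of_frequently_eq h2 hconn (z₀ := 1) (by simp) ?_ hs
  have ht : Filter.Tendsto (fun m : ℕ => ((1 + 1 / ((m : ℝ) + 1) : ℝ) : ℂ)) Filter.atTop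
      (nhdsWithin 1 {1}ᶜ) := by
    refine tendsto_nhdsWithin_iff.2 ⟨?_, .of_forall fun m => ?_⟩
    · have := (tendsto_one_div_add_atTop_nhds_zero_nat (𝕜 := ℝ)).const_add 1
      exact (Complex.continuous_ofReal.tendsto' _ 1 (by simp)).comp this
    · have : (1 + 1 / ((m : ℝ) + 1)) ≠ 1 := by
        have : 1 / ((m : ℝ) + 1) ≠ 0 := by positivity
        simpa using this
      simpa only [Set.mem_compl_iff, Set.mem_singleton_iff, ← Complex.ofReal_one,
        Complex.ofReal_inj] using this
  exact ht.frequently (.of_forall fun m => mehta_ofReal R k (by positivity))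

/-- Decay of the integral along the imaginary axis. -/
lemma norm_mehta_imag_le (R : Finset (Fin n → ℝ)) {θ : ℝ} (h0 : 0 ≤ θ) (h1 : θ < Real.pi / 2) :
    ∃ B, ∀ y : ℝ, ‖mehta R (y * I) 1‖ ≤ B * Real.exp (-(R.card * θ * |y|)) := by
  have hcos : 0 < Real.cos θ := Real.cos_pos_of_mem_Ioo ⟨by linarith [Real.pi_pos], h1⟩
  refine ⟨(Real.sqrt (Real.cos θ) ^ n)⁻¹, fun y => ?_⟩
  have key : ∀ τ : ℝ, |τ| = θ → ‖mehta R (y * I) 1‖ * Real.exp (R.card * τ * y) ≤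
      (Real.sqrt (Real.cos θ) ^ n)⁻¹ := by
    intro τ hτ
    have hc : Real.cos τ = Real.cos θ := by rw [← hτ, Real.cos_abs]
    have hτ2 := abs_le.1 hτ.le
    have hre : (Complex.exp (τ * I)).re = Real.cos θ := by rw [Complex.exp_ofReal_mul_I_re, hc]
    have hk : 0 ≤ ((y : ℂ) * I).re := by simp
    have h := mehta_eq R (k := y * I) (s := Complex.exp (τ * I)) hk (by rw [hre]; exact hcos)
    have hn : ‖(Complex.exp (τ * I)) ^ (-((n : ℂ) / 2 + y * I * R.card))‖ =
        Real.exp (R.card * τ * y) := by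
      rw [Complex.cpow_def_of_ne_zero (Complex.exp_ne_zero _), Complex.log_exp, Complex.norm_exp]
      · congr 1
        have : τ * I * (-((n : ℂ) / 2 + y * I * R.card)) =
            ((R.card * τ * y : ℝ) : ℂ) + ((-(τ * n / 2) : ℝ) : ℂ) * I := by
          push_cast
          linear_combination (-(τ * y * R.card) : ℂ) * Complex.I_mul_I
        rw [this]; simp
      · simp; linarith [Real.pi_pos]
      · simp; linarith [Real.pi_pos]
    rw [mul_comm, ← hn, ← norm_mul, ← h, mehta, norm_mul, Complex.norm_real, Real.norm_eq_abs,
      abs_of_pos gaussConst_pos, ← gaussConst_mul_integral hcos]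
    refine mul_le_mul_of_nonneg_left ?_ gaussConst_pos.le
    refine norm_integral_le_of_norm_le (integrable_gauss (by positivity)) (.of_forall fun x => ?_)
    have := norm_mehta_integrand_le R hk (Complex.exp (τ * I)) x
    rw [hre] at this
    refine this.trans (le_of_eq ?_)
    simp
  rw [Real.exp_neg, ← div_eq_mul_inv, le_div_iff₀ (Real.exp_pos _)]
  rcases le_total 0 y with hy | hy
  · have := key θ (abs_of_nonneg h0)
    rwa [abs_of_nonneg hy]
  · have := key (-θ) (by rw [abs_neg, abs_of_nonneg h0])
    rw [abs_of_nonpos hy]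
    rwa [mul_neg, ← neg_mul, ← mul_neg]

end

/-! ### Growth in the right half plane -/

section

variable {n : ℕ} {R : Finset (Fin n → ℝ)}

lemma RootSys.abs_prod_map (hR : RootSys R) {e : (Fin n → ℝ) ≃ₗ[ℝ] (Fin n → ℝ)}
    (he : e ∈ coxGroup R) (x : Fin n → ℝ) :
    |∏ α ∈ R, dotR α (e x)| = |∏ α ∈ R, dotR α x| := by
  have h1 : ∀ y, MvPolynomial.eval y (delta R) = ∏ α ∈ R, dotR α y := fun y => by
    rw [delta, map_prod]
    exact prod_congr rfl fun α _ => eval_lin α y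
  have h2 : MvPolynomial.eval x (subst e.toLinearMap (delta R)) =
      MvPolynomial.eval (e x) (delta R) := eval_subst _ _ _
  rw [← h1, ← h1, ← h2]
  rcases hR.subst_delta_sign he with h | h <;> rw [h]
  rw [map_neg, abs_neg]

lemma phi_eq (R : Finset (Fin n → ℝ)) (k : ℂ) (x : Fin n → ℝ) :
    phi R k x = ((|∏ α ∈ R, dotR α x| : ℝ) : ℂ) ^ (2 * k) := by
  rw [phi]
  induction R using Finset.induction_on with
  | empty => simp
  | insert a S ha ih => rw [prod_insert ha, ih, prod_insert ha, abs_mul, Complex.ofReal_mul,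
      Complex.mul_cpow_ofReal_nonneg (abs_nonneg _) (abs_nonneg _)]

lemma RootSys.phi_map (hR : RootSys R) {e : (Fin n → ℝ) ≃ₗ[ℝ] (Fin n → ℝ)}
    (he : e ∈ coxGroup R) (k : ℂ) (x : Fin n → ℝ) : phi R k (e x) = phi R k x := by
  rw [phi_eq, phi_eq, hR.abs_prod_map he]

/-- Critical points of `∏ (α,x)² exp (-|x|²/2)` in the fundamental chamber. -/
def IsCritical (R : Finset (Fin n → ℝ)) (ξ : Fin n → ℝ) : Prop :=
  (∀ α ∈ R, 0 < dotR α ξ) ∧ ∀ v, ∑ α ∈ R, 2 * dotR α v / dotR α ξ = dotR ξ v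

/-- The weight `∏ (α,x)² exp (-|x|²/2)`. -/
noncomputable def weight (R : Finset (Fin n → ℝ)) (x : Fin n → ℝ) : ℝ :=
  (∏ α ∈ R, dotR α x) ^ 2 * Real.exp (-(dotR x x / 2))

lemma log_weight {x : Fin n → ℝ} (hx : Regular R x) :
    Real.log (weight R x) = ∑ α ∈ R, 2 * Real.log (dotR α x) - dotR x x / 2 := by
  have h : ∏ α ∈ R, dotR α x ≠ 0 := prod_ne_zero_iff.2 hx
  rw [weight, Real.log_mul (pow_ne_zero _ h) (Real.exp_pos _).ne', Real.log_pow, Real.log_exp,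
    Real.log_prod hx, mul_sum]
  push_cast; ring

lemma weight_pos {x : Fin n → ℝ} (hx : Regular R x) : 0 < weight R x := by
  have h : ∏ α ∈ R, dotR α x ≠ 0 := prod_ne_zero_iff.2 hx
  unfold weight
  positivity

lemma weight_le (R : Finset (Fin n → ℝ)) (x : Fin n → ℝ) :
    weight R x ≤ Real.exp (n * (2 * ∑ α ∈ R, l1 α) ^ 2 - 1 / 4 * dotR x x) := by
  have h1 : (∏ α ∈ R, dotR α x) ^ 2 ≤ Real.exp (2 * (∑ α ∈ R, l1 α) * l1 x) := by
    rw [← sq_abs, abs_prod]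
    calc (∏ α ∈ R, |dotR α x|) ^ 2 ≤ (∏ α ∈ R, Real.exp |dotR α x|) ^ 2 := by
          refine pow_le_pow_left₀ (prod_nonneg fun _ _ => abs_nonneg _)
            (prod_le_prod (fun _ _ => abs_nonneg _) fun α _ => ?_) _
          linarith [Real.add_one_le_exp |dotR α x|]
      _ = Real.exp (2 * ∑ α ∈ R, |dotR α x|) := by
          rw [← Real.exp_sum, ← Real.exp_nat_mul]; norm_num
      _ ≤ _ := by
          apply Real.exp_le_exp.2
          rw [mul_assoc]
          exact mul_le_mul_of_nonneg_left (sum_abs_dotR_le R x) (by norm_num)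
  calc weight R x ≤ Real.exp (2 * (∑ α ∈ R, l1 α) * l1 x) * Real.exp (-(dotR x x / 2)) :=
        mul_le_mul_of_nonneg_right h1 (Real.exp_pos _).le
    _ ≤ _ := by
      rw [← Real.exp_add]
      apply Real.exp_le_exp.2
      have := mul_l1_sub_le (2 * ∑ α ∈ R, l1 α) (s := 1 / 2) (by norm_num) x
      norm_num at this ⊢
      linarith

lemma sq_norm_le (x : Fin n → ℝ) : ‖x‖ ^ 2 ≤ dotR x x := by
  rw [← Real.le_sqrt (norm_nonneg x) (dotR_self_nonneg x),
    pi_norm_le_iff_of_nonneg (Real.sqrt_nonneg _)]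
  intro i
  rw [dotR_self_eq, Real.norm_eq_abs]
  exact Real.abs_le_sqrt (single_le_sum (f := fun j => x j ^ 2) (fun j _ => sq_nonneg _) (mem_univ i))

lemma continuous_weight (R : Finset (Fin n → ℝ)) : Continuous (weight R) := by
  have h1 := continuous_dotR_self (n := n)
  have h2 := continuous_dotR (n := n)
  unfold weight
  fun_prop

lemma exists_max_weight (R : Finset (Fin n → ℝ)) {v : Fin n → ℝ} (hv : Regular R v) :
    ∃ u, ∀ y, weight R y ≤ weight R u := by
  refine (continuous_weight R).exists_forall_ge' v ?_
  have h0 := weight_pos hv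
  have h1 : Filter.Tendsto (fun x : Fin n → ℝ =>
      Real.exp (n * (2 * ∑ α ∈ R, l1 α) ^ 2 - 1 / 4 * ‖x‖ ^ 2))
      (Filter.cocompact _) (nhds 0) := by
    refine Real.tendsto_exp_atBot.comp ?_
    refine Filter.tendsto_atBot_add_const_left _ _ ?_
    refine Filter.tendsto_neg_atTop_atBot.comp ?_
    refine Filter.Tendsto.const_mul_atTop (by norm_num) ?_
    exact (Filter.tendsto_pow_atTop two_ne_zero).comp tendsto_norm_cocompact_atTop
  filter_upwards [h1.eventually_lt_const h0] with x hx
  refine (weight_le R x).trans (le_trans ?_ hx.le)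
  apply Real.exp_le_exp.2
  linarith [sq_norm_le x]

lemma RootSys.exists_isCritical (hR : RootSys R) : ∃ ξ, IsCritical R ξ := by
  obtain ⟨v, hv⟩ := hR.pos
  have hvr : Regular R v := fun α hα => (hv α hα).ne'
  obtain ⟨u, hu⟩ := exists_max_weight R hvr
  obtain ⟨w, hw, hwu⟩ := hR.exists_dominant hv u
  have hmax : ∀ y, weight R y ≤ weight R (w u) := fun y => by
    refine (hu y).trans (le_of_eq ?_)
    rw [weight, weight, hR.dotR_map hw, ← sq_abs, ← hR.abs_prod_map hw, sq_abs]
  have hreg : Regular R (w u) := by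
    have h1 := (weight_pos hvr).trans_le (hmax v)
    intro α hα h0
    rw [weight, prod_eq_zero hα h0] at h1
    simp at h1
  have hpos : ∀ α ∈ R, 0 < dotR α (w u) := fun α hα => (hwu α hα).lt_of_ne (hreg α hα).symm
  refine ⟨w u, hpos, fun y => ?_⟩
  set ξ := w u
  have hd : HasDerivAt (fun t : ℝ => ∑ α ∈ R, 2 * Real.log (dotR α ξ + t * dotR α y) -
      (dotR ξ ξ + t * (2 * dotR ξ y) + t ^ 2 * dotR y y) / 2)
      (∑ α ∈ R, 2 * (dotR α y / dotR α ξ) - (2 * dotR ξ y) / 2) 0 := by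
    refine HasDerivAt.sub (HasDerivAt.fun_sum fun α hα => HasDerivAt.const_mul _ ?_) ?_
    · have : HasDerivAt (fun t : ℝ => dotR α ξ + t * dotR α y) (dotR α y) 0 := by
        simpa using ((hasDerivAt_id (0 : ℝ)).mul_const (dotR α y)).const_add (dotR α ξ)
      simpa using this.log (by simpa using (hpos α hα).ne')
    · have h1 := ((hasDerivAt_id (0 : ℝ)).mul_const (2 * dotR ξ y)).const_add (dotR ξ ξ)
      have h2 := (hasDerivAt_pow 2 (0 : ℝ)).mul_const (dotR y y)
      simpa using (h1.add h2).div_const 2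
  have hloc : IsLocalMax (fun t : ℝ => ∑ α ∈ R, 2 * Real.log (dotR α ξ + t * dotR α y) -
      (dotR ξ ξ + t * (2 * dotR ξ y) + t ^ 2 * dotR y y) / 2) 0 := by
    have hev : ∀ᶠ t : ℝ in nhds 0, ∀ α ∈ R, dotR α ξ + t * dotR α y ≠ 0 := by
      refine (Filter.eventually_all_finset R).2 fun α hα => ?_
      have : Continuous fun t : ℝ => dotR α ξ + t * dotR α y := by fun_prop
      exact this.continuousAt.eventually_ne (by simpa using (hpos α hα).ne')
    filter_upwards [hev] with t ht
    have hreg' : Regular R (ξ + t • y) := fun α hα => by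
      rw [dotR_add, dotR_smul]; exact ht α hα
    have h := Real.log_le_log (weight_pos hreg') (hmax (ξ + t • y))
    rw [log_weight hreg', log_weight hreg] at h
    simp only [dotR_add, dotR_smul, add_dotR, smul_dotR] at h
    rw [dotR_comm y ξ] at h
    simp only [zero_mul, add_zero, ne_eq, OfNat.ofNat_ne_zero, not_false_eq_true, zero_pow]
    refine le_trans (le_of_eq ?_) h
    ring
  have h0 := hloc.hasDerivAt_eq_zero hd
  have h1 : ∑ α ∈ R, 2 * dotR α y / dotR α ξ = ∑ α ∈ R, 2 * (dotR α y / dotR α ξ) :=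
    sum_congr rfl fun α _ => mul_div_assoc _ _ _
  linarith

lemma IsCritical.dotR_self {ξ : Fin n → ℝ} (h : IsCritical R ξ) : dotR ξ ξ = 2 * R.card := by
  rw [← h.2 ξ, mul_comm, ← nsmul_eq_mul, ← sum_const]
  exact sum_congr rfl fun α hα => mul_div_cancel_right₀ _ (h.1 α hα).ne'

/-- The logarithm of the maximal value of the weight. -/
noncomputable def logMax (R : Finset (Fin n → ℝ)) (ξ : Fin n → ℝ) : ℝ :=
  2 * ∑ α ∈ R, Real.log (dotR α ξ) - R.card

lemma IsCritical.tangent {ξ : Fin n → ℝ} (h : IsCritical R ξ) {x : ℝ} (hx : 0 < x)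
    {u : Fin n → ℝ} (hu : ∀ α ∈ R, 0 < dotR α u) :
    2 * x * ∑ α ∈ R, Real.log (dotR α u) - 1 / 2 * dotR u u ≤
      R.card * x * Real.log x + x * logMax R ξ -
        1 / 2 * dotR (u - Real.sqrt x • ξ) (u - Real.sqrt x • ξ) := by
  have hq := Real.sqrt_pos.2 hx
  have hqq := Real.mul_self_sqrt hx.le
  have key : ∀ α ∈ R, Real.log (dotR α u) ≤ Real.log x / 2 + Real.log (dotR α ξ) +
      (dotR α u / dotR α ξ / Real.sqrt x - 1) := fun α hα => by
    have h1 := h.1 α hα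
    have h2 := hu α hα
    have h3 := Real.log_le_sub_one_of_pos (x := dotR α u / (Real.sqrt x * dotR α ξ))
      (by positivity)
    rw [Real.log_div h2.ne' (by positivity), Real.log_mul hq.ne' h1.ne',
      Real.log_sqrt hx.le] at h3
    have h4 : dotR α u / (Real.sqrt x * dotR α ξ) = dotR α u / dotR α ξ / Real.sqrt x := by
      field_simp
    rw [h4] at h3
    linarith
  have hsum := sum_le_sum key
  have hcr : ∑ α ∈ R, dotR α u / dotR α ξ = dotR ξ u / 2 := by
    rw [← h.2 u, sum_div]
    exact sum_congr rfl fun α _ => by ring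
  rw [sum_add_distrib, sum_add_distrib, sum_sub_distrib, ← sum_div R _ (Real.sqrt x), hcr, sum_const, sum_const,
    nsmul_eq_mul, nsmul_eq_mul, mul_one] at hsum
  have h5 := mul_le_mul_of_nonneg_left hsum (by positivity : 0 ≤ 2 * x)
  have h6 : x * (dotR ξ u / 2 / Real.sqrt x) = Real.sqrt x * dotR ξ u / 2 := by
    field_simp
    linear_combination (-dotR ξ u) * hqq
  simp only [sub_dotR, dotR_sub, smul_dotR, dotR_smul, h.dotR_self, logMax]
  rw [dotR_comm u ξ]
  have h7 : Real.sqrt x * (Real.sqrt x * (2 * (R.card : ℝ))) = x * (2 * R.card) := by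
    rw [← mul_assoc, hqq]
  linarith

lemma norm_phi_of_pos {u : Fin n → ℝ} (hu : ∀ α ∈ R, 0 < dotR α u) (k : ℂ) :
    ‖phi R k u‖ = Real.exp (2 * k.re * ∑ α ∈ R, Real.log (dotR α u)) := by
  rw [phi, norm_prod, mul_sum, Real.exp_sum]
  refine prod_congr rfl fun α hα => ?_
  rw [abs_of_pos (hu α hα), Complex.norm_cpow_eq_rpow_re_of_pos (hu α hα),
    Real.rpow_def_of_pos (hu α hα)]
  simp [mul_comm]

lemma phi_eq_zero {u : Fin n → ℝ} {α : Fin n → ℝ} (hα : α ∈ R) (hu : dotR α u = 0) {k : ℂ}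
    (hk : 0 < k.re) : phi R k u = 0 := by
  refine prod_eq_zero hα ?_
  rw [hu, abs_zero, Complex.ofReal_zero, Complex.zero_cpow]
  intro h
  have : k = 0 := by simpa using h
  simp [this] at hk

/-- Growth of the integral in the right half plane. -/
lemma RootSys.norm_mehta_le (hR : RootSys R) {ξ : Fin n → ℝ} (h : IsCritical R ξ) {k : ℂ}
    (hk : 0 < k.re) : ‖mehta R k 1‖ ≤ (elts R).card *
      Real.exp (R.card * k.re * Real.log k.re + k.re * logMax R ξ) := by
  set A := R.card * k.re * Real.log k.re + k.re * logMax R ξ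
  obtain ⟨v, hv⟩ := hR.pos
  set f : ((Fin n → ℝ) ≃ₗ[ℝ] (Fin n → ℝ)) → (Fin n → ℝ) → ℝ := fun w u =>
    Real.exp (-(1 / 2 * dotR (u - w⁻¹ (Real.sqrt k.re • ξ)) (u - w⁻¹ (Real.sqrt k.re • ξ))))
  have hpt : ∀ u : Fin n → ℝ, ‖phi R k u * Complex.exp (-(1 * (dotR u u : ℝ)) / 2)‖ ≤
      ∑ w ∈ elts R, Real.exp A * f w u := by
    intro u
    obtain ⟨w, hw, hwu⟩ := hR.exists_dominant hv u
    refine le_trans ?_ (single_le_sum (f := fun w => Real.exp A * f w u)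
      (fun w _ => by positivity) (hR.mem_elts.2 hw))
    rw [norm_mul, norm_exp_gauss, ← hR.phi_map hw]
    by_cases hreg : ∀ α ∈ R, dotR α (w u) ≠ 0
    · have hpos : ∀ α ∈ R, 0 < dotR α (w u) := fun α hα =>
        (hwu α hα).lt_of_ne (hreg α hα).symm
      have ht := h.tangent hk hpos
      rw [norm_phi_of_pos hpos]
      simp only [f]
      rw [← Real.exp_add, ← Real.exp_add]
      apply Real.exp_le_exp.2
      have e1 : dotR (w u) (w u) = dotR u u := hR.dotR_map hw u u
      have e2 : dotR (u - w⁻¹ (Real.sqrt k.re • ξ)) (u - w⁻¹ (Real.sqrt k.re • ξ)) =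
          dotR (w u - Real.sqrt k.re • ξ) (w u - Real.sqrt k.re • ξ) := by
        rw [← hR.dotR_map hw, map_sub]
        have : w (w⁻¹ (Real.sqrt k.re • ξ)) = Real.sqrt k.re • ξ := w.apply_symm_apply _
        rw [this]
      rw [e1] at ht
      rw [e2]
      simp only [one_re]
      linarith
    · push Not at hreg
      obtain ⟨α, hα, h0⟩ := hreg
      rw [phi_eq_zero hα h0 hk, norm_zero, zero_mul]
      positivity
  have hint : ∀ w ∈ elts R, Integrable fun u => Real.exp A * f w u := fun w _ =>
    ((integrable_gauss (n := n) (s := 1 / 2) (by norm_num)).comp_sub_right _).const_mul _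
  have hval : ∀ w ∈ elts R, ∫ u, Real.exp A * f w u =
      Real.exp A * ∫ x : Fin n → ℝ, Real.exp (-(1 / 2 * dotR x x)) := fun w _ => by
    rw [integral_const_mul]
    congr 1
    exact integral_sub_right_eq_self (fun x : Fin n → ℝ => Real.exp (-(1 / 2 * dotR x x))) _
  have h1 := norm_integral_le_of_norm_le (integrable_finsetSum _ hint) (.of_forall hpt)
  rw [integral_finsetSum _ hint, sum_congr rfl hval, sum_const, nsmul_eq_mul] at h1
  rw [mehta, norm_mul, Complex.norm_real, Real.norm_eq_abs, abs_of_pos gaussConst_pos]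
  refine (mul_le_mul_of_nonneg_left h1 gaussConst_pos.le).trans (le_of_eq ?_)
  have h2 := gaussConst_mul_integral (n := n) one_pos
  rw [Real.sqrt_one, one_pow, inv_one] at h2
  linear_combination ((elts R).card * Real.exp A) * h2

end

/-! ### The translated contour -/

section

variable {n : ℕ} {R : Finset (Fin n → ℝ)}

/-- The logarithm `∑ log (α, x + ζξ)` of the product of roots on the translated contour. -/
noncomputable def logSum (R : Finset (Fin n → ℝ)) (ξ : Fin n → ℝ) (ζ : ℂ) (x : Fin n → ℝ) : ℂ :=
  ∑ α ∈ R, Complex.log (dotR α x + ζ * dotR α ξ)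

/-- The integrand on the translated contour. -/
noncomputable def shiftedIntegrand (R : Finset (Fin n → ℝ)) (ξ : Fin n → ℝ) (k ζ : ℂ)
    (x : Fin n → ℝ) : ℂ :=
  Complex.exp (2 * k * logSum R ξ ζ x) *
    Complex.exp (-(dotR x x + 2 * ζ * dotR ξ x + ζ ^ 2 * dotR ξ ξ) / 2)

/-- The Macdonald–Mehta integral over the translated contour. -/
noncomputable def shifted (R : Finset (Fin n → ℝ)) (ξ : Fin n → ℝ) (k ζ : ℂ) : ℂ :=
  gaussConst n * ∫ x : Fin n → ℝ, shiftedIntegrand R ξ k ζ x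

lemma norm_log_le {w : ℂ} {δ : ℝ} (hδ : 0 < δ) (hw : δ ≤ w.im) :
    ‖Complex.log w‖ ≤ ‖w‖ + |Real.log δ| + Real.pi := by
  have h1 : ‖Complex.log w‖ ≤ |Real.log ‖w‖| + |w.arg| := by
    refine (Complex.norm_le_abs_re_add_abs_im _).trans (le_of_eq ?_)
    rw [Complex.log_re, Complex.log_im]
  have h2 : δ ≤ ‖w‖ := hw.trans ((le_abs_self _).trans (Complex.abs_im_le_norm w))
  have h3 : |Real.log ‖w‖| ≤ ‖w‖ + |Real.log δ| := by
    have a := Real.log_le_log hδ h2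
    have b := Real.log_le_sub_one_of_pos (hδ.trans_le h2)
    have c := neg_abs_le (Real.log δ)
    have d := abs_nonneg (Real.log δ)
    have e := norm_nonneg w
    rw [abs_le]
    constructor <;> linarith
  linarith [Complex.abs_arg_le_pi w]

lemma im_shift (α x ξ : Fin n → ℝ) (ζ : ℂ) :
    ((dotR α x : ℂ) + ζ * dotR α ξ).im = ζ.im * dotR α ξ := by
  simp

lemma im_shift_pos {ξ : Fin n → ℝ} (hξ : ∀ α ∈ R, 0 < dotR α ξ) {ζ : ℂ} (hζ : 0 < ζ.im)
    {α : Fin n → ℝ} (hα : α ∈ R) (x : Fin n → ℝ) :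
    0 < ((dotR α x : ℂ) + ζ * dotR α ξ).im := by
  rw [im_shift]; exact mul_pos hζ (hξ α hα)

lemma mem_slitPlane_shift {ξ : Fin n → ℝ} (hξ : ∀ α ∈ R, 0 < dotR α ξ) {ζ : ℂ} (hζ : 0 < ζ.im)
    {α : Fin n → ℝ} (hα : α ∈ R) (x : Fin n → ℝ) :
    ((dotR α x : ℂ) + ζ * dotR α ξ) ∈ Complex.slitPlane :=
  .inr (im_shift_pos hξ hζ hα x).ne'

lemma measurable_shiftedIntegrand (R : Finset (Fin n → ℝ)) (ξ : Fin n → ℝ) (k ζ : ℂ) :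
    Measurable (shiftedIntegrand R ξ k ζ) := by
  have h1 : ∀ α : Fin n → ℝ, Measurable fun x => dotR α x := fun α =>
    (continuous_dotR α).measurable
  have h2 := (continuous_dotR_self (n := n)).measurable
  have h3 : Measurable (logSum R ξ ζ) := by
    unfold logSum
    refine Finset.measurable_sum _ fun α _ => ?_
    have := h1 α
    fun_prop
  have h4 := h1 ξ
  unfold shiftedIntegrand
  fun_prop

lemma norm_shift_gauss (ξ : Fin n → ℝ) (ζ : ℂ) (x : Fin n → ℝ) :
    ‖Complex.exp (-(dotR x x + 2 * ζ * dotR ξ x + ζ ^ 2 * dotR ξ ξ) / 2)‖ =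
      Real.exp (-(dotR x x + 2 * ζ.re * dotR ξ x + (ζ.re ^ 2 - ζ.im ^ 2) * dotR ξ ξ) / 2) := by
  rw [Complex.norm_exp]
  congr 1
  have h : (-(dotR x x + 2 * ζ * dotR ξ x + ζ ^ 2 * dotR ξ ξ) / 2 : ℂ) =
      ((-(dotR x x + 2 * ζ.re * dotR ξ x + (ζ.re ^ 2 - ζ.im ^ 2) * dotR ξ ξ) / 2 : ℝ) : ℂ) +
      ((-(2 * ζ.im * dotR ξ x + 2 * ζ.re * ζ.im * dotR ξ ξ) / 2 : ℝ) : ℂ) * I := by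
    conv_lhs => rw [← Complex.re_add_im ζ]
    push_cast
    linear_combination (-(ζ.im : ℂ) ^ 2 * dotR ξ ξ / 2) * Complex.I_mul_I
  rw [h, Complex.add_re, Complex.ofReal_re, Complex.re_ofReal_mul, Complex.I_re, mul_zero, add_zero]

lemma exists_shifted_majorant {ξ : Fin n → ℝ} (hξ : ∀ α ∈ R, 0 < dotR α ξ) (K Z : ℝ) {δ : ℝ}
    (hδ : 0 < δ) : ∃ A B : ℝ, ∀ (k ζ : ℂ) (x : Fin n → ℝ), ‖k‖ ≤ K → ‖ζ‖ ≤ Z → δ ≤ ζ.im →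
      ‖shiftedIntegrand R ξ k ζ x‖ ≤ Real.exp (A + B * l1 x - 1 / 2 * dotR x x) := by
  set D := ∑ α ∈ R, (Z * dotR α ξ + |Real.log (δ * dotR α ξ)| + Real.pi)
  refine ⟨2 * K * D + Z ^ 2 * dotR ξ ξ, 2 * K * ∑ α ∈ R, l1 α + Z * l1 ξ,
    fun k ζ x hk hζ hi => ?_⟩
  have hK : 0 ≤ K := (norm_nonneg _).trans hk
  have hZ : 0 ≤ Z := (norm_nonneg _).trans hζ
  have h1 : ‖logSum R ξ ζ x‖ ≤ (∑ α ∈ R, l1 α) * l1 x + D := by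
    refine (norm_sum_le _ _).trans ?_
    have : ∀ α ∈ R, ‖Complex.log (dotR α x + ζ * dotR α ξ)‖ ≤
        |dotR α x| + (Z * dotR α ξ + |Real.log (δ * dotR α ξ)| + Real.pi) := fun α hα => by
      have a := norm_log_le (w := dotR α x + ζ * dotR α ξ) (mul_pos hδ (hξ α hα))
        (by rw [im_shift]; exact mul_le_mul_of_nonneg_right hi (hξ α hα).le)
      have b : ‖(dotR α x + ζ * dotR α ξ : ℂ)‖ ≤ |dotR α x| + Z * dotR α ξ := by
        refine (norm_add_le _ _).trans ?_
        rw [norm_mul, Complex.norm_real, Complex.norm_real, Real.norm_eq_abs, Real.norm_eq_abs,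
          abs_of_pos (hξ α hα)]
        have := mul_le_mul_of_nonneg_right hζ (hξ α hα).le
        linarith
      linarith
    refine (sum_le_sum this).trans ?_
    rw [sum_add_distrib]
    linarith [sum_abs_dotR_le R x]
  rw [shiftedIntegrand, norm_mul, norm_shift_gauss]
  have h2 : ‖Complex.exp (2 * k * logSum R ξ ζ x)‖ ≤
      Real.exp (2 * K * ((∑ α ∈ R, l1 α) * l1 x + D)) := by
    refine (Complex.norm_exp_le_exp_norm _).trans (Real.exp_le_exp.2 ?_)
    rw [norm_mul, norm_mul, Complex.norm_ofNat]
    exact mul_le_mul (by linarith) h1 (norm_nonneg _) (by linarith)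
  refine (mul_le_mul_of_nonneg_right h2 (Real.exp_pos _).le).trans ?_
  rw [← Real.exp_add]
  apply Real.exp_le_exp.2
  have h3 : -(ζ.re * dotR ξ x) ≤ Z * l1 ξ * l1 x := by
    refine (neg_le_abs _).trans ?_
    rw [abs_mul, mul_assoc]
    exact mul_le_mul ((Complex.abs_re_le_norm ζ).trans hζ) (abs_dotR_le ξ x) (abs_nonneg _) hZ
  have h4 : (ζ.im ^ 2 - ζ.re ^ 2) * dotR ξ ξ ≤ Z ^ 2 * dotR ξ ξ := by
    refine mul_le_mul_of_nonneg_right ?_ (dotR_self_nonneg ξ)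
    have := sq_le_sq' (by linarith [norm_nonneg ζ, (abs_le.1 ((Complex.abs_im_le_norm ζ).trans hζ)).1])
      (abs_le.1 ((Complex.abs_im_le_norm ζ).trans hζ)).2
    nlinarith [sq_nonneg ζ.re]
  have h5 : 0 ≤ Z ^ 2 * dotR ξ ξ := mul_nonneg (sq_nonneg _) (dotR_self_nonneg ξ)
  linarith

lemma differentiable_shifted_left {ξ : Fin n → ℝ} (hξ : ∀ α ∈ R, 0 < dotR α ξ) {ζ : ℂ}
    (hζ : 0 < ζ.im) : Differentiable ℂ fun k => shifted R ξ k ζ := by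
  intro k
  obtain ⟨A, B, h⟩ := exists_shifted_majorant hξ (‖k‖ + 1) ‖ζ‖ hζ
  unfold shifted
  refine DifferentiableAt.const_mul ?_ _
  refine differentiableAt_integral one_pos
    (fun z _ => (measurable_shiftedIntegrand R ξ z ζ).aestronglyMeasurable)
    (.of_forall fun x => ?_) (.of_forall fun x z hz => h z ζ x ?_ le_rfl le_rfl)
    (integrable_majorant A B (by norm_num))
  · unfold shiftedIntegrand
    fun_prop
  · have h1 := norm_add_le (z - k) k
    have h2 := mem_ball_iff_norm.1 hz
    rw [sub_add_cancel] at h1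
    linarith

lemma differentiableAt_shifted_right {ξ : Fin n → ℝ} (hξ : ∀ α ∈ R, 0 < dotR α ξ) (k : ℂ) {ζ : ℂ}
    (hζ : 0 < ζ.im) : DifferentiableAt ℂ (fun ζ => shifted R ξ k ζ) ζ := by
  obtain ⟨A, B, h⟩ := exists_shifted_majorant hξ ‖k‖ (‖ζ‖ + ζ.im) (half_pos hζ)
  have him : ∀ z ∈ Metric.ball ζ (ζ.im / 2), ζ.im / 2 ≤ z.im := fun z hz => by
    have h1 := (Complex.abs_im_le_norm (z - ζ)).trans (mem_ball_iff_norm.1 hz).le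
    rw [sub_im] at h1
    linarith [(abs_le.1 h1).1]
  unfold shifted
  refine DifferentiableAt.const_mul ?_ _
  refine differentiableAt_integral (half_pos hζ)
    (fun z _ => (measurable_shiftedIntegrand R ξ k z).aestronglyMeasurable)
    (.of_forall fun x z hz => ?_) (.of_forall fun x z hz => h k z x le_rfl ?_ (him z hz))
    (integrable_majorant A B (by norm_num))
  · refine DifferentiableAt.differentiableWithinAt ?_
    have hz' : 0 < z.im := by linarith [him z hz]
    have h1 : DifferentiableAt ℂ (fun ζ => logSum R ξ ζ x) z := by
      unfold logSum
      refine DifferentiableAt.fun_sum fun α hα => ?_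
      exact DifferentiableAt.clog (by fun_prop) (mem_slitPlane_shift hξ hz' hα x)
    unfold shiftedIntegrand
    fun_prop
  · have h1 := norm_add_le (z - ζ) ζ
    have h2 := mem_ball_iff_norm.1 hz
    rw [sub_add_cancel] at h1
    linarith

lemma shifted_add_real (ξ : Fin n → ℝ) (k ζ : ℂ) (r : ℝ) :
    shifted R ξ k (ζ + r) = shifted R ξ k ζ := by
  unfold shifted
  rw [← integral_add_right_eq_self (shiftedIntegrand R ξ k ζ) (r • ξ)]
  congr 2
  ext x
  have h1 : logSum R ξ (ζ + r) x = logSum R ξ ζ (x + r • ξ) := by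
    refine sum_congr rfl fun α _ => ?_
    rw [dotR_add, dotR_smul]
    push_cast; ring_nf
  rw [shiftedIntegrand, shiftedIntegrand, h1]
  simp only [dotR_add, dotR_smul, add_dotR, smul_dotR]
  rw [dotR_comm x ξ]
  push_cast
  ring_nf

lemma shifted_eq {ξ : Fin n → ℝ} (hξ : ∀ α ∈ R, 0 < dotR α ξ) (k : ℂ) {ζ ζ' : ℂ}
    (hζ : 0 < ζ.im) (hζ' : 0 < ζ'.im) : shifted R ξ k ζ = shifted R ξ k ζ' := by
  have hopen : IsOpen {z : ℂ | 0 < z.im} := isOpen_lt continuous_const Complex.continuous_im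
  refine hopen.is_const_of_deriv_eq_zero (convex_halfSpace_im_gt 0).isPreconnected
    (f := fun ζ => shifted R ξ k ζ)
    (fun z hz => (differentiableAt_shifted_right hξ k hz).differentiableWithinAt)
    (fun z hz => ?_) hζ hζ'
  have hd := (differentiableAt_shifted_right hξ k hz).hasDerivAt
  have h1 : HasDerivAt (fun w : ℂ => shifted R ξ k (z + w))
      (deriv (fun ζ => shifted R ξ k ζ) z) ((0 : ℝ) : ℂ) :=
    HasDerivAt.comp_const_add (f := fun ζ => shifted R ξ k ζ) z ((0 : ℝ) : ℂ) (by simpa using hd)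
  have h2 := h1.comp_ofReal
  simp only [shifted_add_real] at h2
  exact h2.unique (hasDerivAt_const _ _)

/-- Growth of the translated integral in the left half plane. -/
lemma norm_shifted_le {ξ : Fin n → ℝ} (h : IsCritical R ξ) {k : ℂ} (hk : k.re ≤ 0) :
    ‖shifted R ξ k I‖ ≤ Real.exp (2 * Real.pi * R.card * |k.im| -
      (R.card * (-k.re) * Real.log (1 - k.re) + (-k.re) * logMax R ξ) + R.card) := by
  set t := Real.sqrt (1 - k.re)
  have ht : 0 < t := Real.sqrt_pos.2 (by linarith)
  have htt : t ^ 2 = 1 - k.re := Real.sq_sqrt (by linarith)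
  rw [shifted_eq h.1 k (ζ := I) (ζ' := t * I) (by simp) (by simpa using ht)]
  set A := 2 * Real.pi * R.card * |k.im| -
      (R.card * (-k.re) * Real.log (1 - k.re) + (-k.re) * logMax R ξ) + R.card
  have hpt : ∀ x : Fin n → ℝ, ‖shiftedIntegrand R ξ k (t * I) x‖ ≤
      Real.exp A * Real.exp (-(1 / 2 * dotR x x)) := by
    intro x
    rw [shiftedIntegrand, norm_mul, norm_shift_gauss, Complex.norm_exp, ← Real.exp_add,
      ← Real.exp_add]
    apply Real.exp_le_exp.2
    have e1 : (2 * k * logSum R ξ (t * I) x).re = 2 * k.re * (logSum R ξ (t * I) x).re -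
        2 * k.im * (logSum R ξ (t * I) x).im := by simp
    have e2 : ∑ α ∈ R, (Real.log (1 - k.re) / 2 + Real.log (dotR α ξ)) ≤
        (logSum R ξ (t * I) x).re := by
      rw [logSum, Complex.re_sum]
      refine sum_le_sum fun α hα => ?_
      rw [Complex.log_re, ← Real.log_sqrt (by linarith), ← Real.log_mul ht.ne' (h.1 α hα).ne']
      refine Real.log_le_log (mul_pos ht (h.1 α hα)) ?_
      have h1 := Complex.abs_im_le_norm ((dotR α x : ℂ) + t * I * dotR α ξ)
      rw [im_shift] at h1
      refine le_trans (le_of_eq ?_) ((le_abs_self _).trans h1)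
      simp
    have e3 : |(logSum R ξ (t * I) x).im| ≤ R.card * Real.pi := by
      rw [logSum, Complex.im_sum, ← nsmul_eq_mul, ← sum_const]
      refine (abs_sum_le_sum_abs _ _).trans (sum_le_sum fun α _ => ?_)
      rw [Complex.log_im]
      exact Complex.abs_arg_le_pi _
    rw [sum_add_distrib, sum_const, nsmul_eq_mul] at e2
    have e4 := mul_le_mul_of_nonpos_left e2 (by linarith : 2 * k.re ≤ 0)
    have e5 : -(k.im * (logSum R ξ (t * I) x).im) ≤ |k.im| * (R.card * Real.pi) := by
      refine (neg_le_abs _).trans ?_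
      rw [abs_mul]
      exact mul_le_mul_of_nonneg_left e3 (abs_nonneg _)
    have e6 : ((t : ℂ) * I).re = 0 := by simp
    have e7 : ((t : ℂ) * I).im = t := by simp
    rw [e1, e6, e7, h.dotR_self]
    simp only [A, logMax]
    have e8 : ((0 : ℝ) ^ 2 - t ^ 2) * (2 * R.card) = -(1 - k.re) * (2 * R.card) := by
      rw [htt]; ring
    rw [e8]
    nlinarith
  have h1 := norm_integral_le_of_norm_le
    ((integrable_gauss (n := n) (s := 1 / 2) (by norm_num)).const_mul (Real.exp A)) (.of_forall hpt)
  rw [integral_const_mul] at h1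
  rw [shifted, norm_mul, Complex.norm_real, Real.norm_eq_abs, abs_of_pos gaussConst_pos]
  refine (mul_le_mul_of_nonneg_left h1 gaussConst_pos.le).trans (le_of_eq ?_)
  have h2 := gaussConst_mul_integral (n := n) one_pos
  rw [Real.sqrt_one, one_pow, inv_one] at h2
  linear_combination (Real.exp A) * h2

end

/-! ### Boundary values of the translated integral -/

section

variable {n : ℕ} {R : Finset (Fin n → ℝ)}

lemma RootSys.ae_regular (hR : RootSys R) : ∀ᵐ x : Fin n → ℝ, Regular R x := by
  simp only [Regular]
  rw [Filter.eventually_all_finset]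
  intro α hα
  have h : LinearMap.ker (dotL α) ≠ ⊤ := fun h => by
    have : α ∈ LinearMap.ker (dotL α) := h ▸ Submodule.mem_top
    rw [LinearMap.mem_ker, dotL_apply, hR.norm2 α hα] at this
    norm_num at this
  have := Measure.addHaar_submodule (volume : Measure (Fin n → ℝ)) _ h
  rw [ae_iff]
  convert this using 2
  ext x
  simp

/-- The boundary value from above of the logarithm on the real line. -/
noncomputable def boundaryLog (t : ℝ) : ℂ :=
  (Real.log |t| : ℂ) + if t < 0 then (Real.pi : ℂ) * I else 0

lemma tendsto_log_boundary {t : ℝ} (ht : t ≠ 0) {u : ℕ → ℂ}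
    (hu : Filter.Tendsto u Filter.atTop (nhds (t : ℂ))) (hi : ∀ m, 0 ≤ (u m).im) :
    Filter.Tendsto (fun m => Complex.log (u m)) Filter.atTop (nhds (boundaryLog t)) := by
  rcases ht.lt_or_gt with h | h
  · have h1 := Complex.continuousWithinAt_log_of_re_neg_of_im_zero (z := (t : ℂ)) (by simpa)
      (Complex.ofReal_im t)
    have h2 : Complex.log (t : ℂ) = boundaryLog t := by
      apply Complex.ext
      · simp [boundaryLog, h, Complex.log_re]
      · simp [boundaryLog, h, Complex.log_im, Complex.arg_ofReal_of_neg h]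
    rw [← h2]
    exact h1.tendsto.comp (tendsto_nhdsWithin_iff.2 ⟨hu, .of_forall hi⟩)
  · have h2 : Complex.log (t : ℂ) = boundaryLog t := by
      rw [boundaryLog, if_neg h.le.not_gt, add_zero, abs_of_pos h, Complex.ofReal_log h.le]
    rw [← h2]
    exact (continuousAt_clog (.inl (by simpa))).tendsto.comp hu

lemma exp_boundaryLog {k : ℂ} {x : Fin n → ℝ} (hx : Regular R x) :
    Complex.exp (2 * k * ∑ α ∈ R, boundaryLog (dotR α x)) =
      phi R k x * Complex.exp (2 * Real.pi * k * I) ^ neg R x := by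
  rw [mul_sum, Complex.exp_sum, phi, neg, ← prod_const, prod_filter, ← prod_mul_distrib]
  refine prod_congr rfl fun α hα => ?_
  rw [boundaryLog, mul_add, Complex.exp_add, Complex.cpow_def_of_ne_zero
    (by simpa using hx α hα), Complex.ofReal_log (abs_nonneg _), mul_comm (2 * k)]
  congr 1
  split_ifs
  · congr 1; ring
  · simp

lemma norm_exp_logSum_le {ξ : Fin n → ℝ} (hξ : ∀ α ∈ R, 0 < dotR α ξ) {k ζ : ℂ}
    (hk : 0 ≤ k.re) (hζ : ‖ζ‖ ≤ 1) (x : Fin n → ℝ) :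
    ‖Complex.exp (2 * k * logSum R ξ ζ x)‖ ≤
      Real.exp (2 * k.re * ((∑ α ∈ R, l1 α) * l1 x + ∑ α ∈ R, dotR α ξ) +
        2 * |k.im| * (R.card * Real.pi)) := by
  rw [Complex.norm_exp]
  apply Real.exp_le_exp.2
  have h1 : (logSum R ξ ζ x).re ≤ (∑ α ∈ R, l1 α) * l1 x + ∑ α ∈ R, dotR α ξ := by
    rw [logSum, Complex.re_sum]
    refine le_trans (sum_le_sum (g := fun α => |dotR α x| + dotR α ξ) fun α hα => ?_) ?_
    · rw [Complex.log_re]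
      refine (Real.log_le_self (norm_nonneg _)).trans ((norm_add_le _ _).trans ?_)
      rw [norm_mul, Complex.norm_real, Complex.norm_real, Real.norm_eq_abs, Real.norm_eq_abs,
          abs_of_pos (hξ α hα)]
      have := mul_le_mul_of_nonneg_right hζ (hξ α hα).le
      linarith
    · rw [sum_add_distrib]
      linarith [sum_abs_dotR_le R x]
  have h2 : |(logSum R ξ ζ x).im| ≤ R.card * Real.pi := by
    rw [logSum, Complex.im_sum]
    refine (abs_sum_le_sum_abs _ _).trans ?_
    rw [← nsmul_eq_mul]
    refine sum_le_card_nsmul _ _ _ fun α _ => ?_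
    rw [Complex.log_im]; exact Complex.abs_arg_le_pi _
  have h3 : (2 * k * logSum R ξ ζ x).re =
      2 * k.re * (logSum R ξ ζ x).re - 2 * (k.im * (logSum R ξ ζ x).im) := by
    simp [Complex.mul_re]; ring
  rw [h3]
  have h4 : -(k.im * (logSum R ξ ζ x).im) ≤ |k.im| * (R.card * Real.pi) := by
    refine (neg_le_abs _).trans ?_
    rw [abs_mul]; exact mul_le_mul_of_nonneg_left h2 (abs_nonneg _)
  have h5 := mul_le_mul_of_nonneg_left h1 (by linarith : 0 ≤ 2 * k.re)
  linarith

/-- The translated integral as an integral over the real space with boundary values. -/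
lemma RootSys.shifted_eq_boundary (hR : RootSys R) {ξ : Fin n → ℝ}
    (hξ : ∀ α ∈ R, 0 < dotR α ξ) {k : ℂ} (hk : 0 ≤ k.re) :
    shifted R ξ k I = gaussConst n * ∫ x : Fin n → ℝ,
      Complex.exp (2 * Real.pi * k * I) ^ neg R x *
        (phi R k x * Complex.exp (-(1 * (dotR x x : ℝ)) / 2)) := by
  set ζ : ℕ → ℂ := fun m => ((1 / ((m : ℝ) + 1) : ℝ) : ℂ) * I with hζ
  have him : ∀ m, (ζ m).im = 1 / ((m : ℝ) + 1) := fun m => by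
    rw [hζ]; simp only [Complex.im_ofReal_mul, Complex.I_im, mul_one]
  have hre : ∀ m, (ζ m).re = 0 := fun m => by
    rw [hζ]; simp only [Complex.re_ofReal_mul, Complex.I_re, mul_zero]
  have hpos : ∀ m, 0 < (ζ m).im := fun m => by rw [him]; positivity
  have hle : ∀ m, (ζ m).im ≤ 1 := fun m => by
    rw [him, div_le_one (by positivity)]
    have : (0 : ℝ) ≤ m := m.cast_nonneg
    linarith
  have hnorm : ∀ m, ‖ζ m‖ ≤ 1 := fun m => by
    refine (Complex.norm_le_abs_re_add_abs_im _).trans ?_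
    rw [hre, abs_zero, zero_add, abs_of_pos (hpos m)]; exact hle m
  have hlim : Filter.Tendsto ζ Filter.atTop (nhds 0) := by
    have h1 := (Complex.continuous_ofReal.tendsto 0).comp
      (tendsto_one_div_add_atTop_nhds_zero_nat (𝕜 := ℝ))
    have h2 := h1.mul_const I
    rw [Complex.ofReal_zero, zero_mul] at h2
    exact h2
  have hL : Filter.Tendsto (fun m => ∫ x, shiftedIntegrand R ξ k (ζ m) x) Filter.atTop
      (nhds (∫ x : Fin n → ℝ, Complex.exp (2 * Real.pi * k * I) ^ neg R x *
        (phi R k x * Complex.exp (-(1 * (dotR x x : ℝ)) / 2)))) := by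
    refine tendsto_integral_of_dominated_convergence
      (fun x => Real.exp ((2 * k.re * (∑ α ∈ R, dotR α ξ) + 2 * |k.im| * (R.card * Real.pi) +
        dotR ξ ξ / 2) + (2 * k.re * ∑ α ∈ R, l1 α) * l1 x - 1 / 2 * dotR x x))
      (fun m => (measurable_shiftedIntegrand R ξ k (ζ m)).aestronglyMeasurable)
      (integrable_majorant _ _ (by norm_num)) (fun m => .of_forall fun x => ?_) ?_
    · rw [shiftedIntegrand, norm_mul, norm_shift_gauss]
      refine (mul_le_mul_of_nonneg_right (norm_exp_logSum_le hξ hk (hnorm m) x)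
        (Real.exp_pos _).le).trans ?_
      rw [← Real.exp_add]
      apply Real.exp_le_exp.2
      rw [hre]
      have h1 : (ζ m).im ^ 2 ≤ 1 := pow_le_one₀ (hpos m).le (hle m)
      have h2 := mul_le_mul_of_nonneg_right h1 (dotR_self_nonneg ξ)
      linarith
    · filter_upwards [hR.ae_regular] with x hx
      rw [← mul_assoc, mul_comm (Complex.exp _ ^ _), ← exp_boundaryLog hx]
      refine Filter.Tendsto.mul ((Complex.continuous_exp.tendsto _).comp
        (Filter.Tendsto.const_mul _ (tendsto_finsetSum _ fun α hα => ?_))) ?_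
      · refine tendsto_log_boundary (hx α hα) ?_ fun m => (im_shift_pos hξ (hpos m) hα x).le
        have := (hlim.mul_const ((dotR α ξ : ℝ) : ℂ)).const_add ((dotR α x : ℝ) : ℂ)
        simpa using this
      · have hc : Continuous fun z : ℂ =>
            Complex.exp (-(dotR x x + 2 * z * dotR ξ x + z ^ 2 * dotR ξ ξ) / 2) := by fun_prop
        have := (hc.tendsto 0).comp hlim
        simpa [Function.comp_def] using this
  have hc : ∀ m, gaussConst n * ∫ x, shiftedIntegrand R ξ k (ζ m) x = shifted R ξ k I := fun m =>
    shifted_eq hξ k (hpos m) (by simp)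
  have h1 := hL.const_mul (gaussConst n : ℂ)
  simp only [hc] at h1
  exact tendsto_nhds_unique tendsto_const_nhds h1

lemma measurePreserving_of_dotR {e : (Fin n → ℝ) ≃ₗ[ℝ] (Fin n → ℝ)}
    (he : ∀ x y, dotR (e x) (e y) = dotR x y) : MeasurePreserving e := by
  have hd : |LinearMap.det e.toLinearMap| = 1 := by
    rw [det_eq he, abs_pow, abs_neg, abs_one, one_pow]
  have h0 : LinearMap.det e.toLinearMap ≠ 0 := fun h => by rw [h, abs_zero] at hd; norm_num at hd
  refine ⟨e.toLinearMap.continuous_of_finiteDimensional.measurable, ?_⟩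
  have := Real.map_linearMap_volume_pi_eq_smul_volume_pi h0
  rw [abs_inv, hd, inv_one, ENNReal.ofReal_one, one_smul] at this
  exact this

lemma integral_comp_of_dotR {e : (Fin n → ℝ) ≃ₗ[ℝ] (Fin n → ℝ)}
    (he : ∀ x y, dotR (e x) (e y) = dotR x y) (f : (Fin n → ℝ) → ℂ) :
    ∫ x, f (e x) = ∫ x, f x :=
  (measurePreserving_of_dotR he).integral_comp
    (e.toContinuousLinearEquiv.toHomeomorph.measurableEmbedding) f

lemma measurable_neg (R : Finset (Fin n → ℝ)) : Measurable (neg R) := by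
  have : neg R = fun x => ∑ α ∈ R, if dotR α x < 0 then 1 else 0 := by
    funext x; rw [neg, card_filter]
  rw [this]
  refine Finset.measurable_sum _ fun α _ => Measurable.ite ?_ measurable_const measurable_const
  exact measurableSet_lt (continuous_dotR α).measurable measurable_const

lemma norm_pow_neg_le (X : ℂ) (x : Fin n → ℝ) : ‖X ^ neg R x‖ ≤ max 1 ‖X‖ ^ R.card := by
  rw [norm_pow]
  refine (pow_le_pow_left₀ (norm_nonneg _) (le_max_right 1 _) _).trans
    (pow_le_pow_right₀ (le_max_left _ _) (card_filter_le _ _))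

/-- The boundary values are averaged over the group by means of the Poincaré polynomial. -/
lemma shifted_eq_poinc (C : CoxeterData n) {ξ : Fin n → ℝ} (hξ : ∀ α ∈ C.R, 0 < dotR α ξ) {k : ℂ}
    (hk : 0 ≤ k.re) : Complex.exp (-(Real.pi * k * I * C.R.card)) * shifted C.R ξ k I =
      poinc C k * mehta C.R k 1 := by
  have hR := C.rootSys
  set X := Complex.exp (2 * Real.pi * k * I) with hX
  set B : (Fin n → ℝ) → ℂ := fun x => phi C.R k x * Complex.exp (-(1 * (dotR x x : ℝ)) / 2)
    with hB
  have hBi : Integrable B := integrable_mehta C.R hk (by simp)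
  have hξr : Regular C.R ξ := fun α hα => (hξ α hα).ne'
  have hcard : ((elts C.R).card : ℂ) ≠ 0 := Nat.cast_ne_zero.2 hR.card_elts_pos.ne'
  have hBe : ∀ e ∈ elts C.R, ∀ x, B (e x) = B x := fun e he x => by
    rw [hR.mem_elts] at he
    simp only [hB, hR.phi_map he, hR.dotR_map he]
  have h1 : ∀ e ∈ elts C.R, ∫ x, X ^ neg C.R (e x) * B x = ∫ x, X ^ neg C.R x * B x := by
    intro e he
    rw [← integral_comp_of_dotR (hR.dotR_map (hR.mem_elts.1 he)) fun x => X ^ neg C.R x * B x]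
    simp only [hBe e he]
  have hint : ∀ e ∈ elts C.R, Integrable fun x => X ^ neg C.R (e x) * B x := by
    intro e he
    refine hBi.bdd_mul (c := max 1 ‖X‖ ^ C.R.card) ?_ (.of_forall fun x => norm_pow_neg_le X _)
    have : Measurable e := e.toLinearMap.continuous_of_finiteDimensional.measurable
    exact (((measurable_of_countable fun m : ℕ => X ^ m).comp (measurable_neg C.R)).comp
      this).aestronglyMeasurable
  have h2 : (elts C.R).card * ∫ x, X ^ neg C.R x * B x = orbSum C.R X ξ * ∫ x, B x := by
    rw [← nsmul_eq_mul, ← sum_const, ← sum_congr rfl h1, ← integral_finsetSum _ hint,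
      ← integral_const_mul]
    refine integral_congr_ae ?_
    filter_upwards [hR.ae_regular] with x hx
    rw [← sum_mul, ← hR.orbSum_eq X hx hξr, orbSum]
  rw [hR.shifted_eq_boundary hξ hk, poinc_eq C hξr, mehta]
  have h3 : ∫ x, X ^ neg C.R x * B x = orbSum C.R X ξ / (elts C.R).card * ∫ x, B x := by
    rw [div_mul_eq_mul_div, eq_div_iff hcard, mul_comm, h2]
  rw [← hX, h3]
  ring

end

/-! ### Comparison of both sides -/

section

variable {n : ℕ} {R : Finset (Fin n → ℝ)}

/-- An entire function of exponential type, bounded on the real axis and of type zero on the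
imaginary axis, is constant. -/
lemma eq_of_exponential_type {f : ℂ → ℂ} (hf : Differentiable ℂ f) {K c : ℝ}
    (hb : ∀ z, ‖f z‖ ≤ K * Real.exp (c * |z.im|))
    (hi : ∀ ε > 0, ∃ B, ∀ y : ℝ, ‖f (y * I)‖ ≤ B * Real.exp (ε * |y|)) (z w : ℂ) :
    f z = f w := by
  have hK : 0 ≤ K := by simpa using (norm_nonneg _).trans (hb 0)
  have key : ∀ s : ℝ, |s| = 1 → ∀ z : ℂ, 0 ≤ z.re → ‖f (s * I * z)‖ ≤ K := by
    intro s hs z hz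
    have h1 : ∀ ε > 0, ‖f (s * I * z)‖ * Real.exp (-(ε * z.re)) ≤ K := by
      intro ε hε
      set g : ℂ → ℂ := fun z => f (s * I * z) * Complex.exp (-(ε * z)) with hg
      have hgn : ∀ z, ‖g z‖ = ‖f (s * I * z)‖ * Real.exp (-(ε * z.re)) := fun z => by
        rw [hg, norm_mul, Complex.norm_exp, Complex.neg_re, Complex.re_ofReal_mul]
      rw [← hgn]
      refine PhragmenLindelof.right_half_plane_of_tendsto_zero_on_real ?_ ?_ ?_ ?_ hz
      · have : Differentiable ℂ g := by
          have := hf.comp (f := fun z => s * I * z) (by fun_prop)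
          exact this.mul (by fun_prop)
        exact this.diffContOnCl
      · refine ⟨1, by norm_num, |c|, Asymptotics.IsBigO.of_bound K ?_⟩
        rw [Filter.eventually_inf_principal]
        refine .of_forall fun z (hz : 0 < z.re) => ?_
        rw [hgn, Real.norm_of_nonneg (Real.exp_pos _).le, Real.rpow_one]
        have h2 : Real.exp (-(ε * z.re)) ≤ 1 := Real.exp_le_one_iff.2 (by
          have := mul_pos hε hz; linarith)
        have h3 : ‖f (s * I * z)‖ ≤ K * Real.exp (|c| * ‖z‖) := by
          refine (hb _).trans (mul_le_mul_of_nonneg_left (Real.exp_le_exp.2 ?_) hK)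
          have e : (s * I * z).im = s * z.re := by
            rw [mul_assoc, Complex.im_ofReal_mul, Complex.I_mul_im]
          rw [e, abs_mul, hs, one_mul]
          exact mul_le_mul (le_abs_self c) (Complex.abs_re_le_norm z) (abs_nonneg _) (abs_nonneg _)
        exact (mul_le_mul h3 h2 (Real.exp_pos _).le ((norm_nonneg _).trans h3)).trans
          (mul_one _).le
      · obtain ⟨B, hB⟩ := hi (ε / 2) (half_pos hε)
        have h2 : Filter.Tendsto (fun x : ℝ => B * Real.exp (-(ε / 2 * x))) Filter.atTop
            (nhds (B * 0)) :=
          (Real.tendsto_exp_neg_atTop_nhds_zero.comp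
            (Filter.tendsto_id.const_mul_atTop (half_pos hε))).const_mul B
        rw [mul_zero] at h2
        refine squeeze_zero_norm' ?_ h2
        filter_upwards [Filter.eventually_ge_atTop 0] with x hx
        have h3 := hB (s * x)
        rw [abs_mul, hs, one_mul, abs_of_nonneg hx] at h3
        rw [hgn, Complex.ofReal_re]
        have e : (s * I * x : ℂ) = ((s * x : ℝ) : ℂ) * I := by push_cast; ring
        rw [e]
        refine (mul_le_mul_of_nonneg_right h3 (Real.exp_pos _).le).trans (le_of_eq ?_)
        rw [mul_assoc, ← Real.exp_add]
        congr 2; ring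
      · intro x
        rw [hgn]
        have e : (s * I * (x * I) : ℂ) = ((-(s * x) : ℝ) : ℂ) := by
          push_cast; linear_combination (s * x : ℂ) * Complex.I_mul_I
        have := hb (s * I * (x * I))
        rw [e, Complex.ofReal_im, abs_zero, mul_zero, Real.exp_zero, mul_one] at this
        simpa [e] using this
    have h2 : Filter.Tendsto (fun ε : ℝ => ‖f (s * I * z)‖ * Real.exp (-(ε * z.re)))
        (nhdsWithin 0 (Set.Ioi 0)) (nhds (‖f (s * I * z)‖ * Real.exp (-(0 * z.re)))) := by
      have : Continuous fun ε : ℝ => ‖f (s * I * z)‖ * Real.exp (-(ε * z.re)) := by fun_prop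
      exact (this.tendsto 0).mono_left nhdsWithin_le_nhds
    have h3 := le_of_tendsto h2 (by filter_upwards [self_mem_nhdsWithin] with ε hε using h1 ε hε)
    simpa using h3
  have hbd : ∀ z, ‖f z‖ ≤ K := by
    intro z
    rcases le_total 0 z.im with h | h
    · have := key 1 (by simp) (-I * z) (by simpa using h)
      have e : ((1 : ℝ) : ℂ) * I * (-I * z) = z := by
        push_cast; linear_combination (-z) * Complex.I_mul_I
      rwa [e] at this
    · have := key (-1) (by simp) (I * z) (by simpa using h)
      have e : ((-1 : ℝ) : ℂ) * I * (I * z) = z := by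
        push_cast; linear_combination (-z) * Complex.I_mul_I
      rwa [e] at this
  refine hf.apply_eq_apply_of_bounded ?_ z w
  refine isBounded_iff_forall_norm_le.2 ⟨K, ?_⟩
  rintro _ ⟨z, rfl⟩
  exact hbd z

lemma mehta_zero (R : Finset (Fin n → ℝ)) : mehta R 0 1 = 1 := by
  have h := gaussConst_mul_integral (n := n) (s := 1) one_pos
  rw [Real.sqrt_one, one_pow, inv_one] at h
  have h2 : ∀ x : Fin n → ℝ, phi R 0 x * Complex.exp (-(1 * (dotR x x : ℝ)) / 2) =
      ((Real.exp (-(1 / 2 * dotR x x)) : ℝ) : ℂ) := fun x => by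
    simp only [phi, mul_zero, Complex.cpow_zero, prod_const_one, one_mul, Complex.ofReal_exp]
    push_cast
    congr 1; ring
  rw [mehta, integral_congr_ae (.of_forall h2), integral_complex_ofReal]
  exact_mod_cast h

lemma gammaProd_zero (C : CoxeterData n) : gammaProd C 0 = 1 := by
  simp [gammaProd]

/-- The expression of the quotient of both sides in the left half plane. -/
noncomputable def quotLeft (C : CoxeterData n) (ξ : Fin n → ℝ) (k : ℂ) : ℂ :=
  Complex.exp (-(Real.pi * k * I * C.R.card)) * shifted C.R ξ k I * gammaProd C (-k)

/-- The entire extension of the quotient of both sides of the Macdonald–Mehta formula. -/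
noncomputable def quot (C : CoxeterData n) (ξ : Fin n → ℝ) (k : ℂ) : ℂ :=
  if 0 < k.re then mehta C.R k 1 / gammaProd C k else quotLeft C ξ k

variable (C : CoxeterData n)

lemma quotLeft_eq {ξ : Fin n → ℝ} (hξ : ∀ α ∈ C.R, 0 < dotR α ξ) {k : ℂ} (hk : 0 ≤ k.re)
    (hk' : ∀ j, k.re * C.d j < 1) : quotLeft C ξ k = mehta C.R k 1 / gammaProd C k := by
  have h := gammaProd_reflection C (k := k) fun j => by rw [abs_of_nonneg hk]; exact hk' j
  have h0 : gammaProd C k ≠ 0 := fun h0 => by simp [h0] at h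
  rw [quotLeft, shifted_eq_poinc C hξ hk, eq_div_iff h0]
  linear_combination (mehta C.R k 1) * h

lemma quot_of_nonneg {ξ : Fin n → ℝ} (hξ : ∀ α ∈ C.R, 0 < dotR α ξ) {k : ℂ} (hk : 0 ≤ k.re) :
    quot C ξ k = mehta C.R k 1 / gammaProd C k := by
  rw [quot]
  split_ifs with h
  · rfl
  · have : k.re = 0 := le_antisymm (not_lt.1 h) hk
    exact quotLeft_eq C hξ hk fun j => by rw [this]; simp

lemma re_one_add_pos {k : ℂ} (hk : 0 ≤ k.re) (m : ℕ) : 0 < (1 + k * m).re := by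
  rw [Complex.add_re, Complex.one_re, Complex.mul_re, Complex.natCast_re, Complex.natCast_im,
    mul_zero, sub_zero]
  positivity

lemma gammaProd_ne_zero_of_nonneg {k : ℂ} (hk : 0 ≤ k.re) : gammaProd C k ≠ 0 :=
  gammaProd_ne_zero C (fun j => re_one_add_pos hk _) (by simpa using re_one_add_pos hk 1)

lemma differentiableAt_gammaProd_of_nonneg {k : ℂ} (hk : 0 ≤ k.re) :
    DifferentiableAt ℂ (gammaProd C) k :=
  differentiableAt_gammaProd C (fun j => re_one_add_pos hk _) (by simpa using re_one_add_pos hk 1)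

lemma differentiable_quot {ξ : Fin n → ℝ} (hξ : ∀ α ∈ C.R, 0 < dotR α ξ) :
    Differentiable ℂ (quot C ξ) := by
  intro k
  rcases lt_or_ge 0 k.re with hk | hk
  · have h1 : DifferentiableAt ℂ (fun k => mehta C.R k 1 / gammaProd C k) k :=
      (differentiableAt_mehta_left C.R hk).div (differentiableAt_gammaProd_of_nonneg C hk.le)
        (gammaProd_ne_zero_of_nonneg C hk.le)
    refine h1.congr_of_eventuallyEq ?_
    filter_upwards [(isOpen_lt continuous_const Complex.continuous_re).mem_nhds hk] with z hz
    exact if_pos hz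
  · have h1 : DifferentiableAt ℂ (quotLeft C ξ) k := by
      have h2 := differentiableAt_gammaProd_of_nonneg C (k := -k) (by simpa using hk)
      have h3 : DifferentiableAt ℂ (fun k => gammaProd C (-k)) k :=
        h2.comp k differentiableAt_id.neg
      have h4 := differentiable_shifted_left hξ (ζ := I) (by simp) k
      unfold quotLeft
      exact (DifferentiableAt.mul (by fun_prop) h4).mul h3
    refine h1.congr_of_eventuallyEq ?_
    have h2 : ∀ᶠ z : ℂ in nhds k, ∀ j, z.re * C.d j < 1 := by
      rw [Filter.eventually_all]
      intro j
      refine (isOpen_lt (by fun_prop : Continuous fun z : ℂ => z.re * C.d j)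
        continuous_const).mem_nhds ?_
      have : k.re * C.d j ≤ 0 := mul_nonpos_of_nonpos_of_nonneg hk (Nat.cast_nonneg _)
      exact this.trans_lt one_pos
    filter_upwards [h2] with z hz
    rw [quot]
    split_ifs with h
    · exact (quotLeft_eq C hξ h.le hz).symm
    · rfl

lemma exists_norm_quot_le {ξ : Fin n → ℝ} (h : IsCritical C.R ξ) :
    ∃ a K c : ℝ, ∀ k, ‖quot C ξ k‖ ≤ K * Real.exp (c * |k.im|) * Real.exp (a * k.re) := by
  obtain ⟨b, B, hB⟩ := exists_log_gammaProd_bound C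
  have hlow : ∀ x, 0 ≤ x → Real.exp (C.R.card * x * Real.log (1 + x) + x * b - B) ≤
      gammaProdReal C x := fun x hx => by
    rw [← Real.exp_log (gammaProdReal_pos C hx)]
    exact Real.exp_le_exp.2 (by linarith [(abs_le.1 (hB x hx)).1])
  have hup : ∀ x, 0 ≤ x → gammaProdReal C x ≤
      Real.exp (C.R.card * x * Real.log (1 + x) + x * b + B) := fun x hx => by
    rw [← Real.exp_log (gammaProdReal_pos C hx)]
    exact Real.exp_le_exp.2 (by linarith [(abs_le.1 (hB x hx)).2])
  set N : ℝ := (C.R.card : ℝ)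
  have hN : 0 ≤ N := Nat.cast_nonneg _
  set W : ℝ := ((elts C.R).card : ℝ)
  have hW : 0 ≤ W := Nat.cast_nonneg _
  set c := 3 * Real.pi * N + gammaType C
  have hpi := Real.pi_pos
  refine ⟨logMax C.R ξ - b, W * Real.exp B + Real.exp (N + B), c, fun k => ?_⟩
  have hNy : 0 ≤ Real.pi * N * |k.im| := by positivity
  rw [add_mul, add_mul]
  rw [quot]
  split_ifs with hk
  · refine le_add_of_le_of_nonneg ?_ (by positivity)
    have hg := (norm_gammaProd_bounds C hk.le k.im).2
    rw [Complex.re_add_im] at hg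
    have hg0 : 0 < ‖gammaProd C k‖ := norm_pos_iff.2 (gammaProd_ne_zero_of_nonneg C hk.le)
    rw [norm_div, div_le_iff₀ hg0]
    refine (C.rootSys.norm_mehta_le h hk).trans ?_
    have h1 := (hlow _ hk.le).trans hg
    have h2 : N * k.re * Real.log k.re ≤ N * k.re * Real.log (1 + k.re) :=
      mul_le_mul_of_nonneg_left (Real.log_le_log hk (by linarith)) (by positivity)
    calc W * Real.exp (N * k.re * Real.log k.re + k.re * logMax C.R ξ)
        ≤ W * (Real.exp (B + (3 * Real.pi * N) * |k.im| + (logMax C.R ξ - b) * k.re) *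
            Real.exp (N * k.re * Real.log (1 + k.re) + k.re * b - B)) := by
          refine mul_le_mul_of_nonneg_left ?_ hW
          rw [← Real.exp_add]
          exact Real.exp_le_exp.2 (by linarith)
      _ ≤ W * (Real.exp (B + (3 * Real.pi * N) * |k.im| + (logMax C.R ξ - b) * k.re) *
            (‖gammaProd C k‖ * Real.exp (gammaType C * |k.im|))) := by gcongr
      _ = _ := by
          rw [show c * |k.im| = (3 * Real.pi * N) * |k.im| + gammaType C * |k.im| by ring,
            Real.exp_add, Real.exp_add, Real.exp_add]
          ring
  · refine le_add_of_nonneg_of_le (by positivity) ?_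
    rw [not_lt] at hk
    have hk' : 0 ≤ -k.re := by linarith
    have hg := (norm_gammaProd_bounds C hk' (-k.im)).1
    have e : (((-k.re : ℝ) : ℂ) + ((-k.im : ℝ) : ℂ) * I) = -k := by
      conv_rhs => rw [← Complex.re_add_im k]
      push_cast; ring
    rw [e, abs_neg] at hg
    have h1 : ‖Complex.exp (-(Real.pi * k * I * C.R.card))‖ ≤ Real.exp (Real.pi * N * |k.im|) := by
      rw [Complex.norm_exp]
      apply Real.exp_le_exp.2
      have : (-(Real.pi * k * I * C.R.card) : ℂ) = ((Real.pi * N : ℝ) : ℂ) * (-(k * I)) := by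
        simp only [N]; push_cast; ring
      rw [this, Complex.re_ofReal_mul, Complex.neg_re, Complex.mul_I_re, neg_neg]
      exact mul_le_mul_of_nonneg_left (le_abs_self _) (by positivity)
    have h2 := norm_shifted_le h hk
    have h3 := hg.trans (mul_le_mul_of_nonneg_right (hup _ hk') (Real.exp_pos _).le)
    rw [quotLeft, norm_mul, norm_mul]
    refine (mul_le_mul (mul_le_mul h1 h2 (norm_nonneg _) (Real.exp_pos _).le) h3 (norm_nonneg _)
      (by positivity)).trans (le_of_eq ?_)
    simp only [← Real.exp_add]
    congr 1
    rw [← sub_eq_add_neg]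
    ring

lemma exists_norm_quot_imag_le {ξ : Fin n → ℝ} (hξ : ∀ α ∈ C.R, 0 < dotR α ξ) {ε : ℝ}
    (hε : 0 < ε) : ∃ B, ∀ y : ℝ, ‖quot C ξ (y * I)‖ ≤ B * Real.exp (ε * |y|) := by
  set N : ℝ := (C.R.card : ℝ)
  have hN : 0 ≤ N := Nat.cast_nonneg _
  set t := min (ε / (N + 1)) 1
  have ht : 0 < t := lt_min (by positivity) one_pos
  have htN : N * t ≤ ε := by
    have h1 : t ≤ ε / (N + 1) := min_le_left _ _
    rw [le_div_iff₀ (by positivity)] at h1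
    nlinarith
  obtain ⟨B, hB⟩ := norm_mehta_imag_le C.R (θ := Real.pi / 2 - t)
    (by have := Real.pi_gt_three; have : t ≤ 1 := min_le_right _ _; linarith) (by linarith)
  have hB0 : 0 ≤ B := by simpa using (norm_nonneg _).trans (hB 0)
  refine ⟨B, fun y => ?_⟩
  rw [quot_of_nonneg C hξ (by simp), div_eq_mul_inv, norm_mul]
  refine (mul_le_mul (hB y) (norm_inv_gammaProd_le C y) (norm_nonneg _) (by positivity)).trans ?_
  rw [mul_assoc, ← Real.exp_add]
  refine mul_le_mul_of_nonneg_left (Real.exp_le_exp.2 ?_) hB0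
  have := mul_le_mul_of_nonneg_right htN (abs_nonneg y)
  linarith

/-- The Macdonald–Mehta formula up to an exponential factor. -/
lemma exists_mehta_eq : ∃ a : ℝ, ∀ k : ℂ, 0 ≤ k.re →
    mehta C.R k 1 = gammaProd C k * Complex.exp (a * k) := by
  obtain ⟨ξ, h⟩ := C.rootSys.exists_isCritical
  have hξ := h.1
  obtain ⟨a, K, c, hK⟩ := exists_norm_quot_le C h
  have hen : ∀ k : ℂ, ‖Complex.exp (-(a * k))‖ = Real.exp (-(a * k.re)) := fun k => by
    rw [Complex.norm_exp, Complex.neg_re, Complex.re_ofReal_mul]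
  have hconst := eq_of_exponential_type (f := fun k => quot C ξ k * Complex.exp (-(a * k)))
    (K := K) (c := c) ((differentiable_quot C hξ).mul (by fun_prop)) (fun k => by
      rw [norm_mul, hen]
      refine (mul_le_mul_of_nonneg_right (hK k) (Real.exp_pos _).le).trans (le_of_eq ?_)
      rw [mul_assoc, ← Real.exp_add, add_neg_cancel, Real.exp_zero, mul_one]) (fun ε hε => by
      obtain ⟨B, hB⟩ := exists_norm_quot_imag_le C hξ hε
      refine ⟨B, fun y => ?_⟩
      rw [norm_mul, hen]
      simpa using hB y)
  refine ⟨a, fun k hk => ?_⟩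
  have h1 := hconst k 0
  rw [quot_of_nonneg C hξ hk, quot_of_nonneg C hξ (k := 0) (by simp), mehta_zero, gammaProd_zero,
    mul_zero, neg_zero, Complex.exp_zero, div_one, mul_one, Complex.exp_neg] at h1
  have h2 := gammaProd_ne_zero_of_nonneg C hk
  have h3 := Complex.exp_ne_zero (a * k)
  field_simp at h1
  exact h1

end

/-! ### Gaussian moments -/

section

variable {n : ℕ} {R : Finset (Fin n → ℝ)}

lemma dotR_refl {β : Fin n → ℝ} (h : dotR β β = 2) (x y : Fin n → ℝ) :
    dotR (refl β h x) (refl β h y) = dotR x y := by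
  simp only [refl_apply, sub_dotR, dotR_sub, smul_dotR, dotR_smul, h, dotR_comm x β]
  ring

/-- Vectors of the same length are exchanged by an orthogonal map. -/
lemma exists_orthogonal {α u : Fin n → ℝ} (h : dotR α α = dotR u u) :
    ∃ e : (Fin n → ℝ) ≃ₗ[ℝ] (Fin n → ℝ), (∀ x y, dotR (e x) (e y) = dotR x y) ∧ e u = α := by
  by_cases hv : α - u = 0
  · exact ⟨LinearEquiv.refl ℝ _, fun _ _ => rfl, (sub_eq_zero.1 hv).symm⟩
  set v := α - u with hvdef
  have hvv : 0 < dotR v v := lt_of_le_of_ne (dotR_self_nonneg v) fun h0 =>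
    hv (dotR_self_eq_zero.1 h0.symm)
  have hvu : 2 * dotR v u = -dotR v v := by
    simp only [hvdef, sub_dotR, dotR_sub, dotR_comm u α]
    linarith
  set c := Real.sqrt (2 / dotR v v)
  have hc : c * c = 2 / dotR v v := Real.mul_self_sqrt (by positivity)
  have hβ : dotR (c • v) (c • v) = 2 := by
    rw [smul_dotR, dotR_smul, ← mul_assoc, hc]
    field_simp
  refine ⟨refl (c • v) hβ, dotR_refl hβ, ?_⟩
  have h1 : c * dotR v u * c = -1 := by
    rw [mul_right_comm, hc]
    field_simp
    linarith
  rw [refl_apply, smul_dotR, smul_smul, h1, hvdef]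
  module

/-- The Gaussian density. -/
noncomputable def gaussDensity (n : ℕ) (x : Fin n → ℝ) : ℝ :=
  gaussConst n * Real.exp (-(1 / 2 * dotR x x))

/-- The density of the one-dimensional Gaussian. -/
noncomputable def gaussDensityOne (t : ℝ) : ℝ :=
  (Real.sqrt (2 * Real.pi))⁻¹ * Real.exp (-(1 / 2 * t ^ 2))

lemma gaussDensity_eq_prod (x : Fin n → ℝ) : gaussDensity n x = ∏ i, gaussDensityOne (x i) := by
  simp only [gaussDensity, gaussDensityOne, gaussConst, prod_mul_distrib, prod_const, card_univ,
    Fintype.card_fin, inv_pow, ← Real.exp_sum, dotR_self_eq, mul_sum, sum_neg_distrib]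

lemma integral_gaussDensityOne : ∫ t, gaussDensityOne t = 1 := by
  have := integral_gaussian (1 / 2)
  simp only [gaussDensityOne, integral_const_mul]
  simp only [neg_mul] at this
  rw [this, show Real.pi / (1 / 2) = 2 * Real.pi by ring]
  exact inv_mul_cancel₀ (by positivity)

lemma integrable_gaussDensityOne : Integrable gaussDensityOne :=
  .of_integral_ne_zero (by rw [integral_gaussDensityOne]; norm_num)

lemma gaussDensity_map {e : (Fin n → ℝ) ≃ₗ[ℝ] (Fin n → ℝ)}
    (he : ∀ x y, dotR (e x) (e y) = dotR x y) (x : Fin n → ℝ) :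
    gaussDensity n (e x) = gaussDensity n x := by
  simp only [gaussDensity, he]

/-- The law of a linear form under the Gaussian measure. -/
lemma integral_comp_dotR {α : Fin n → ℝ} (hα : dotR α α = 2) {f : ℝ → ℝ}
    (hf : Integrable fun t => f (Real.sqrt 2 * t) * gaussDensityOne t) :
    (Integrable fun x => f (dotR α x) * gaussDensity n x) ∧
    ∫ x, f (dotR α x) * gaussDensity n x = ∫ t, f (Real.sqrt 2 * t) * gaussDensityOne t := by
  classical
  obtain ⟨i⟩ : Nonempty (Fin n) := by
    by_contra h
    rw [not_nonempty_iff] at h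
    simp [dotR] at hα
  set u : Fin n → ℝ := Pi.single i (Real.sqrt 2) with hu
  have hux : ∀ x, dotR u x = Real.sqrt 2 * x i := fun x => by
    rw [dotR, sum_eq_single i (fun j _ hj => by rw [hu, Pi.single_eq_of_ne hj, zero_mul])
      (fun h => absurd (mem_univ i) h), hu, Pi.single_eq_same]
  have huu : dotR u u = 2 := by
    rw [hux, hu, Pi.single_eq_same, Real.mul_self_sqrt (by norm_num)]
  obtain ⟨e, he, heu⟩ := exists_orthogonal (hα.trans huu.symm)
  have hcomp : ∀ x, f (dotR α (e x)) * gaussDensity n (e x) =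
      ∏ j, (if j = i then fun t => f (Real.sqrt 2 * t) * gaussDensityOne t
        else gaussDensityOne) (x j) := fun x => by
    rw [gaussDensity_map he, ← heu, he, hux, gaussDensity_eq_prod, ← mul_prod_erase _ _ (mem_univ i),
      ← mul_prod_erase (s := univ) (a := i) _ (mem_univ i), if_pos rfl, mul_assoc]
    congr 2
    exact prod_congr rfl fun j hj => by rw [if_neg (ne_of_mem_erase hj)]
  have hint : Integrable fun x : Fin n → ℝ => ∏ j, (if j = i then
      fun t => f (Real.sqrt 2 * t) * gaussDensityOne t else gaussDensityOne) (x j) := by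
    refine Integrable.fintype_prod (f := fun j => if j = i then
      fun t => f (Real.sqrt 2 * t) * gaussDensityOne t else gaussDensityOne) fun j => ?_
    dsimp only
    split_ifs
    · exact hf
    · exact integrable_gaussDensityOne
  have hmp := measurePreserving_of_dotR he
  have hemb : MeasurableEmbedding e := e.toContinuousLinearEquiv.toHomeomorph.measurableEmbedding
  constructor
  · rw [← hmp.integrable_comp_emb hemb]
    exact hint.congr (.of_forall fun x => (hcomp x).symm)
  · rw [← hmp.integral_comp hemb fun x => f (dotR α x) * gaussDensity n x]
    simp only [hcomp]
    rw [integral_fintype_prod_volume_eq_prod fun j => if j = i then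
      fun t => f (Real.sqrt 2 * t) * gaussDensityOne t else gaussDensityOne,
      ← mul_prod_erase _ _ (mem_univ i), if_pos rfl]
    rw [prod_eq_one fun j hj => by rw [if_neg (ne_of_mem_erase hj), integral_gaussDensityOne],
      mul_one]

/-- The absolute moments of a Gaussian variable of variance two. -/
noncomputable def momentFun (s : ℝ) : ℝ := Real.Gamma (1 + 2 * s) / Real.Gamma (1 + s)

lemma momentFun_pos {s : ℝ} (hs : -(1 / 2) < s) : 0 < momentFun s :=
  div_pos (Real.Gamma_pos_of_pos (by linarith)) (Real.Gamma_pos_of_pos (by linarith))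

lemma integral_moment {s : ℝ} (hs : -(1 / 2) < s) :
    ∫ t, |Real.sqrt 2 * t| ^ (2 * s) * gaussDensityOne t = momentFun s := by
  have h2 : (0 : ℝ) < 2 := two_pos
  have hpi := Real.pi_pos
  have h1 : ∀ t : ℝ, |Real.sqrt 2 * t| ^ (2 * s) * gaussDensityOne t =
      (2 ^ s * (Real.sqrt (2 * Real.pi))⁻¹) *
        (fun u : ℝ => u ^ (2 * s) * Real.exp (-(1 / 2) * u ^ (2 : ℝ))) |t| := fun t => by
    rw [gaussDensityOne, abs_mul, abs_of_pos (Real.sqrt_pos.2 h2), Real.mul_rpow (by positivity)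
      (abs_nonneg t), Real.rpow_mul (Real.sqrt_nonneg 2), Real.rpow_two, Real.sq_sqrt h2.le]
    simp only [Real.rpow_two, sq_abs, neg_mul]
    ring
  simp only [h1]
  rw [integral_const_mul, integral_comp_abs
    (f := fun u : ℝ => u ^ (2 * s) * Real.exp (-(1 / 2) * u ^ (2 : ℝ))),
    integral_rpow_mul_exp_neg_mul_rpow h2 (by linarith) (by norm_num)]
  have h3 := Real.Gamma_mul_Gamma_add_half (s + 1 / 2)
  have hG : Real.Gamma (1 + s) ≠ 0 := (Real.Gamma_pos_of_pos (by linarith)).ne'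
  rw [show s + 1 / 2 + 1 / 2 = 1 + s by ring, show 2 * (s + 1 / 2) = 1 + 2 * s by ring,
    show 1 - (1 + 2 * s) = -(2 * s) by ring] at h3
  rw [momentFun, eq_div_iff hG, show (2 * s + 1) / 2 = s + 1 / 2 by ring, one_div (2 : ℝ),
    Real.inv_rpow h2.le, ← Real.rpow_neg h2.le, show -(-(2 * s + 1) / 2) = s + 1 / 2 by ring,
    Real.sqrt_mul h2.le, Real.rpow_add h2, ← Real.sqrt_eq_rpow]
  have e1 : (2 : ℝ) ^ s * 2 ^ s * 2 ^ (-(2 * s)) = 1 := by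
    rw [← Real.rpow_add h2, ← Real.rpow_add h2]
    convert Real.rpow_zero (2 : ℝ) using 2; ring
  have e2 : Real.sqrt 2 ≠ 0 := by positivity
  have e3 : Real.sqrt Real.pi ≠ 0 := by positivity
  rw [show s + 2⁻¹ = s + 1 / 2 by norm_num]
  generalize Real.Gamma (s + 1 / 2) = G at h3 ⊢
  field_simp
  linear_combination (2 ^ s * 2 ^ s) * h3 + Real.Gamma (1 + 2 * s) * Real.sqrt Real.pi * e1

lemma integrable_moment {s : ℝ} (hs : -(1 / 2) < s) :
    Integrable fun t => |Real.sqrt 2 * t| ^ (2 * s) * gaussDensityOne t :=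
  .of_integral_ne_zero (by rw [integral_moment hs]; exact (momentFun_pos hs).ne')

end

/-! ### Determination of the exponential factor -/

section

variable {n : ℕ} {R : Finset (Fin n → ℝ)}

lemma rpow_abs_eq {t : ℝ} (ht : t ≠ 0) (s : ℝ) : |t| ^ (2 * s) = Real.exp (s * (2 * Real.log |t|)) := by
  rw [Real.rpow_def_of_pos (abs_pos.2 ht)]
  congr 1; ring

lemma one_add_log_le {t : ℝ} (ht : t ≠ 0) (s : ℝ) : 1 + s * (2 * Real.log |t|) ≤ |t| ^ (2 * s) := by
  rw [rpow_abs_eq ht, add_comm]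
  exact Real.add_one_le_exp _

lemma ae_sqrt_two_mul_ne_zero : ∀ᵐ t : ℝ, Real.sqrt 2 * t ≠ 0 := by
  filter_upwards [Measure.ae_ne volume (0 : ℝ)] with t ht
  exact mul_ne_zero (by positivity) ht

lemma gaussDensityOne_pos (t : ℝ) : 0 < gaussDensityOne t := by
  unfold gaussDensityOne; positivity

lemma gaussDensity_pos (x : Fin n → ℝ) : 0 < gaussDensity n x :=
  mul_pos gaussConst_pos (Real.exp_pos _)

lemma integrable_log : Integrable fun t => 2 * Real.log |Real.sqrt 2 * t| * gaussDensityOne t := by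
  have h1 := integrable_moment (s := 1 / 4) (by norm_num)
  have h2 := integrable_moment (s := -(1 / 4)) (by norm_num)
  refine ((h1.add h2).const_mul 4).mono' ?_ ?_
  · have : Measurable gaussDensityOne := by unfold gaussDensityOne; fun_prop
    have h3 : Measurable fun t : ℝ => |Real.sqrt 2 * t| := by fun_prop
    exact ((h3.log.const_mul 2).mul this).aestronglyMeasurable
  · filter_upwards [ae_sqrt_two_mul_ne_zero] with t ht
    have h3 := one_add_log_le ht (1 / 4)
    have h4 := one_add_log_le ht (-(1 / 4))
    have h5 : (0 : ℝ) ≤ |Real.sqrt 2 * t| ^ (2 * (1 / 4 : ℝ)) := by positivity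
    have h6 : (0 : ℝ) ≤ |Real.sqrt 2 * t| ^ (2 * (-(1 / 4) : ℝ)) := by positivity
    rw [norm_mul, Real.norm_eq_abs, Real.norm_of_nonneg (gaussDensityOne_pos t).le]
    simp only [Pi.add_apply]
    rw [← add_mul, ← mul_assoc]
    refine mul_le_mul_of_nonneg_right (abs_le.2 ⟨?_, ?_⟩) (gaussDensityOne_pos t).le <;> linarith

/-- The logarithmic moment of a Gaussian variable of variance two. -/
noncomputable def logMoment : ℝ := ∫ t, 2 * Real.log |Real.sqrt 2 * t| * gaussDensityOne t

lemma one_add_logMoment_le {s : ℝ} (hs : -(1 / 2) < s) : 1 + s * logMoment ≤ momentFun s := by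
  rw [← integral_moment hs, logMoment, ← integral_const_mul, ← integral_gaussDensityOne,
    ← integral_add integrable_gaussDensityOne (integrable_log.const_mul s)]
  refine integral_mono_ae (integrable_gaussDensityOne.add (integrable_log.const_mul s))
    (integrable_moment hs) ?_
  filter_upwards [ae_sqrt_two_mul_ne_zero] with t ht
  have := mul_le_mul_of_nonneg_right (one_add_log_le ht s) (gaussDensityOne_pos t).le
  linarith

lemma momentFun_zero : momentFun 0 = 1 := by simp [momentFun]

lemma hasDerivAt_Gamma_one : HasDerivAt Real.Gamma (deriv Real.Gamma 1) 1 :=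
  (Real.differentiableAt_Gamma fun m h => by
    have : (0 : ℝ) ≤ m := m.cast_nonneg
    linarith).hasDerivAt

lemma hasDerivAt_Gamma_ratio (c : ℝ) :
    HasDerivAt (fun s => Real.Gamma (1 + s * c) / Real.Gamma (1 + s))
      ((c - 1) * deriv Real.Gamma 1) 0 := by
  have h : ∀ c : ℝ, HasDerivAt (fun s : ℝ => Real.Gamma (1 + s * c)) (deriv Real.Gamma 1 * c) 0 := by
    intro c
    have h1 : HasDerivAt (fun s : ℝ => 1 + s * c) c 0 := by
      simpa using ((hasDerivAt_id (0 : ℝ)).mul_const c).const_add 1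
    exact HasDerivAt.comp (h₂ := Real.Gamma) 0 (by simpa using hasDerivAt_Gamma_one) h1
  have h1 : HasDerivAt (fun s : ℝ => Real.Gamma (1 + s)) (deriv Real.Gamma 1) 0 := by
    simpa using h 1
  have h2 := (h c).fun_div h1 (by simp)
  refine h2.congr_deriv ?_
  simp only [zero_mul, add_zero, Real.Gamma_one]
  ring

lemma hasDerivAt_momentFun : HasDerivAt momentFun (deriv Real.Gamma 1) 0 := by
  have := hasDerivAt_Gamma_ratio 2
  convert this using 1
  · funext s; rw [momentFun, mul_comm]
  · ring

lemma logMoment_eq : logMoment = deriv Real.Gamma 1 := by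
  have h1 : HasDerivAt (fun s => momentFun s - (1 + s * logMoment))
      (deriv Real.Gamma 1 - logMoment) 0 := by
    simpa using hasDerivAt_momentFun.fun_sub
      (((hasDerivAt_id (0 : ℝ)).mul_const logMoment).const_add 1)
  have h2 : IsLocalMin (fun s => momentFun s - (1 + s * logMoment)) 0 := by
    filter_upwards [lt_mem_nhds (show -(1 / 2 : ℝ) < 0 by norm_num)] with s hs
    have := one_add_logMoment_le hs
    rw [momentFun_zero]
    linarith
  have := h2.hasDerivAt_eq_zero h1
  linarith

lemma hasDerivAt_gammaProdReal (C : CoxeterData n) :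
    HasDerivAt (gammaProdReal C) (C.R.card * deriv Real.Gamma 1) 0 := by
  have h := HasDerivAt.fun_finsetProd (u := univ) fun (j : Fin n) _ =>
    hasDerivAt_Gamma_ratio (C.d j : ℝ)
  have e : ∑ j, (∏ i ∈ univ.erase j, Real.Gamma (1 + (0 : ℝ) * (C.d i)) / Real.Gamma (1 + 0)) •
      (((C.d j : ℝ) - 1) * deriv Real.Gamma 1) = C.R.card * deriv Real.Gamma 1 := by
    rw [← sum_d_cast, sum_mul]
    refine sum_congr rfl fun j _ => ?_
    rw [prod_eq_one fun i _ => by simp, one_smul]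
  rw [← e]
  exact h

lemma gammaProdReal_zero (C : CoxeterData n) : gammaProdReal C 0 = 1 := by
  simp [gammaProdReal]

lemma deriv_nonneg_of_nonneg_right {f : ℝ → ℝ} {f' : ℝ} (hf : HasDerivAt f f' 0) (h0 : f 0 = 0)
    (h : ∀ x > 0, 0 ≤ f x) : 0 ≤ f' := by
  have h1 : Filter.Tendsto (slope f 0) (nhdsWithin 0 (Set.Ioi 0)) (nhds f') :=
    (hasDerivAt_iff_tendsto_slope.1 hf).mono_left
      (nhdsWithin_mono 0 fun x (hx : 0 < x) => hx.ne')
  refine ge_of_tendsto h1 ?_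
  filter_upwards [self_mem_nhdsWithin] with x hx
  rw [slope_def_field, h0, sub_zero, sub_zero]
  exact div_nonneg (h x hx) (le_of_lt hx)

/-- The integrand of the real Macdonald–Mehta integral. -/
noncomputable def realIntegrand (R : Finset (Fin n → ℝ)) (k : ℝ) (x : Fin n → ℝ) : ℝ :=
  (∏ α ∈ R, |dotR α x| ^ (2 * k)) * gaussDensity n x

lemma ofReal_realIntegrand (R : Finset (Fin n → ℝ)) (k : ℝ) (x : Fin n → ℝ) :
    (realIntegrand R k x : ℂ) =
      gaussConst n * (phi R k x * Complex.exp (-(1 * (dotR x x : ℝ)) / 2)) := by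
  rw [realIntegrand, gaussDensity, phi]
  push_cast
  have : ∀ α ∈ R, ((|dotR α x| ^ (2 * k) : ℝ) : ℂ) = (|dotR α x| : ℝ) ^ (2 * (k : ℂ)) :=
    fun α _ => by rw [Complex.ofReal_cpow (abs_nonneg _)]; push_cast; rfl
  rw [prod_congr rfl this, show (-(1 / 2 * (dotR x x : ℂ))) = -(1 * (dotR x x : ℂ)) / 2 by ring]
  ring

lemma integrable_realIntegrand (R : Finset (Fin n → ℝ)) {k : ℝ} (hk : 0 ≤ k) :
    Integrable (realIntegrand R k) := by
  have h := (integrable_mehta R (k := k) (s := 1) (by simpa) (by simp)).const_mul (gaussConst n : ℂ)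
  refine h.re.congr (.of_forall fun x => ?_)
  simp only [← ofReal_realIntegrand]
  exact Complex.ofReal_re _

lemma mehta_ofReal_left (R : Finset (Fin n → ℝ)) (k : ℝ) :
    mehta R k 1 = ((∫ x, realIntegrand R k x : ℝ) : ℂ) := by
  rw [← integral_complex_ofReal, mehta, ← integral_const_mul]
  simp only [ofReal_realIntegrand]

lemma integral_gaussDensity : ∫ x, gaussDensity n x = 1 := by
  have h := gaussConst_mul_integral (n := n) (s := 1) one_pos
  rw [Real.sqrt_one, one_pow, inv_one] at h
  simp only [gaussDensity, integral_const_mul]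
  exact h

lemma integrable_gaussDensity : Integrable (gaussDensity n) :=
  .of_integral_ne_zero (by rw [integral_gaussDensity]; norm_num)

lemma RootSys.le_integral (hR : RootSys R) {k : ℝ} (hk : 0 ≤ k) :
    1 + k * (R.card * logMoment) ≤ ∫ x, realIntegrand R k x := by
  have h1 : ∀ α ∈ R, (Integrable fun x => 2 * Real.log |dotR α x| * gaussDensity n x) ∧
      ∫ x, 2 * Real.log |dotR α x| * gaussDensity n x = logMoment := fun α hα =>
    integral_comp_dotR (hR.norm2 α hα) (f := fun t => 2 * Real.log |t|) integrable_log
  have h2 := integrable_finsetSum R fun α hα => (h1 α hα).1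
  have h3 : R.card * logMoment = ∫ x, ∑ α ∈ R, 2 * Real.log |dotR α x| * gaussDensity n x := by
    rw [integral_finsetSum R fun α hα => (h1 α hα).1, sum_congr rfl fun α hα => (h1 α hα).2,
      sum_const, nsmul_eq_mul]
  rw [h3, ← integral_const_mul, ← integral_gaussDensity (n := n),
    ← integral_add integrable_gaussDensity (h2.const_mul k)]
  refine integral_mono_ae (integrable_gaussDensity.add (h2.const_mul k))
    (integrable_realIntegrand R hk) ?_
  filter_upwards [hR.ae_regular] with x hx
  have h4 : ∏ α ∈ R, |dotR α x| ^ (2 * k) = Real.exp (k * ∑ α ∈ R, 2 * Real.log |dotR α x|) := by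
    rw [mul_sum, Real.exp_sum]
    exact prod_congr rfl fun α hα => rpow_abs_eq (hx α hα) k
  rw [realIntegrand, h4, ← sum_mul]
  have := mul_le_mul_of_nonneg_right
    (Real.add_one_le_exp (k * ∑ α ∈ R, 2 * Real.log |dotR α x|)) (gaussDensity_pos x).le
  linarith

lemma RootSys.integral_le (hR : RootSys R) {k : ℝ} (hk : 0 ≤ k) :
    ∫ x, realIntegrand R k x ≤ momentFun (R.card * k) := by
  rcases R.eq_empty_or_nonempty with h0 | h0
  · subst h0
    simp [realIntegrand, integral_gaussDensity, momentFun_zero]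
  have hN : (0 : ℝ) < R.card := by exact_mod_cast h0.card_pos
  have hs : -(1 / 2) < R.card * k := by have := mul_nonneg hN.le hk; linarith
  have h1 : ∀ α ∈ R, (Integrable fun x => |dotR α x| ^ (2 * (R.card * k)) * gaussDensity n x) ∧
      ∫ x, |dotR α x| ^ (2 * (R.card * k)) * gaussDensity n x = momentFun (R.card * k) :=
    fun α hα => by
      have := integral_comp_dotR (hR.norm2 α hα) (f := fun t => |t| ^ (2 * (R.card * k)))
        (integrable_moment hs)
      rwa [integral_moment hs] at this
  have h2 := integrable_finsetSum R fun α hα => (h1 α hα).1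
  have h3 : momentFun (R.card * k) = ∫ x, (R.card : ℝ)⁻¹ *
      ∑ α ∈ R, |dotR α x| ^ (2 * (R.card * k)) * gaussDensity n x := by
    rw [integral_const_mul, integral_finsetSum R fun α hα => (h1 α hα).1,
      sum_congr rfl fun α hα => (h1 α hα).2, sum_const, nsmul_eq_mul, inv_mul_cancel_left₀ hN.ne']
  rw [h3]
  refine integral_mono (integrable_realIntegrand R hk) (h2.const_mul _) fun x => ?_
  simp only [realIntegrand]
  rw [← sum_mul, ← mul_assoc]
  refine mul_le_mul_of_nonneg_right ?_ (gaussDensity_pos x).le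
  have h4 := Real.geom_mean_le_arith_mean_weighted R (fun _ => (R.card : ℝ)⁻¹)
    (fun α => |dotR α x| ^ (2 * (R.card * k))) (fun _ _ => by positivity)
    (by rw [sum_const, nsmul_eq_mul, mul_inv_cancel₀ hN.ne']) (fun _ _ => by positivity)
  rw [mul_sum]
  refine le_trans (le_of_eq (prod_congr rfl fun α _ => ?_)) h4
  rw [← Real.rpow_mul (abs_nonneg _)]
  congr 1
  field_simp

/-- The Macdonald–Mehta formula. -/
lemma mehta_eq_gammaProd (C : CoxeterData n) {k : ℂ} (hk : 0 ≤ k.re) :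
    mehta C.R k 1 = gammaProd C k := by
  obtain ⟨a, ha⟩ := exists_mehta_eq C
  have hreal : ∀ k : ℝ, 0 < k →
      ∫ x, realIntegrand C.R k x = gammaProdReal C k * Real.exp (a * k) := fun k hk => by
    have := ha k (by simpa using hk.le)
    rw [mehta_ofReal_left, gammaProd_ofReal] at this
    exact_mod_cast this
  set g := deriv Real.Gamma 1 with hg
  have hexp : HasDerivAt (fun k => Real.exp (a * k)) a 0 := by
    simpa using ((hasDerivAt_id (0 : ℝ)).const_mul a).exp
  have hH : HasDerivAt (fun k => gammaProdReal C k * Real.exp (a * k)) (C.R.card * g + a) 0 := by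
    simpa [gammaProdReal_zero] using (hasDerivAt_gammaProdReal C).fun_mul hexp
  have hlin : HasDerivAt (fun k : ℝ => 1 + k * (C.R.card * logMoment)) (C.R.card * g) 0 := by
    simpa [logMoment_eq] using
      ((hasDerivAt_id (0 : ℝ)).mul_const (C.R.card * logMoment)).const_add 1
  have hF : HasDerivAt (fun k : ℝ => momentFun (C.R.card * k)) (g * C.R.card) 0 := by
    have h1 : HasDerivAt (fun s : ℝ => (C.R.card : ℝ) * s) C.R.card 0 := by
      simpa using (hasDerivAt_id (0 : ℝ)).const_mul (C.R.card : ℝ)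
    exact HasDerivAt.comp (h₂ := momentFun) 0 (by simpa using hasDerivAt_momentFun) h1
  have h1 := deriv_nonneg_of_nonneg_right (hH.fun_sub hlin) (by simp [gammaProdReal_zero])
    fun k hk => by
      have := C.rootSys.le_integral hk.le
      rw [hreal k hk] at this
      simpa using this
  have h2 := deriv_nonneg_of_nonneg_right (hF.fun_sub hH) (by simp [gammaProdReal_zero, momentFun_zero])
    fun k hk => by
      have := C.rootSys.integral_le hk.le
      rw [hreal k hk] at this
      simpa using this
  have ha0 : a = 0 := by linarith
  rw [ha k hk, ha0]
  simp

end

end MacdonaldMehta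

/-- The Macdonald-Mehta integral for a finite Coxeter group `W` with positive roots
normalised by `(α,α) = 2` and degrees `d_1, …, d_n`:
`(2π)^{-n/2} ∫_{ℝ^n} ∏_{α∈R_+} |(α,x)|^{2k} e^{-|x|²/2} dx = ∏_j Γ(1+k d_j)/Γ(1+k)`. -/
theorem macdonald_mehta (n : ℕ) (C : CoxeterData n) (k : ℂ) (hk : 0 ≤ k.re) :
    ((2 * Real.pi : ℝ) : ℂ) ^ (-(n : ℂ) / 2) *
      ∫ x : Fin n → ℝ,
        (∏ α ∈ C.R, ((|dotR α x| : ℝ) : ℂ) ^ (2 * k)) *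
        Complex.exp (-(∑ i, ((x i : ℂ)) ^ 2) / 2)
      = ∏ j, Complex.Gamma (1 + k * (C.d j)) / Complex.Gamma (1 + k) := by
  have h := MacdonaldMehta.mehta_eq_gammaProd C hk
  rw [MacdonaldMehta.gammaProd] at h
  rw [← h, MacdonaldMehta.mehta]
  have hc : ((2 * Real.pi : ℝ) : ℂ) ^ (-(n : ℂ) / 2) = MacdonaldMehta.gaussConst n := by
    have h2 : (0 : ℝ) ≤ 2 * Real.pi := by positivity
    rw [show (-(n : ℂ) / 2) = ((-(n : ℝ) / 2 : ℝ) : ℂ) by push_cast; rfl,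
      ← Complex.ofReal_cpow h2, MacdonaldMehta.gaussConst]
    congr 1
    rw [Real.sqrt_eq_rpow, ← Real.rpow_natCast, ← Real.rpow_mul h2, ← Real.rpow_neg h2]
    congr 1; ring
  rw [hc]
  congr 1
  refine integral_congr_ae (.of_forall fun x => ?_)
  simp only [MacdonaldMehta.phi, MacdonaldMehta.dotR_self_eq, one_mul]
  push_cast
  rfl
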